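/- For p ∈ (1,∞), the nontrivial closed subspaces of L^p(ℝ) that are invariant under every operator of A_par^p are exactly the subspaces L^p[t,∞) for t ∈ ℝ together with the subspaces K_{λ,s}^p = e^{iλx} e^{−isx²/2} H^p(ℝ) for λ ∈ ℝ and s ≥ 0. That is, Lat A_par^p = {0, L^p(ℝ)} ∪ {L^p[t,∞) : t ∈ ℝ} ∪ {e^{iλx}e^{−isx²/2}H^p(ℝ) : λ ∈ ℝ, s ≥ 0}. -/

import Mathlib

open MeasureTheory Complex Filter Topology
open scoped ENNReal NNReal

noncomputable section

/-- `L^p(ℝ)` with complex values. -/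
abbrev LpR (p : ℝ≥0∞) := MeasureTheory.Lp ℂ p (volume : Measure ℝ)

/-- The Bochner space `L^p(ℝ; L^q(ℝ))`. -/
abbrev LpLq (p q : ℝ≥0∞) [Fact (1 ≤ q)] := MeasureTheory.Lp (LpR q) p (volume : Measure ℝ)

/-- `T` is the operator of multiplication by `φ`. -/
def IsMulOp (p : ℝ≥0∞) [Fact (1 ≤ p)] (φ : ℝ → ℂ) (T : LpR p →L[ℂ] LpR p) : Prop :=
  ∀ f : LpR p, (T f : ℝ → ℂ) =ᵐ[volume] fun x => φ x * (f : ℝ → ℂ) x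

/-- `T` is the operator of translation by `μ`: `(T f)(x) = f (x - μ)`. -/
def IsTransOp (p : ℝ≥0∞) [Fact (1 ≤ p)] (μ : ℝ) (T : LpR p →L[ℂ] LpR p) : Prop :=
  ∀ f : LpR p, (T f : ℝ → ℂ) =ᵐ[volume] fun x => (f : ℝ → ℂ) (x - μ)

/-- A set of operators is closed in the strong operator topology (the topology of
pointwise norm convergence) if it contains every operator which is an SOT-limit point. -/
def IsSOTClosed (p : ℝ≥0∞) [Fact (1 ≤ p)] (S : Set (LpR p →L[ℂ] LpR p)) : Prop :=
  ∀ T : LpR p →L[ℂ] LpR p,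
    (⇑T ∈ closure ((fun A : LpR p →L[ℂ] LpR p => (A : LpR p → LpR p)) '' S)) → T ∈ S

/-- The generators of the parabolic algebra: multiplications `M_λ`, `λ ≥ 0`, and
translations `D_μ`, `μ ≥ 0`. -/
def parabolicGens (p : ℝ≥0∞) [Fact (1 ≤ p)] : Set (LpR p →L[ℂ] LpR p) :=
  {T | ∃ l : ℝ, 0 ≤ l ∧ IsMulOp p (fun x => Complex.exp (Complex.I * l * x)) T} ∪
  {T | ∃ m : ℝ, 0 ≤ m ∧ IsTransOp p m T}

/-- The parabolic algebra: the smallest SOT-closed subalgebra of `B(L^p(ℝ))` containing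
the multiplication semigroup and the translation semigroup. -/
def parabolicAlgebra (p : ℝ≥0∞) [Fact (1 ≤ p)] : Set (LpR p →L[ℂ] LpR p) :=
  ⋂₀ {S | parabolicGens p ⊆ S ∧ IsSOTClosed p S ∧
      ∃ A : Subalgebra ℂ (LpR p →L[ℂ] LpR p), (A : Set (LpR p →L[ℂ] LpR p)) = S}

/-- The Hardy space `H^p(ℝ)`, as a subset of `L^p(ℝ)`. -/
def hardy (p : ℝ≥0∞) [Fact (1 ≤ p)] : Set (LpR p) :=
  {f | ∀ u : ℂ, 0 < u.im → ∫ x : ℝ, (f : ℝ → ℂ) x / ((x : ℂ) + u) = 0}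

/-- `L^p[t,∞)`, the subspace of functions vanishing a.e. on `(-∞, t)`. -/
def LpHalfLine (p : ℝ≥0∞) [Fact (1 ≤ p)] (t : ℝ) : Set (LpR p) :=
  {f | ∀ᵐ x : ℝ, x < t → (f : ℝ → ℂ) x = 0}

/-- The image of the Hardy space under multiplication by the function `φ`. -/
def mulHardy (p : ℝ≥0∞) [Fact (1 ≤ p)] (φ : ℝ → ℂ) : Set (LpR p) :=
  {g | ∃ f ∈ hardy p, (g : ℝ → ℂ) =ᵐ[volume] fun x => φ x * (f : ℝ → ℂ) x}

/-- The Fourier binest algebra: operators leaving invariant each `L^p[t,∞)` and each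
`e^{iλx}H^p(ℝ)`. -/
def fourierBinest (p : ℝ≥0∞) [Fact (1 ≤ p)] : Set (LpR p →L[ℂ] LpR p) :=
  {T | (∀ t : ℝ, ∀ f ∈ LpHalfLine p t, T f ∈ LpHalfLine p t) ∧
       (∀ l : ℝ, ∀ f ∈ mulHardy p (fun x => Complex.exp (Complex.I * l * x)),
          T f ∈ mulHardy p (fun x => Complex.exp (Complex.I * l * x)))}

/-- `T` is the `(p,q)`-integral operator with kernel `k`. -/
def IsIntOp (p q : ℝ≥0∞) [Fact (1 ≤ p)] [Fact (1 ≤ q)] (k : LpLq p q)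
    (T : LpR p →L[ℂ] LpR p) : Prop :=
  ∀ f : LpR p, (T f : ℝ → ℂ) =ᵐ[volume]
    fun x => ∫ y : ℝ, ((k : ℝ → LpR q) x : ℝ → ℂ) y * (f : ℝ → ℂ) y

/-- `G^p`, the set of `(p,q)`-integral operators on `L^p(ℝ)`. -/
def Gp (p q : ℝ≥0∞) [Fact (1 ≤ p)] [Fact (1 ≤ q)] : Set (LpR p →L[ℂ] LpR p) :=
  {T | ∃ k : LpLq p q, IsIntOp p q k T}

open scoped ComplexConjugate

section

/-- The character `x ↦ e^{iλx}`. -/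
def chr (l : ℝ) (x : ℝ) : ℂ := Complex.exp (Complex.I * l * x)

/-- The resolvent weight `x ↦ (x + u)⁻¹`. -/
def wt (u : ℂ) (x : ℝ) : ℂ := ((x : ℂ) + u)⁻¹

lemma continuous_chr (l : ℝ) : Continuous (chr l) := by unfold chr; fun_prop

lemma norm_chr (l x : ℝ) : ‖chr l x‖ = 1 := by
  have : Complex.I * l * x = ((l * x : ℝ) : ℂ) * Complex.I := by push_cast; ring
  rw [chr, this, Complex.norm_exp_ofReal_mul_I]

lemma add_ne_zero_of_im {u : ℂ} (hu : u.im ≠ 0) (x : ℝ) : (x : ℂ) + u ≠ 0 := by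
  intro h
  apply hu
  simpa using congrArg Complex.im h

lemma continuous_wt {u : ℂ} (hu : u.im ≠ 0) : Continuous (wt u) := by
  unfold wt
  exact (by fun_prop : Continuous fun x : ℝ => (x : ℂ) + u).inv₀ (add_ne_zero_of_im hu)

lemma wt_ne_zero {u : ℂ} (hu : u.im ≠ 0) (x : ℝ) : wt u x ≠ 0 :=
  inv_ne_zero (add_ne_zero_of_im hu x)

lemma norm_wt_le {u : ℂ} (hu : u.im ≠ 0) (x : ℝ) : ‖wt u x‖ ≤ |u.im|⁻¹ := by
  rw [wt, norm_inv]
  apply inv_anti₀ (abs_pos.2 hu)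
  simpa using Complex.abs_im_le_norm ((x : ℂ) + u)

lemma memLp_top_of_bdd {f : ℝ → ℂ} (hf : AEStronglyMeasurable f volume) (C : ℝ)
    (h : ∀ x, ‖f x‖ ≤ C) : MemLp f ⊤ volume :=
  memLp_top_of_bound hf C (Eventually.of_forall h)

lemma memLp_chr (l : ℝ) : MemLp (chr l) ⊤ volume :=
  memLp_top_of_bdd (continuous_chr l).aestronglyMeasurable 1 fun x => (norm_chr l x).le

lemma memLp_wt_top {u : ℂ} (hu : u.im ≠ 0) : MemLp (wt u) ⊤ volume :=
  memLp_top_of_bdd (continuous_wt hu).aestronglyMeasurable _ (norm_wt_le hu)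

lemma memLp_wt_I {r : ℝ≥0∞} (hr : 1 < r) : MemLp (wt Complex.I) r volume := by
  have hI : Complex.I.im ≠ 0 := by simp
  rcases eq_or_ne r ⊤ with rfl | hr'
  · exact memLp_wt_top hI
  have h1 : 1 < r.toReal := by
    simpa using (ENNReal.toReal_lt_toReal (by simp) hr').2 hr
  have hr0 : r ≠ 0 := (zero_lt_one.trans hr).ne'
  rw [← integrable_norm_rpow_iff (continuous_wt hI).aestronglyMeasurable hr0 hr']
  have := integrable_rpow_neg_one_add_norm_sq (E := ℝ) (μ := volume) (r := r.toReal)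
    (by simpa using h1)
  refine this.congr (Eventually.of_forall fun x => ?_)
  have h2 : ‖wt Complex.I x‖ = (1 + ‖x‖ ^ 2) ^ (-(1:ℝ)/2) := by
    rw [wt, norm_inv, Complex.norm_eq_sqrt_sq_add_sq]
    simp only [add_re, ofReal_re, I_re, add_zero, add_im, ofReal_im, I_im, zero_add, one_pow,
      Real.norm_eq_abs, sq_abs]
    rw [neg_div, Real.rpow_neg (by positivity), Real.sqrt_eq_rpow, add_comm]
  simp only
  rw [h2, ← Real.rpow_mul (by positivity)]
  congr 1
  ring

lemma wt_sub {u v : ℂ} (hu : u.im ≠ 0) (hv : v.im ≠ 0) (x : ℝ) :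
    wt u x - wt v x = (v - u) * (wt u x * wt v x) := by
  have := add_ne_zero_of_im hu x
  have := add_ne_zero_of_im hv x
  unfold wt
  field_simp
  ring

lemma memLp_wt {u : ℂ} (hu : u.im ≠ 0) {r : ℝ≥0∞} (hr : 1 < r) : MemLp (wt u) r volume := by
  have hI : Complex.I.im ≠ 0 := by simp
  have h1 : MemLp (fun x => (1 + (Complex.I - u) * wt u x) * wt Complex.I x) r volume := by
    have h2 : MemLp (fun x => 1 + (Complex.I - u) * wt u x) ⊤ volume :=
      (memLp_top_const (1:ℂ)).add ((memLp_wt_top hu).const_mul _)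
    exact (memLp_wt_I hr).mul h2
  refine h1.ae_eq (Eventually.of_forall fun x => ?_)
  have := wt_sub hu hI x
  linear_combination -this

section Ops

variable (p : ℝ≥0∞) [Fact (1 ≤ p)]

/-- Multiplication by a bounded function, as an operator on `L^p(ℝ)`. -/
def mulOp (φ : ℝ → ℂ) (hφ : MemLp φ ⊤ (volume : Measure ℝ)) : LpR p →L[ℂ] LpR p :=
  haveI : Fact ((1:ℝ≥0∞) ≤ ⊤) := ⟨le_top⟩
  (ContinuousLinearMap.mul ℂ ℂ).holderL volume ⊤ p p hφ.toLp

lemma coe_mulOp {φ : ℝ → ℂ} (hφ : MemLp φ ⊤ (volume : Measure ℝ)) (f : LpR p) :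
    mulOp p φ hφ f =ᵐ[volume] fun x => φ x * f x := by
  have h := (ContinuousLinearMap.mul ℂ ℂ).coeFn_holder (r := p) (hφ.toLp) f
  have : mulOp p φ hφ f = (ContinuousLinearMap.mul ℂ ℂ).holder p hφ.toLp f := rfl
  rw [this]
  filter_upwards [h, hφ.coeFn_toLp] with x h1 h2
  rw [h1, h2]; rfl

/-- Translation by `m`, as an operator on `L^p(ℝ)`. -/
def transOp (m : ℝ) : LpR p →L[ℂ] LpR p :=
  (Lp.compMeasurePreservingₗᵢ ℂ (fun x : ℝ => x - m)
    (measurePreserving_sub_right volume m)).toContinuousLinearMap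

lemma coe_transOp (m : ℝ) (f : LpR p) :
    transOp p m f =ᵐ[volume] fun x => f (x - m) :=
  Lp.coeFn_compMeasurePreserving f (measurePreserving_sub_right volume m)

/-- Multiplication by `e^{iλx}`. -/
abbrev chrOp (l : ℝ) : LpR p →L[ℂ] LpR p := mulOp p (chr l) (memLp_chr l)

variable {p}

/-- Invariance under the two semigroups. -/
def SemiInv (K : Set (LpR p)) : Prop :=
  (∀ l : ℝ, 0 ≤ l → ∀ f ∈ K, chrOp p l f ∈ K) ∧ (∀ m : ℝ, 0 ≤ m → ∀ f ∈ K, transOp p m f ∈ K)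

lemma chrOp_mem_parabolicAlgebra {l : ℝ} (hl : 0 ≤ l) : chrOp p l ∈ parabolicAlgebra p := by
  rintro S ⟨hS, -, -⟩
  exact hS (Or.inl ⟨l, hl, fun f => coe_mulOp p (memLp_chr l) f⟩)

lemma transOp_mem_parabolicAlgebra {m : ℝ} (hm : 0 ≤ m) : transOp p m ∈ parabolicAlgebra p := by
  rintro S ⟨hS, -, -⟩
  exact hS (Or.inr ⟨m, hm, fun f => coe_transOp p m f⟩)

lemma inv_iff (K : Submodule ℂ (LpR p)) (hK : IsClosed (K : Set (LpR p))) :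
    (∀ T ∈ parabolicAlgebra p, ∀ f ∈ K, T f ∈ K) ↔ SemiInv (K : Set (LpR p)) := by
  constructor
  · intro h
    exact ⟨fun l hl f hf => h _ (chrOp_mem_parabolicAlgebra hl) f hf,
      fun m hm f hf => h _ (transOp_mem_parabolicAlgebra hm) f hf⟩
  · rintro ⟨h1, h2⟩ T hT
    let A : Subalgebra ℂ (LpR p →L[ℂ] LpR p) :=
      { carrier := {T | ∀ f ∈ K, T f ∈ K}
        mul_mem' := fun {S T} hS hT f hf => hS _ (hT f hf)
        add_mem' := fun {S T} hS hT f hf => K.add_mem (hS f hf) (hT f hf)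
        algebraMap_mem' := fun c f hf => by
          rw [Algebra.algebraMap_eq_smul_one]
          exact K.smul_mem c hf }
    refine hT (A : Set _) ⟨?_, ?_, A, rfl⟩
    · rintro T (⟨l, hl, hT⟩ | ⟨m, hm, hT⟩) f hf
      · have : T f = chrOp p l f :=
          Lp.ext ((hT f).trans (coe_mulOp p (memLp_chr l) f).symm)
        rw [this]; exact h1 l hl f hf
      · have : T f = transOp p m f :=
          Lp.ext ((hT f).trans (coe_transOp p m f).symm)
        rw [this]; exact h2 m hm f hf
    · intro T hT f hf
      have hc : IsClosed {F : LpR p → LpR p | F f ∈ K} := hK.preimage (continuous_apply f)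
      exact closure_minimal (by rintro _ ⟨S, hS, rfl⟩; exact hS f hf) hc hT

/-- Integration against a weight in the conjugate space. -/
lemma exists_pairing {q : ℝ≥0∞} [p.HolderConjugate q] {w : ℝ → ℂ} (hw : MemLp w q volume) :
    ∃ T : LpR p →L[ℂ] ℂ, ∀ f : LpR p, T f = ∫ x, f x * w x := by
  have : Fact (1 ≤ q) := ⟨ENNReal.HolderConjugate.one_le q p⟩
  refine ⟨((ContinuousLinearMap.mul ℂ ℂ).lpPairing volume p q).flip hw.toLp, fun f => ?_⟩
  rw [ContinuousLinearMap.flip_apply, ContinuousLinearMap.lpPairing_eq_integral]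
  apply integral_congr_ae
  filter_upwards [hw.coeFn_toLp] with x h
  rw [h]; rfl

end Ops

end

section

/-- The vanishing condition that defines the Hardy space. -/
def HardyVanish (f : ℝ → ℂ) : Prop := ∀ u : ℂ, 0 < u.im → ∫ x : ℝ, f x * wt u x = 0

lemma one_lt_conjExponent {p : ℝ≥0∞} (hp : p ≠ ⊤) : 1 < p.conjExponent := by
  unfold ENNReal.conjExponent
  refine ENNReal.lt_add_right (by simp) ?_
  exact ENNReal.inv_ne_zero.2 (ENNReal.sub_ne_top hp)

lemma integrable_mul_of_memLp {p : ℝ≥0∞} (h1 : 1 ≤ p) (hp : p ≠ ⊤) {f w : ℝ → ℂ}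
    (hf : MemLp f p volume) (hw : ∀ q : ℝ≥0∞, 1 < q → MemLp w q volume) :
    Integrable (fun x => f x * w x) volume := by
  have : p.HolderConjugate p.conjExponent := ENNReal.HolderConjugate.conjExponent h1
  have : ENNReal.HolderTriple p p.conjExponent 1 := this
  exact memLp_one_iff_integrable.1 ((hw _ (one_lt_conjExponent hp)).mul' hf)

lemma integrable_mul_wt {p : ℝ≥0∞} (h1 : 1 ≤ p) (hp : p ≠ ⊤) {f : ℝ → ℂ}
    (hf : MemLp f p volume) {u : ℂ} (hu : u.im ≠ 0) :
    Integrable (fun x => f x * wt u x) volume :=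
  integrable_mul_of_memLp h1 hp hf fun _ hq => memLp_wt hu hq

lemma HardyVanish.congr {f g : ℝ → ℂ} (hf : HardyVanish f) (h : f =ᵐ[volume] g) :
    HardyVanish g := by
  intro u hu
  rw [← hf u hu]
  apply integral_congr_ae
  filter_upwards [h] with x hx
  rw [hx]

lemma HardyVanish.const_mul {f : ℝ → ℂ} (hf : HardyVanish f) (c : ℂ) :
    HardyVanish fun x => c * f x := by
  intro u hu
  simp only [mul_assoc, integral_const_mul, hf u hu, mul_zero]

lemma HardyVanish.mul_wt {p : ℝ≥0∞} (h1 : 1 ≤ p) (hp : p ≠ ⊤) {f : ℝ → ℂ}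
    (hf : MemLp f p volume) (hv : HardyVanish f) {v : ℂ} (him : 0 < v.im) :
    HardyVanish fun x => f x * wt v x := by
  have key : ∀ u : ℂ, 0 < u.im → u ≠ v → ∫ x : ℝ, f x * wt v x * wt u x = 0 := by
    intro u hu huv
    have h2 : ∀ x : ℝ, f x * wt v x * wt u x = (u - v)⁻¹ * (f x * wt v x - f x * wt u x) := by
      intro x
      have h3 := wt_sub him.ne' hu.ne' x
      have h4 : u - v ≠ 0 := sub_ne_zero.2 huv
      rw [← mul_sub, h3]
      field_simp
    simp_rw [h2]
    rw [integral_const_mul, integral_sub (integrable_mul_wt h1 hp hf him.ne')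
      (integrable_mul_wt h1 hp hf hu.ne'), hv v him, hv u hu]
    simp
  intro u hu
  by_cases huv : u = v
  swap
  · exact key u hu huv
  subst huv
  let w : ℕ → ℂ := fun n => u + ((1 / ((n : ℝ) + 1) : ℝ) : ℂ) * Complex.I
  have hwim : ∀ n, (w n).im = u.im + 1 / ((n : ℝ) + 1) := by
    intro n
    simp only [w, add_im, mul_im, ofReal_re, I_im, ofReal_im, I_re]; ring
  have hpos : ∀ n : ℕ, 0 < 1 / ((n : ℝ) + 1) := fun n => by positivity
  have hw0 : ∀ n, 0 < (w n).im := fun n => by rw [hwim]; have := hpos n; linarith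
  have hwne : ∀ n, w n ≠ u := fun n h => by
    have := congrArg Complex.im h
    rw [hwim] at this
    have := hpos n; linarith
  have hwlim : Tendsto w atTop (𝓝 u) := by
    have h3 := (Complex.continuous_ofReal.tendsto 0).comp
      (tendsto_one_div_add_atTop_nhds_zero_nat (𝕜 := ℝ))
    have := (h3.mul_const Complex.I).const_add u
    simpa [w] using this
  have hlim : Tendsto (fun n => ∫ x : ℝ, f x * wt u x * wt (w n) x) atTop
      (𝓝 (∫ x : ℝ, f x * wt u x * wt u x)) := by
    refine tendsto_integral_of_dominated_convergence (fun x => ‖f x * wt u x‖ * |u.im|⁻¹) ?_ ?_ ?_ ?_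
    · intro n
      exact (integrable_mul_wt h1 hp hf hu.ne').aestronglyMeasurable.mul
        (continuous_wt (hw0 n).ne').aestronglyMeasurable
    · exact (integrable_mul_wt h1 hp hf hu.ne').norm.mul_const _
    · intro n
      refine Eventually.of_forall fun x => ?_
      rw [norm_mul]
      refine mul_le_mul_of_nonneg_left ((norm_wt_le (hw0 n).ne' x).trans ?_) (norm_nonneg _)
      refine inv_anti₀ (abs_pos.2 hu.ne') ?_
      rw [abs_of_pos hu, abs_of_pos (hw0 n), hwim]
      have := hpos n; linarith
    · refine Eventually.of_forall fun x => Tendsto.const_mul _ ?_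
      exact (hwlim.const_add (x : ℂ)).inv₀ (add_ne_zero_of_im hu.ne' x)
  have : (fun n => ∫ x : ℝ, f x * wt u x * wt (w n) x) = fun _ => 0 :=
    funext fun n => key _ (hw0 n) (hwne n)
  rw [this] at hlim
  exact tendsto_nhds_unique hlim tendsto_const_nhds

lemma memLp_mul_bdd {p : ℝ≥0∞} {f w : ℝ → ℂ} (hf : MemLp f p volume)
    (hw : MemLp w ⊤ volume) : MemLp (fun x => f x * w x) p volume := hw.mul' hf

lemma memLp_bdd_mul {p : ℝ≥0∞} {f w : ℝ → ℂ} (hf : MemLp f p volume)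
    (hw : MemLp w ⊤ volume) : MemLp (fun x => w x * f x) p volume := hf.mul' hw

lemma HardyVanish.chr_mul {p : ℝ≥0∞} (h1 : 1 ≤ p) (hp : p ≠ ⊤) {f : ℝ → ℂ}
    (hf : MemLp f p volume) (hv : HardyVanish f) {l : ℝ} (hl : 0 ≤ l) :
    HardyVanish fun x => chr l x * f x := by
  rcases hl.eq_or_lt with rfl | hl
  · exact hv.congr (Eventually.of_forall fun x => by simp [chr])
  let a : ℕ → ℝ → ℂ := fun n x => (1 - Complex.I * l * x / ((n : ℂ) + 1))⁻¹
  have ha : ∀ n x, a n x = (((n + 1) / l : ℝ) * Complex.I) *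
      wt ((((n + 1) / l : ℝ) : ℂ) * Complex.I) x := by
    intro n x
    have h0 : ((((n + 1) / l : ℝ) : ℂ) * Complex.I).im ≠ 0 := by
      have : 0 < (n + 1) / l := by positivity
      simpa using this.ne'
    have h2 := add_ne_zero_of_im h0 x
    have hl' : (l : ℂ) ≠ 0 := by exact_mod_cast hl.ne'
    have hn : (n : ℂ) + 1 ≠ 0 := by exact_mod_cast n.succ_ne_zero
    simp only [a, wt]
    have h3 : ((((n + 1) / l : ℝ) : ℂ) * Complex.I) ≠ 0 := by
      intro h
      rw [h] at h0; simp at h0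
    have h4 : (1 - Complex.I * l * x / ((n : ℂ) + 1)) =
      ((x : ℂ) + (((n + 1) / l : ℝ) : ℂ) * Complex.I) / ((((n + 1) / l : ℝ) : ℂ) * Complex.I) := by
      rw [eq_div_iff h3]
      push_cast
      field_simp
      linear_combination (-l * x : ℂ) * Complex.I_sq
    rw [h4, inv_div, div_eq_mul_inv]
  have hanorm : ∀ n x, ‖a n x‖ ≤ 1 := by
    intro n x
    simp only [a]
    rw [norm_inv]
    apply inv_le_one_of_one_le₀
    have h4 : (1 - Complex.I * l * x / ((n : ℂ) + 1)) =
      1 - ((l * x / (n + 1) : ℝ) : ℂ) * Complex.I := by push_cast; ring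
    rw [h4]
    generalize l * x / (n + 1) = c
    have := Complex.abs_re_le_norm (1 - (c : ℂ) * Complex.I)
    simpa using this
  have hpow : ∀ n k, MemLp (fun x => f x * a n x ^ k) p volume ∧
      HardyVanish fun x => f x * a n x ^ k := by
    intro n k
    have h0 : 0 < ((((n + 1) / l : ℝ) : ℂ) * Complex.I).im := by
      have : 0 < (n + 1) / l := by positivity
      simpa using this
    induction k with
    | zero => simpa using ⟨hf, hv⟩
    | succ k ih =>
      have e : (fun x => f x * a n x ^ (k + 1)) = fun x => (((n + 1) / l : ℝ) * Complex.I) *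
          ((f x * a n x ^ k) * wt ((((n + 1) / l : ℝ) : ℂ) * Complex.I) x) := by
        funext x
        rw [pow_succ, ha]; ring
      rw [e]
      exact ⟨(memLp_mul_bdd ih.1 (memLp_wt_top h0.ne')).const_mul _,
        (HardyVanish.mul_wt h1 hp ih.1 ih.2 h0).const_mul _⟩
  intro u hu
  have hlim : Tendsto (fun n => ∫ x : ℝ, f x * a n x ^ (n + 1) * wt u x) atTop
      (𝓝 (∫ x : ℝ, chr l x * f x * wt u x)) := by
    refine tendsto_integral_of_dominated_convergence (fun x => ‖f x * wt u x‖) ?_ ?_ ?_ ?_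
    · intro n
      exact (integrable_mul_wt h1 hp (hpow n (n + 1)).1 hu.ne').aestronglyMeasurable
    · exact (integrable_mul_wt h1 hp hf hu.ne').norm
    · intro n
      refine Eventually.of_forall fun x => ?_
      rw [norm_mul, norm_mul, norm_mul, norm_pow]
      gcongr
      exact mul_le_of_le_one_right (norm_nonneg _) (pow_le_one₀ (norm_nonneg _) (hanorm n x))
    · refine Eventually.of_forall fun x => Tendsto.mul_const _ ?_
      rw [mul_comm (chr l x)]
      refine Tendsto.const_mul _ ?_
      have h5 := (Complex.tendsto_one_add_div_pow_exp (-(Complex.I * l * x))).comp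
        (tendsto_add_atTop_nat 1)
      have h6 := h5.inv₀ (Complex.exp_ne_zero _)
      rw [← Complex.exp_neg, neg_neg] at h6
      refine h6.congr fun n => ?_
      simp only [a, Function.comp, inv_pow]
      push_cast
      rw [neg_div, ← sub_eq_add_neg]
  have : (fun n => ∫ x : ℝ, f x * a n x ^ (n + 1) * wt u x) = fun _ => 0 :=
    funext fun n => (hpow n (n + 1)).2 u hu
  rw [this] at hlim
  exact tendsto_nhds_unique hlim tendsto_const_nhds

lemma HardyVanish.comp_sub {f : ℝ → ℂ} (hv : HardyVanish f) (m : ℝ) :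
    HardyVanish fun x => f (x - m) := by
  intro u hu
  have h2 := hv (u + m) (by simpa using hu)
  rw [← integral_sub_right_eq_self _ m] at h2
  rw [← h2]
  refine integral_congr_ae (Eventually.of_forall fun x => ?_)
  simp only [wt]
  congr 2
  push_cast; ring

lemma mem_hardy_iff {p : ℝ≥0∞} [Fact (1 ≤ p)] (f : LpR p) : f ∈ hardy p ↔ HardyVanish f := by
  simp only [hardy, HardyVanish, wt, div_eq_mul_inv, Set.mem_ofPred_eq]

open scoped ComplexConjugate

lemma conj_mul_self_of_norm {z : ℂ} (hz : ‖z‖ = 1) : conj z * z = 1 := by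
  rw [Complex.conj_mul', hz]; simp

/-- Measurable functions of modulus one. -/
structure Unimod (φ : ℝ → ℂ) : Prop where
  meas : Measurable φ
  norm : ∀ x, ‖φ x‖ = 1

lemma Unimod.conj {φ : ℝ → ℂ} (h : Unimod φ) : Unimod fun x => conj (φ x) :=
  ⟨Complex.continuous_conj.measurable.comp h.meas, fun x => by simp [h.norm x]⟩

lemma Unimod.mul {φ ψ : ℝ → ℂ} (h : Unimod φ) (h' : Unimod ψ) : Unimod fun x => φ x * ψ x :=
  ⟨h.meas.mul h'.meas, fun x => by simp [h.norm x, h'.norm x]⟩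

lemma Unimod.comp_sub {φ : ℝ → ℂ} (h : Unimod φ) (m : ℝ) : Unimod fun x => φ (x - m) :=
  ⟨h.meas.comp (measurable_id.sub_const m), fun _ => h.norm _⟩

lemma Unimod.memLp_top {φ : ℝ → ℂ} (h : Unimod φ) : MemLp φ ⊤ volume :=
  memLp_top_of_bdd h.meas.aestronglyMeasurable 1 fun x => (h.norm x).le

lemma Unimod.conj_mul {φ : ℝ → ℂ} (h : Unimod φ) (x : ℝ) : conj (φ x) * φ x = 1 :=
  conj_mul_self_of_norm (h.norm x)

lemma mem_mulHardy_iff {p : ℝ≥0∞} [Fact (1 ≤ p)] {φ : ℝ → ℂ} (h : Unimod φ) (g : LpR p) :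
    g ∈ mulHardy p φ ↔ HardyVanish fun x => conj (φ x) * g x := by
  constructor
  · rintro ⟨f, hf, hg⟩
    refine ((mem_hardy_iff f).1 hf).congr ?_
    filter_upwards [hg] with x hx
    rw [hx, ← mul_assoc, h.conj_mul, one_mul]
  · intro hv
    have e := coe_mulOp p h.conj.memLp_top g
    refine ⟨mulOp p _ h.conj.memLp_top g, (mem_hardy_iff _).2 (hv.congr e.symm), ?_⟩
    filter_upwards [e] with x hx
    rw [hx, ← mul_assoc, mul_comm (φ x), h.conj_mul, one_mul]

/-- The function `e^{iλx}e^{-isx²/2}`. -/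
def parab (l s : ℝ) (x : ℝ) : ℂ :=
  Complex.exp (Complex.I * l * x) * Complex.exp (-(Complex.I * s * x ^ 2) / 2)

lemma unimod_parab (l s : ℝ) : Unimod (parab l s) := by
  refine ⟨by unfold parab; fun_prop, fun x => ?_⟩
  rw [parab, norm_mul]
  have h1 : ‖Complex.exp (Complex.I * l * x)‖ = 1 := norm_chr l x
  have : -(Complex.I * s * x ^ 2) / 2 = ((-(s * x ^ 2) / 2 : ℝ) : ℂ) * Complex.I := by
    push_cast; ring
  rw [h1, this, Complex.norm_exp_ofReal_mul_I, one_mul]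

lemma parab_sub (l s m x : ℝ) : parab l s (x - m) =
    Complex.exp (-(Complex.I * l * m) - Complex.I * s * m ^ 2 / 2) *
      (chr (s * m) x * parab l s x) := by
  unfold parab chr
  rw [← Complex.exp_add, ← Complex.exp_add, ← Complex.exp_add, ← Complex.exp_add]
  congr 1
  push_cast
  ring

lemma semiInv_mulHardy {p : ℝ≥0∞} [Fact (1 ≤ p)] (hp : p ≠ ⊤) (l : ℝ) {s : ℝ} (hs : 0 ≤ s) :
    SemiInv (mulHardy p (parab l s)) := by
  have h1 : 1 ≤ p := Fact.out
  have hu := unimod_parab l s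
  constructor
  · intro r hr f hf
    rw [mem_mulHardy_iff hu] at hf ⊢
    have := hf.chr_mul h1 hp (memLp_bdd_mul (Lp.memLp f) hu.conj.memLp_top) hr
    refine this.congr ?_
    filter_upwards [coe_mulOp p (memLp_chr r) f] with x hx
    rw [hx]; ring
  · intro m hm f hf
    rw [mem_mulHardy_iff hu] at hf ⊢
    have h2 : MemLp (fun x => conj (parab l s (x - m)) * f (x - m)) p volume := by
      have := memLp_bdd_mul (Lp.memLp f) hu.conj.memLp_top
      exact this.comp_measurePreserving (measurePreserving_sub_right volume m)
    have := ((hf.comp_sub m).chr_mul h1 hp h2 (mul_nonneg hs hm)).const_mul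
      (Complex.exp (-(Complex.I * l * m) - Complex.I * s * m ^ 2 / 2))
    refine this.congr ?_
    filter_upwards [coe_transOp p m f] with x hx
    rw [hx]
    have e1 := parab_sub l s m x
    have e2 := hu.conj_mul x
    have e3 := hu.conj_mul (x - m)
    linear_combination (-conj (parab l s x) * conj (parab l s (x-m)) * f (x-m)) * e1
      + (conj (parab l s x) * f (x-m)) * e3
      - (Complex.exp (-(Complex.I * l * m) - Complex.I * s * m ^ 2 / 2) * chr (s*m) x *
        conj (parab l s (x-m)) * f (x-m)) * e2

lemma semiInv_halfLine {p : ℝ≥0∞} [Fact (1 ≤ p)] (t : ℝ) : SemiInv (LpHalfLine p t) := by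
  constructor
  · intro r hr f hf
    change ∀ᵐ x : ℝ, x < t → chrOp p r f x = 0
    filter_upwards [coe_mulOp p (memLp_chr r) f, hf] with x hx h hxt
    rw [hx, h hxt, mul_zero]
  · intro m hm f hf
    have h2 := (measurePreserving_sub_right volume m).quasiMeasurePreserving.ae hf
    change ∀ᵐ x : ℝ, x < t → transOp p m f x = 0
    filter_upwards [coe_transOp p m f, h2] with x hx h hxt
    rw [hx, h (by linarith)]

end

section

section

variable {p : ℝ≥0∞} [Fact (1 ≤ p)]

lemma norm_mulOp_le {φ : ℝ → ℂ} (hφ : MemLp φ ⊤ (volume : Measure ℝ)) {C : ℝ}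
    (hC : ∀ x, ‖φ x‖ ≤ C) (f : LpR p) : ‖mulOp p φ hφ f‖ ≤ C * ‖f‖ := by
  apply Lp.norm_le_mul_norm_of_ae_le_mul
  filter_upwards [coe_mulOp p hφ f] with x hx
  rw [hx, norm_mul]
  exact mul_le_mul_of_nonneg_right (hC x) (norm_nonneg _)

lemma tendsto_mulOp (hp : p ≠ ⊤) {ι : Type*} {l : Filter ι} [l.IsCountablyGenerated]
    {a : ι → ℝ → ℂ} (ha : ∀ i, MemLp (a i) ⊤ (volume : Measure ℝ)) {a₀ : ℝ → ℂ}
    (ha₀ : MemLp a₀ ⊤ (volume : Measure ℝ)) {C : ℝ} (hC : ∀ i x, ‖a i x‖ ≤ C)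
    (hC₀ : ∀ x, ‖a₀ x‖ ≤ C)
    (hlim : ∀ x, Tendsto (fun i => a i x) l (𝓝 (a₀ x))) (f : LpR p) :
    Tendsto (fun i => mulOp p (a i) (ha i) f) l (𝓝 (mulOp p a₀ ha₀ f)) := by
  have hp0 : p ≠ 0 := (zero_lt_one.trans_le (Fact.out : 1 ≤ p)).ne'
  have hpr : 0 < p.toReal := ENNReal.toReal_pos hp0 hp
  rw [Lp.tendsto_Lp_iff_tendsto_eLpNorm']
  have e : ∀ i, eLpNorm (⇑(mulOp p (a i) (ha i) f) - ⇑(mulOp p a₀ ha₀ f)) p volume =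
      (∫⁻ x, ‖(a i x - a₀ x) * f x‖ₑ ^ p.toReal) ^ (1 / p.toReal) := by
    intro i
    rw [← eLpNorm_eq_lintegral_rpow_enorm_toReal hp0 hp]
    apply eLpNorm_congr_ae
    filter_upwards [coe_mulOp p (ha i) f, coe_mulOp p ha₀ f] with x h1 h2
    rw [Pi.sub_apply, h1, h2, sub_mul]
  simp_rw [e]
  have h0 : (0 : ℝ≥0∞) = (∫⁻ _ : ℝ, 0) ^ (1 / p.toReal) := by
    rw [lintegral_zero, ENNReal.zero_rpow_of_pos (by positivity)]
  rw [h0]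
  refine Tendsto.ennrpow_const _ ?_
  have hfm : AEStronglyMeasurable f volume := Lp.aestronglyMeasurable f
  refine tendsto_lintegral_filter_of_dominated_convergence'
    (fun x => ‖((2 * C : ℝ) : ℂ) * f x‖ₑ ^ p.toReal) ?_ ?_ ?_ ?_
  · refine Eventually.of_forall fun i => ?_
    exact ((((ha i).1.sub ha₀.1).mul hfm).enorm).pow_const _
  · refine Eventually.of_forall fun i => Eventually.of_forall fun x => ?_
    refine ENNReal.rpow_le_rpow ?_ hpr.le
    rw [enorm_le_iff_norm_le, norm_mul, norm_mul]
    refine mul_le_mul_of_nonneg_right ?_ (norm_nonneg _)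
    have h3 := (norm_nonneg _).trans (hC₀ x)
    rw [Complex.norm_real, Real.norm_of_nonneg (by linarith)]
    calc _ ≤ ‖a i x‖ + ‖a₀ x‖ := norm_sub_le _ _
      _ ≤ _ := by linarith [hC i x, hC₀ x]
  · have h4 : MemLp (fun x => ((2 * C : ℝ) : ℂ) * f x) p volume := (Lp.memLp f).const_mul _
    have := h4.eLpNorm_lt_top
    rw [eLpNorm_eq_lintegral_rpow_enorm_toReal hp0 hp] at this
    intro h
    rw [h, ENNReal.top_rpow_of_pos (by positivity)] at this
    exact this.ne rfl
  · refine Eventually.of_forall fun x => ?_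
    have h5 : Tendsto (fun i => (a i x - a₀ x) * f x) l (𝓝 0) := by
      have := ((hlim x).sub_const (a₀ x)).mul_const (f x)
      simpa using this
    have h6 := (h5.enorm).ennrpow_const p.toReal
    simpa [ENNReal.zero_rpow_of_pos hpr] using h6

lemma continuous_chrOp (hp : p ≠ ⊤) (f : LpR p) : Continuous fun l => chrOp p l f := by
  rw [continuous_iff_continuousAt]
  intro l
  refine tendsto_mulOp hp (fun l => memLp_chr l) (memLp_chr l) (C := 1)
    (fun i x => (norm_chr i x).le) (fun x => (norm_chr l x).le) (fun x => ?_) f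
  have : Continuous fun l => chr l x := by unfold chr; fun_prop
  exact this.tendsto l

lemma continuous_transOp (hp : p ≠ ⊤) (f : LpR p) : Continuous fun m => transOp p m f := by
  refine Continuous.compMeasurePreservingLp (f := fun _ : ℝ => f)
    (g := fun m => (⟨fun x => x - m, by fun_prop⟩ : C(ℝ, ℝ))) continuous_const ?_
    (fun m => measurePreserving_sub_right volume m) hp
  refine ContinuousMap.continuous_of_continuous_uncurry _ ?_
  simp only [Function.uncurry_def, ContinuousMap.coe_mk]
  fun_prop

/-- A Bochner integral in `L^p` is computed pointwise. -/
lemma coe_integral_Lp (E : Measure ℝ) [SFinite E] {F : ℝ → LpR p} (hF : Integrable F E)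
    {G : ℝ → ℝ → ℂ} (hG : AEStronglyMeasurable (Function.uncurry G) (E.prod volume))
    (hFG : ∀ t, F t =ᵐ[volume] G t) :
    (∫ t, F t ∂E : LpR p) =ᵐ[volume] fun x => ∫ t, G t x ∂E := by
  have key : ∀ s : Set ℝ, MeasurableSet s → volume s < ∞ →
      Integrable (Function.uncurry G) (E.prod (volume.restrict s)) := by
    intro s hs hvs
    have hac : E.prod (volume.restrict s) ≪ E.prod volume :=
      Measure.AbsolutelyContinuous.prod .rfl Measure.restrict_le_self.absolutelyContinuous
    have : IsFiniteMeasure ((volume : Measure ℝ).restrict s) := ⟨by simpa using hvs⟩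
    rw [integrable_prod_iff (hG.mono_ac hac)]
    have hmem : ∀ t, MemLp (G t) p (volume.restrict s) := fun t =>
      ((Lp.memLp (F t)).ae_eq (hFG t)).restrict s
    refine ⟨Eventually.of_forall fun t => (hmem t).integrable Fact.out, ?_⟩
    let c : ℝ≥0∞ := (volume.restrict s) Set.univ ^ (1 / (1:ℝ≥0∞).toReal - 1 / p.toReal)
    have hc : c ≠ ⊤ := by
      refine ENNReal.rpow_ne_top_of_nonneg ?_ (measure_ne_top _ _)
      have h1 : 1 / p.toReal ≤ 1 := by
        rcases eq_or_ne p ⊤ with rfl | hp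
        · simp
        · rw [div_le_one]
          · simpa using (ENNReal.toReal_le_toReal (by simp) hp).2 (Fact.out : 1 ≤ p)
          · exact ENNReal.toReal_pos (zero_lt_one.trans_le (Fact.out : 1 ≤ p)).ne' hp
      simpa using h1
    refine Integrable.mono' (hF.norm.const_mul c.toReal) ?_ (Eventually.of_forall fun t => ?_)
    · exact ((hG.mono_ac hac).norm).integral_prod_right'
    · rw [Real.norm_of_nonneg (integral_nonneg fun _ => norm_nonneg _)]
      have h3 := eLpNorm_le_eLpNorm_mul_rpow_measure_univ (Fact.out : 1 ≤ p) (hmem t).1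
      have h4 : eLpNorm (G t) p (volume.restrict s) ≤ eLpNorm (F t) p volume := by
        rw [eLpNorm_congr_ae (hFG t)]
        exact eLpNorm_mono_measure _ Measure.restrict_le_self
      have h5 : ∫ x in s, ‖G t x‖ = (eLpNorm (G t) 1 (volume.restrict s)).toReal := by
        rw [eLpNorm_one_eq_lintegral_enorm, integral_norm_eq_lintegral_enorm (hmem t).1]
      change ∫ x in s, ‖G t x‖ ≤ _
      rw [h5, Lp.norm_def, mul_comm, ← ENNReal.toReal_mul]
      refine ENNReal.toReal_mono ?_ (h3.trans ?_)
      · exact ENNReal.mul_ne_top (Lp.eLpNorm_ne_top _) hc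
      · exact mul_le_mul_left h4 _
  have hgi : ∀ s : Set ℝ, MeasurableSet s → volume s < ∞ → ∀ f : LpR p, IntegrableOn f s := by
    intro s hs hvs f
    have : IsFiniteMeasure ((volume : Measure ℝ).restrict s) := ⟨by simpa using hvs⟩
    exact ((Lp.memLp f).restrict s).integrable Fact.out
  apply ae_eq_of_forall_setIntegral_eq_of_sigmaFinite
  · intro s hs hvs; exact hgi s hs hvs _
  · intro s hs hvs
    exact (key s hs hvs).integral_prod_right
  · intro s hs hvs
    have hw : MemLp (s.indicator fun _ => (1:ℂ)) p.conjExponent volume :=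
      memLp_indicator_const _ hs _ (Or.inr hvs.ne)
    obtain ⟨T, hT⟩ := exists_pairing (p := p) (q := p.conjExponent) hw
    have hT' : ∀ f : LpR p, T f = ∫ x in s, f x := by
      intro f
      rw [hT, ← integral_indicator hs]
      congr 1; funext x
      by_cases hx : x ∈ s <;> simp [hx]
    rw [← hT', ← T.integral_comp_comm hF, integral_integral_swap]
    · refine integral_congr_ae (Eventually.of_forall fun t => ?_)
      simp only
      rw [hT']
      exact integral_congr_ae (ae_restrict_of_ae (hFG t))
    · exact (key s hs hvs).swap

end

end

section

section

variable {p : ℝ≥0∞} [Fact (1 ≤ p)]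

lemma integral_mem_submodule {E : Measure ℝ} {K : Submodule ℂ (LpR p)}
    (hK : IsClosed (K : Set (LpR p))) {F : ℝ → LpR p} (hF : Integrable F E)
    (h : ∀ᵐ t ∂E, F t ∈ K) : ∫ t, F t ∂E ∈ K := by
  have : IsClosed (K : Set (LpR p)) := hK
  have h1 := K.mkQL.integral_comp_comm hF
  have h2 : ∫ t, K.mkQL (F t) ∂E = 0 := by
    rw [← integral_zero (G := LpR p ⧸ K) (μ := E)]
    apply integral_congr_ae
    filter_upwards [h] with t ht
    exact (Submodule.Quotient.mk_eq_zero K).2 ht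
  rw [h2] at h1
  exact (Submodule.Quotient.mk_eq_zero K).1 h1.symm

lemma exp_mul_I_integrable {v : ℂ} (hv : 0 < v.im) :
    IntegrableOn (fun s : ℝ => Complex.exp (Complex.I * v * s)) (Set.Ioi 0) := by
  exact integrableOn_exp_mul_complex_Ioi (by simpa using hv) 0

lemma integral_exp_mul_I {v : ℂ} (hv : 0 < v.im) (x : ℝ) :
    ∫ s in Set.Ioi (0:ℝ), Complex.exp (Complex.I * v * s) * chr s x = Complex.I * wt v x := by
  have h0 := integral_exp_mul_complex_Ioi (a := Complex.I * (v + x)) (by simpa using hv) 0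
  have e : ∀ s : ℝ, Complex.exp (Complex.I * v * s) * chr s x =
      Complex.exp (Complex.I * (v + x) * s) := by
    intro s
    rw [chr, ← Complex.exp_add]; congr 1; ring
  simp_rw [e]
  rw [h0, wt, add_comm v]
  have := add_ne_zero_of_im hv.ne' x
  simp only [ofReal_zero, mul_zero, Complex.exp_zero]
  have h2 := Complex.I_sq
  field_simp
  rw [h2]

lemma SemiInv.mul_wt_mem (hp : p ≠ ⊤) {K : Submodule ℂ (LpR p)}
    (hK : IsClosed (K : Set (LpR p))) (hI : SemiInv (K : Set (LpR p))) {v : ℂ} (hv : 0 < v.im)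
    {f : LpR p} (hf : f ∈ K) : mulOp p (wt v) (memLp_wt_top hv.ne') f ∈ K := by
  let F : ℝ → LpR p := fun s => Complex.exp (Complex.I * v * s) • chrOp p s f
  have hFc : Continuous F := by
    have := continuous_chrOp hp f
    fun_prop
  have hF : Integrable F (volume.restrict (Set.Ioi 0)) := by
    refine Integrable.mono' ((exp_mul_I_integrable hv).norm.mul_const ‖f‖)
      hFc.aestronglyMeasurable (Eventually.of_forall fun s => ?_)
    simp only [F]
    rw [norm_smul]
    refine mul_le_mul_of_nonneg_left ?_ (norm_nonneg _)
    simpa using norm_mulOp_le (memLp_chr s) (fun x => (norm_chr s x).le) f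
  have hmem : ∫ s in Set.Ioi (0:ℝ), F s ∈ K := by
    refine integral_mem_submodule hK hF ?_
    filter_upwards [ae_restrict_mem measurableSet_Ioi] with s hs
    exact K.smul_mem _ (hI.1 s (le_of_lt hs) f hf)
  have hco := coe_integral_Lp (volume.restrict (Set.Ioi 0)) hF
    (G := fun s x => Complex.exp (Complex.I * v * s) * (chr s x * f x)) (by
      refine AEStronglyMeasurable.mul ?_ (AEStronglyMeasurable.mul ?_ ?_)
      · exact (by fun_prop : Continuous fun z : ℝ × ℝ =>
          Complex.exp (Complex.I * v * z.1)).aestronglyMeasurable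
      · exact (by unfold chr; fun_prop : Continuous fun z : ℝ × ℝ =>
          chr z.1 z.2).aestronglyMeasurable
      · exact ((Lp.stronglyMeasurable f).comp_measurable measurable_snd).aestronglyMeasurable)
    (fun s => by
      filter_upwards [Lp.coeFn_smul (Complex.exp (Complex.I * v * s)) (chrOp p s f),
        coe_mulOp p (memLp_chr s) f] with x h1 h2
      simp only [F]
      rw [h1, Pi.smul_apply, h2, smul_eq_mul])
  have : mulOp p (wt v) (memLp_wt_top hv.ne') f = (-Complex.I) • ∫ s in Set.Ioi (0:ℝ), F s := by
    apply Lp.ext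
    filter_upwards [hco, coe_mulOp p (memLp_wt_top hv.ne') f,
      Lp.coeFn_smul (-Complex.I) (∫ s in Set.Ioi (0:ℝ), F s)] with x h1 h2 h3
    rw [h2, h3, Pi.smul_apply, h1]
    simp_rw [← mul_assoc]
    rw [integral_mul_const, integral_exp_mul_I hv, smul_eq_mul]
    linear_combination (wt v x * f x) * Complex.I_sq
  rw [this]
  exact K.smul_mem _ hmem

/-- The uniform probability measure on `[0, ε]`. -/
def unifMeas (ε : ℝ) : Measure ℝ := (ENNReal.ofReal ε)⁻¹ • volume.restrict (Set.Icc 0 ε)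

lemma isProbabilityMeasure_unifMeas {ε : ℝ} (hε : 0 < ε) :
    IsProbabilityMeasure (unifMeas ε) := by
  constructor
  simp only [unifMeas, Measure.smul_apply, Measure.restrict_apply_univ, Real.volume_Icc, sub_zero,
    smul_eq_mul]
  exact ENNReal.inv_mul_cancel (by simpa using hε) (by simp)

lemma ae_unifMeas (ε : ℝ) : ∀ᵐ t ∂unifMeas ε, t ∈ Set.Icc 0 ε :=
  Measure.ae_smul_measure (ae_restrict_mem measurableSet_Icc) _

/-- The regularizing weight `(1 - iεx)⁻¹`. -/
def regW (ε : ℝ) (x : ℝ) : ℂ := (1 - Complex.I * ε * x)⁻¹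

lemma regW_eq {ε : ℝ} (hε : 0 < ε) (x : ℝ) :
    regW ε x = ((ε⁻¹ : ℝ) * Complex.I) * wt ((ε⁻¹ : ℝ) * Complex.I) x := by
  have him : (((ε⁻¹ : ℝ) : ℂ) * Complex.I).im ≠ 0 := by simpa using hε.ne'
  have h1 := add_ne_zero_of_im him x
  have h0 : (((ε⁻¹ : ℝ) : ℂ) * Complex.I) ≠ 0 := fun h => by rw [h] at him; simp at him
  have hε' : (ε : ℂ) ≠ 0 := by exact_mod_cast hε.ne'
  have h4 : 1 - Complex.I * ε * x =
      (x + ((ε⁻¹ : ℝ) : ℂ) * Complex.I) / (((ε⁻¹ : ℝ) : ℂ) * Complex.I) := by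
    rw [eq_div_iff h0]
    push_cast
    field_simp
    linear_combination (-ε * x : ℂ) * Complex.I_sq
  rw [regW, wt, h4, inv_div, div_eq_mul_inv]

lemma norm_regW_le (ε x : ℝ) : ‖regW ε x‖ ≤ 1 := by
  rw [regW, norm_inv]
  apply inv_le_one_of_one_le₀
  have h4 : (1 - Complex.I * ε * x : ℂ) = 1 - ((ε * x : ℝ) : ℂ) * Complex.I := by push_cast; ring
  rw [h4]
  generalize ε * x = c
  simpa using Complex.abs_re_le_norm (1 - (c : ℂ) * Complex.I)

lemma one_sub_ne (ε x : ℝ) : (1 - Complex.I * ε * x : ℂ) ≠ 0 := by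
  intro h
  simpa using congrArg Complex.re h

lemma continuous_regW (ε : ℝ) : Continuous (regW ε) := by
  unfold regW
  exact (by fun_prop : Continuous fun x : ℝ => (1 - Complex.I * ε * x : ℂ)).inv₀ (one_sub_ne ε)

lemma memLp_regW_top (ε : ℝ) : MemLp (regW ε) ⊤ volume :=
  memLp_top_of_bdd (continuous_regW ε).aestronglyMeasurable 1 (norm_regW_le ε)

lemma memLp_regW {ε : ℝ} (hε : 0 < ε) {q : ℝ≥0∞} (hq : 1 < q) : MemLp (regW ε) q volume := by
  have : regW ε = fun x => ((ε⁻¹ : ℝ) * Complex.I) * wt ((ε⁻¹ : ℝ) * Complex.I) x :=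
    funext (regW_eq hε)
  rw [this]
  exact (memLp_wt (by simpa using hε.ne') hq).const_mul _

/-- The regularization of a function. -/
def reg (ε : ℝ) (f : ℝ → ℂ) (x : ℝ) : ℂ := regW ε x * ∫ t, f (x - t) ∂unifMeas ε

variable (p) in
/-- The regularization of an element of `L^p(ℝ)`. -/
def regOp (ε : ℝ) (f : LpR p) : LpR p :=
  mulOp p (regW ε) (memLp_regW_top ε) (∫ t, transOp p t f ∂unifMeas ε)

lemma norm_transOp (t : ℝ) (f : LpR p) : ‖transOp p t f‖ = ‖f‖ :=
  (Lp.compMeasurePreservingₗᵢ ℂ (fun x : ℝ => x - t)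
    (measurePreserving_sub_right volume t)).norm_map f

lemma integrable_transOp (hp : p ≠ ⊤) {ε : ℝ} (hε : 0 < ε) (f : LpR p) :
    Integrable (fun t => transOp p t f) (unifMeas ε) := by
  have := isProbabilityMeasure_unifMeas hε
  refine Integrable.mono' (integrable_const ‖f‖)
    (continuous_transOp hp f).aestronglyMeasurable (Eventually.of_forall fun s => ?_)
  rw [norm_transOp]

lemma SemiInv.regOp_mem (hp : p ≠ ⊤) {K : Submodule ℂ (LpR p)}
    (hK : IsClosed (K : Set (LpR p))) (hI : SemiInv (K : Set (LpR p))) {ε : ℝ} (hε : 0 < ε)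
    {f : LpR p} (hf : f ∈ K) : regOp p ε f ∈ K := by
  have h1 : ∫ t, transOp p t f ∂unifMeas ε ∈ K := by
    refine integral_mem_submodule hK (integrable_transOp hp hε f) ?_
    filter_upwards [ae_unifMeas ε] with t ht
    exact hI.2 t ht.1 f hf
  have him : 0 < (((ε⁻¹ : ℝ) : ℂ) * Complex.I).im := by simpa using hε
  have h2 := K.smul_mem ((ε⁻¹ : ℝ) * Complex.I) (SemiInv.mul_wt_mem hp hK hI him h1)
  convert h2 using 1
  apply Lp.ext
  filter_upwards [coe_mulOp p (memLp_regW_top ε) (∫ t, transOp p t f ∂unifMeas ε),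
    coe_mulOp p (memLp_wt_top him.ne') (∫ t, transOp p t f ∂unifMeas ε),
    Lp.coeFn_smul (((ε⁻¹ : ℝ) : ℂ) * Complex.I)
    (mulOp p (wt ((ε⁻¹ : ℝ) * Complex.I)) (memLp_wt_top him.ne') (∫ t, transOp p t f ∂unifMeas ε))]
    with x h1 h2 h3
  rw [regOp, h1, h3, Pi.smul_apply, h2, regW_eq hε, smul_eq_mul]
  ring

lemma coe_regOp (hp : p ≠ ⊤) {ε : ℝ} (hε : 0 < ε) (f : LpR p) :
    regOp p ε f =ᵐ[volume] reg ε f := by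
  have := isProbabilityMeasure_unifMeas hε
  have h := coe_integral_Lp (unifMeas ε) (integrable_transOp hp hε f)
    (G := fun t x => f (x - t)) (((Lp.stronglyMeasurable f).comp_measurable
      (measurable_snd.sub measurable_fst)).aestronglyMeasurable) (fun t => coe_transOp p t f)
  filter_upwards [h, coe_mulOp p (memLp_regW_top ε) (∫ t, transOp p t f ∂unifMeas ε)] with x h1 h2
  rw [regOp, h2, h1, reg]

lemma tendsto_regOp (hp : p ≠ ⊤) (f : LpR p) :
    Tendsto (fun ε => regOp p ε f) (𝓝[>] 0) (𝓝 f) := by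
  have h1 : Tendsto (fun ε => mulOp p (regW ε) (memLp_regW_top ε) f) (𝓝[>] 0) (𝓝 f) := by
    have := tendsto_mulOp hp (l := 𝓝[>] (0:ℝ)) (fun ε => memLp_regW_top ε)
      (memLp_top_const (1:ℂ)) (C := 1) norm_regW_le (by simp) (fun x => ?_) f
    · convert this using 2
      apply Lp.ext
      filter_upwards [coe_mulOp p (memLp_top_const (1:ℂ)) f] with x hx
      rw [hx, one_mul]
    · refine Tendsto.mono_left ?_ nhdsWithin_le_nhds
      have h : Continuous fun ε : ℝ => regW ε x := by
        unfold regW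
        exact (by fun_prop : Continuous fun ε : ℝ => (1 - Complex.I * ε * x : ℂ)).inv₀
          (fun ε => one_sub_ne ε x)
      have := h.tendsto 0
      simpa [regW] using this
  have h2 : Tendsto (fun ε => ∫ t, transOp p t f ∂unifMeas ε) (𝓝[>] 0) (𝓝 f) := by
    rw [Metric.tendsto_nhds]
    intro δ hδ
    have hc := (continuous_transOp hp f).tendsto 0
    have h0 : transOp p 0 f = f := by
      apply Lp.ext
      filter_upwards [coe_transOp p 0 f] with x hx
      rw [hx, sub_zero]
    rw [h0, Metric.tendsto_nhds_nhds] at hc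
    obtain ⟨η, hη, hc⟩ := hc (δ / 2) (by positivity)
    filter_upwards [Ioo_mem_nhdsGT hη] with ε hε
    have := isProbabilityMeasure_unifMeas hε.1
    have e : ∫ t, transOp p t f ∂unifMeas ε - f = ∫ t, (transOp p t f - f) ∂unifMeas ε := by
      rw [integral_sub (integrable_transOp hp hε.1 f) (integrable_const _)]
      simp
    rw [dist_eq_norm, e]
    refine (norm_integral_le_of_norm_le_const (C := δ / 2) ?_).trans_lt ?_
    · filter_upwards [ae_unifMeas ε] with t ht
      rw [← dist_eq_norm]
      refine (hc ?_).le
      rw [dist_zero_right, Real.norm_of_nonneg ht.1]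
      exact ht.2.trans_lt hε.2
    · simp; linarith
  have h3 : Tendsto (fun ε => mulOp p (regW ε) (memLp_regW_top ε)
      (∫ t, transOp p t f ∂unifMeas ε - f)) (𝓝[>] 0) (𝓝 0) := by
    refine squeeze_zero_norm (a := fun ε => ‖∫ t, transOp p t f ∂unifMeas ε - f‖) (fun ε => ?_) ?_
    · simpa using norm_mulOp_le (memLp_regW_top ε) (norm_regW_le ε)
        (∫ t, transOp p t f ∂unifMeas ε - f)
    · simpa using (h2.sub_const f).norm
  have h4 := h3.add h1
  rw [zero_add] at h4
  refine h4.congr fun ε => ?_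
  rw [← map_add, sub_add_cancel, regOp]

lemma aestronglyMeasurable_comp_sub_left {f : ℝ → ℂ} (hf : AEStronglyMeasurable f volume) (x : ℝ) :
    AEStronglyMeasurable (fun t => f (x - t)) volume :=
  hf.comp_measurePreserving (Measure.measurePreserving_sub_left volume x)

lemma exists_reg_bound {r q : ℝ≥0∞} (hr : 1 ≤ r) (hq : 1 < q) {ε : ℝ} (hε : 0 < ε) :
    ∃ C : ℝ≥0∞, C ≠ ⊤ ∧ ∀ f : ℝ → ℂ, MemLp f r volume →
      eLpNorm (reg ε f) q volume ≤ C * eLpNorm f r volume := by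
  have := isProbabilityMeasure_unifMeas hε
  set c : ℝ≥0∞ := (ENNReal.ofReal ε)⁻¹ ^ (1 / r.toReal) with hc
  have hct : c ≠ ⊤ := ENNReal.rpow_ne_top_of_nonneg (by positivity) (by simpa using hε)
  refine ⟨c * eLpNorm (regW ε) q volume, ENNReal.mul_ne_top hct (memLp_regW hε hq).2.ne, ?_⟩
  intro f hf
  have hmeas : ∀ x, AEStronglyMeasurable (fun t => f (x - t)) (unifMeas ε) := fun x =>
    ((aestronglyMeasurable_comp_sub_left hf.1 x).restrict).smul_measure _
  have hb : ∀ x, ‖∫ t, f (x - t) ∂unifMeas ε‖ₑ ≤ c * eLpNorm f r volume := by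
    intro x
    calc _ ≤ ∫⁻ t, ‖f (x - t)‖ₑ ∂unifMeas ε := enorm_integral_le_lintegral_enorm _
      _ = eLpNorm (fun t => f (x - t)) 1 (unifMeas ε) := eLpNorm_one_eq_lintegral_enorm.symm
      _ ≤ eLpNorm (fun t => f (x - t)) r (unifMeas ε) :=
        eLpNorm_le_eLpNorm_of_exponent_le hr (hmeas x)
      _ ≤ c * eLpNorm (fun t => f (x - t)) r volume := by
        rw [unifMeas, eLpNorm_smul_measure_of_ne_zero (by simp), smul_eq_mul]
        gcongr
        · simp [hc]
        · exact Measure.restrict_le_self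
      _ = c * eLpNorm f r volume := by
        rw [← eLpNorm_comp_measurePreserving hf.1 (Measure.measurePreserving_sub_left volume x)]
        rfl
  have hfin : c * eLpNorm f r volume ≠ ⊤ := ENNReal.mul_ne_top hct hf.2.ne
  calc eLpNorm (reg ε f) q volume
      ≤ eLpNorm ((((c * eLpNorm f r volume).toReal : ℝ) : ℂ) • regW ε) q volume := by
        refine eLpNorm_mono_enorm fun x => ?_
        rw [reg, Pi.smul_apply, enorm_smul, enorm_mul, mul_comm]
        gcongr
        refine (hb x).trans_eq ?_
        rw [← ofReal_norm, Complex.norm_real, Real.norm_of_nonneg ENNReal.toReal_nonneg,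
          ENNReal.ofReal_toReal hfin]
    _ = (c * eLpNorm f r volume) * eLpNorm (regW ε) q volume := by
        rw [eLpNorm_const_smul]
        congr 1
        rw [← ofReal_norm, Complex.norm_real, Real.norm_of_nonneg ENNReal.toReal_nonneg,
          ENNReal.ofReal_toReal hfin]
    _ = _ := by ring

end

end

section

section

variable {p : ℝ≥0∞} [Fact (1 ≤ p)] {q : ℝ≥0∞} [Fact (1 ≤ q)]

lemma exists_pairing_bdd (hp : p ≠ ⊤) {φ : ℝ → ℂ} (hφ : MemLp φ ⊤ (volume : Measure ℝ)) {u : ℂ}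
    (hu : u.im ≠ 0) :
    ∃ T : LpR p →L[ℂ] ℂ, ∀ f : LpR p, T f = ∫ x, φ x * f x * wt u x := by
  obtain ⟨T, hT⟩ := exists_pairing (p := p) (q := p.conjExponent)
    (memLp_wt hu (one_lt_conjExponent hp))
  refine ⟨T.comp (mulOp p φ hφ), fun f => ?_⟩
  rw [ContinuousLinearMap.comp_apply, hT]
  apply integral_congr_ae
  filter_upwards [coe_mulOp p hφ f] with x hx
  rw [hx]

lemma exists_submodule_mulHardy (hp : p ≠ ⊤) {φ : ℝ → ℂ} (hφ : Unimod φ) :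
    ∃ X : Submodule ℂ (LpR p), IsClosed (X : Set (LpR p)) ∧ (X : Set (LpR p)) = mulHardy p φ := by
  have h : ∀ u : {u : ℂ // 0 < u.im}, ∃ T : LpR p →L[ℂ] ℂ,
      ∀ f : LpR p, T f = ∫ x, conj (φ x) * f x * wt u x := fun u =>
    exists_pairing_bdd hp hφ.conj.memLp_top u.2.ne'
  choose T hT using h
  refine ⟨⨅ u, (T u).ker, ?_, ?_⟩
  · rw [Submodule.coe_iInf]
    exact isClosed_iInter fun u => (T u).isClosed_ker
  · ext f
    rw [SetLike.mem_coe, Submodule.mem_iInf, mem_mulHardy_iff hφ]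
    constructor
    · intro h u hu
      have := h ⟨u, hu⟩
      rw [LinearMap.mem_ker] at this
      rw [← this]
      exact (hT ⟨u, hu⟩ f).symm
    · intro h u
      rw [LinearMap.mem_ker]
      exact (hT u f).trans (h u u.2)

lemma exists_submodule_halfLine (t : ℝ) :
    ∃ X : Submodule ℂ (LpR p), IsClosed (X : Set (LpR p)) ∧ (X : Set (LpR p)) = LpHalfLine p t := by
  have hm : MemLp ((Set.Iio t).indicator fun _ => (1:ℂ)) ⊤ (volume : Measure ℝ) :=
    (memLp_top_const (1:ℂ)).indicator measurableSet_Iio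
  refine ⟨(mulOp p _ hm).ker, (mulOp p _ hm).isClosed_ker, ?_⟩
  ext f
  rw [SetLike.mem_coe, LinearMap.mem_ker]
  change mulOp p _ hm f = 0 ↔ ∀ᵐ x : ℝ, x < t → (f : ℝ → ℂ) x = 0
  rw [Lp.eq_zero_iff_ae_eq_zero]
  have hco := coe_mulOp p hm f
  constructor
  · intro h
    filter_upwards [h, hco] with x h1 h2 hx
    rw [h2] at h1
    simpa [hx] using h1
  · intro h
    filter_upwards [h, hco] with x h1 h2
    rw [h2]
    by_cases hx : x < t <;> simp [hx, h1]

variable (q) in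
/-- The elements of `L^q(ℝ)` which represent elements of `K ⊆ L^p(ℝ)`. -/
def commonPart (K : Submodule ℂ (LpR p)) : Submodule ℂ (LpR q) where
  carrier := {g | ∃ f ∈ K, (f : ℝ → ℂ) =ᵐ[volume] g}
  zero_mem' := ⟨0, K.zero_mem, (Lp.coeFn_zero ..).trans (Lp.coeFn_zero ..).symm⟩
  add_mem' := by
    rintro g g' ⟨f, hf, h⟩ ⟨f', hf', h'⟩
    exact ⟨f + f', K.add_mem hf hf', (Lp.coeFn_add f f').trans
      ((h.add h').trans (Lp.coeFn_add g g').symm)⟩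
  smul_mem' := by
    rintro c g ⟨f, hf, h⟩
    exact ⟨c • f, K.smul_mem c hf, (Lp.coeFn_smul c f).trans
      ((h.const_smul c).trans (Lp.coeFn_smul c g).symm)⟩

variable (q) in
/-- The closed subspace of `L^q(ℝ)` generated by the common part of `K`. -/
def transfer (K : Submodule ℂ (LpR p)) : Submodule ℂ (LpR q) :=
  (commonPart q K).topologicalClosure

lemma semiInv_transfer {K : Submodule ℂ (LpR p)} (hI : SemiInv (K : Set (LpR p))) :
    SemiInv (transfer q K : Set (LpR q)) := by
  constructor
  · intro l hl g hg
    refine map_mem_closure (chrOp q l).continuous hg ?_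
    rintro g ⟨f, hf, h⟩
    refine ⟨chrOp p l f, hI.1 l hl f hf, ?_⟩
    filter_upwards [coe_mulOp p (memLp_chr l) f, coe_mulOp q (memLp_chr l) g, h] with x h1 h2 h3
    rw [h1, h2, h3]
  · intro m hm g hg
    refine map_mem_closure (transOp q m).continuous hg ?_
    rintro g ⟨f, hf, h⟩
    refine ⟨transOp p m f, hI.2 m hm f hf, ?_⟩
    have h0 := (measurePreserving_sub_right volume m).quasiMeasurePreserving.ae h
    filter_upwards [coe_transOp p m f, coe_transOp q m g, h0] with x h1 h2 h3
    rw [h1, h2, h3]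

lemma reg_congr (ε : ℝ) {f g : ℝ → ℂ} (h : f =ᵐ[volume] g) : reg ε f = reg ε g := by
  funext x
  rw [reg, reg]
  congr 1
  apply integral_congr_ae
  refine Measure.ae_smul_measure (ae_restrict_of_ae ?_) _
  exact (Measure.measurePreserving_sub_left volume x).quasiMeasurePreserving.ae h

/-- Regularization maps `L^p(ℝ)` boundedly into `L^q(ℝ)`. -/
lemma exists_regLp (hp : p ≠ ⊤) (hq : 1 < q) {ε : ℝ} (hε : 0 < ε) :
    ∃ T : LpR p → LpR q, (∀ f, T f =ᵐ[volume] regOp p ε f) ∧ Continuous T := by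
  obtain ⟨C, hC, hb⟩ := exists_reg_bound (r := p) Fact.out hq hε
  have hmem : ∀ f : LpR p, MemLp (regOp p ε f) q volume := fun f =>
    ⟨Lp.aestronglyMeasurable _, by
      rw [eLpNorm_congr_ae (coe_regOp hp hε f)]
      exact (hb f (Lp.memLp f)).trans_lt
        (ENNReal.mul_lt_top hC.lt_top (Lp.memLp f).2)⟩
  have hco : ∀ f : LpR p, (hmem f).toLp =ᵐ[volume] regOp p ε f := fun f => (hmem f).coeFn_toLp
  refine ⟨fun f => (hmem f).toLp, hco, ?_⟩
  have hsub : ∀ f g : LpR p, regOp p ε (f - g) = regOp p ε f - regOp p ε g := by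
    intro f g
    simp only [regOp, map_sub]
    rw [integral_sub (integrable_transOp hp hε f) (integrable_transOp hp hε g), map_sub]
  have : LipschitzWith C.toNNReal fun f => (hmem f).toLp := by
    intro f g
    rw [ENNReal.coe_toNNReal hC, Lp.edist_def, Lp.edist_def]
    have e1 : eLpNorm (⇑((hmem f).toLp) - ⇑((hmem g).toLp)) q volume =
        eLpNorm (reg ε (f - g : LpR p)) q volume := by
      apply eLpNorm_congr_ae
      filter_upwards [hco f, hco g, coe_regOp hp hε (f - g),
        Lp.coeFn_sub (regOp p ε f) (regOp p ε g)] with x h1 h2 h3 h4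
      rw [Pi.sub_apply, h1, h2, ← h3, hsub, h4, Pi.sub_apply]
    rw [e1]
    refine (hb _ (Lp.memLp _)).trans_eq ?_
    rw [eLpNorm_congr_ae (Lp.coeFn_sub f g)]
  exact this.continuous

lemma mem_transfer_iff (hp : 1 < p) (hp' : p ≠ ⊤) (hq' : q ≠ ⊤) {K : Submodule ℂ (LpR p)}
    (hK : IsClosed (K : Set (LpR p))) (hI : SemiInv (K : Set (LpR p)))
    {f : LpR p} {g : LpR q} (h : (f : ℝ → ℂ) =ᵐ[volume] g) : g ∈ transfer q K ↔ f ∈ K := by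
  constructor
  swap
  · exact fun hf => (commonPart q K).le_topologicalClosure ⟨f, hf, h⟩
  intro hg
  have hmem : ∀ ε : ℝ, 0 < ε → regOp p ε f ∈ K := by
    intro ε hε
    obtain ⟨T, hT, hTc⟩ := exists_regLp (p := q) (q := p) hq' hp hε
    have h1 : T g ∈ K := by
      have := map_mem_closure (t := (K : Set (LpR p))) hTc hg ?_
      · rwa [hK.closure_eq] at this
      · rintro g' ⟨f', hf', h'⟩
        have : T g' = regOp p ε f' := by
          apply Lp.ext
          refine (hT g').trans ((coe_regOp hq' hε g').trans ?_)
          rw [← reg_congr ε h']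
          exact (coe_regOp hp' hε f').symm
        rw [this]
        exact SemiInv.regOp_mem hp' hK hI hε hf'
    convert h1 using 1
    apply Lp.ext
    refine (coe_regOp hp' hε f).trans ?_
    rw [reg_congr ε h]
    exact ((hT g).trans (coe_regOp hq' hε g)).symm
  refine hK.mem_of_tendsto (tendsto_regOp hp' f) ?_
  filter_upwards [self_mem_nhdsWithin] with ε hε
  exact hmem ε hε

lemma le_of_commonPart_le (hp' : p ≠ ⊤) (hq : 1 < q) {K X : Submodule ℂ (LpR p)}
    (hK : IsClosed (K : Set (LpR p))) (hI : SemiInv (K : Set (LpR p)))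
    (hX : IsClosed (X : Set (LpR p)))
    (h : ∀ f ∈ K, ∀ g : LpR q, (f : ℝ → ℂ) =ᵐ[volume] g → f ∈ X) : K ≤ X := by
  intro f hf
  refine hX.mem_of_tendsto (tendsto_regOp hp' f) ?_
  filter_upwards [self_mem_nhdsWithin] with ε hε
  obtain ⟨T, hT, -⟩ := exists_regLp (p := p) (q := q) hp' hq hε
  exact h _ (SemiInv.regOp_mem hp' hK hI hε hf) (T f) (hT f).symm

lemma eq_of_transfer_eq (hp : 1 < p) (hp' : p ≠ ⊤) (hq : 1 < q) (hq' : q ≠ ⊤)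
    {K X : Submodule ℂ (LpR p)}
    (hK : IsClosed (K : Set (LpR p))) (hI : SemiInv (K : Set (LpR p)))
    (hX : IsClosed (X : Set (LpR p))) (hIX : SemiInv (X : Set (LpR p))) {Y : Set (LpR q)}
    (hXY : ∀ (f : LpR p) (g : LpR q), (f : ℝ → ℂ) =ᵐ[volume] g → (f ∈ X ↔ g ∈ Y))
    (h : (transfer q K : Set (LpR q)) = Y) : K = X := by
  apply le_antisymm
  · refine le_of_commonPart_le (q := q) hp' hq hK hI hX fun f hf g hfg => ?_
    rw [hXY f g hfg, ← h]
    exact (mem_transfer_iff hp hp' hq' hK hI hfg).2 hf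
  · refine le_of_commonPart_le (q := q) hp' hq hX hIX hK fun f hf g hfg => ?_
    rw [hXY f g hfg, ← h] at hf
    exact (mem_transfer_iff hp hp' hq' hK hI hfg).1 hf

/-- The alternatives in the description of the lattice. -/
def IsModel (K : Set (LpR p)) : Prop :=
  K = {0} ∨ K = Set.univ ∨ (∃ t : ℝ, K = LpHalfLine p t) ∨
    ∃ l s : ℝ, 0 ≤ s ∧ K = mulHardy p (parab l s)

lemma semiInv_of_isModel (hp' : p ≠ ⊤) {K : Set (LpR p)} (h : IsModel K) : SemiInv K := by
  rcases h with rfl | rfl | ⟨t, rfl⟩ | ⟨l, s, hs, rfl⟩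
  · constructor <;> rintro _ _ _ rfl <;> simp
  · constructor <;> simp
  · exact semiInv_halfLine t
  · exact semiInv_mulHardy hp' l hs

lemma isModel_of_transfer (hp : 1 < p) (hp' : p ≠ ⊤) (hq : 1 < q) (hq' : q ≠ ⊤)
    {K : Submodule ℂ (LpR p)}
    (hK : IsClosed (K : Set (LpR p))) (hI : SemiInv (K : Set (LpR p)))
    (h : IsModel (transfer q K : Set (LpR q))) : IsModel (K : Set (LpR p)) := by
  rcases h with h | h | ⟨t, h⟩ | ⟨l, s, hs, h⟩
  · left
    rw [eq_of_transfer_eq (X := ⊥) hp hp' hq hq' hK hI (by simp)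
      (semiInv_of_isModel hp' (Or.inl (by simp))) ?_ h]
    · simp
    · intro f g hfg
      rw [Submodule.mem_bot, Set.mem_singleton_iff, Lp.eq_zero_iff_ae_eq_zero,
        Lp.eq_zero_iff_ae_eq_zero]
      exact ⟨fun h => hfg.symm.trans h, fun h => hfg.trans h⟩
  · right; left
    rw [eq_of_transfer_eq (X := ⊤) hp hp' hq hq' hK hI (by simp)
      (semiInv_of_isModel hp' (Or.inr (Or.inl (by simp)))) (by simp) h]
    simp
  · right; right; left
    obtain ⟨X, hX, e⟩ := exists_submodule_halfLine (p := p) t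
    refine ⟨t, ?_⟩
    rw [← e, eq_of_transfer_eq (X := X) hp hp' hq hq' hK hI hX
      (e ▸ semiInv_halfLine t) ?_ h]
    intro f g hfg
    rw [← SetLike.mem_coe, e]
    change (∀ᵐ x : ℝ, x < t → (f : ℝ → ℂ) x = 0) ↔ (∀ᵐ x : ℝ, x < t → (g : ℝ → ℂ) x = 0)
    constructor
    · intro h; filter_upwards [hfg, h] with x h1 h2; rwa [← h1]
    · intro h; filter_upwards [hfg, h] with x h1 h2; rwa [h1]
  · right; right; right
    obtain ⟨X, hX, e⟩ := exists_submodule_mulHardy (p := p) hp' (unimod_parab l s)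
    refine ⟨l, s, hs, ?_⟩
    rw [← e, eq_of_transfer_eq (X := X) hp hp' hq hq' hK hI hX
      (e ▸ semiInv_mulHardy hp' l hs) ?_ h]
    intro f g hfg
    rw [← SetLike.mem_coe, e, mem_mulHardy_iff (unimod_parab l s),
      mem_mulHardy_iff (unimod_parab l s)]
    have : (fun x => conj (parab l s x) * f x) =ᵐ[volume] fun x => conj (parab l s x) * g x := by
      filter_upwards [hfg] with x hx
      rw [hx]
    exact ⟨fun h => h.congr this, fun h => h.congr this.symm⟩

end

end

section

/-- Measurable functions bounded by `C`. -/
structure Bdd (C : ℝ) (u : ℝ → ℂ) : Prop where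
  meas : Measurable u
  bound : ∀ x, ‖u x‖ ≤ C

lemma Unimod.bdd {φ : ℝ → ℂ} (h : Unimod φ) : Bdd 1 φ := ⟨h.meas, fun x => (h.norm x).le⟩

lemma Bdd.memLp_top {C : ℝ} {u : ℝ → ℂ} (h : Bdd C u) : MemLp u ⊤ volume :=
  memLp_top_of_bdd h.meas.aestronglyMeasurable C h.bound

lemma Bdd.integrable_mul {C : ℝ} {u G : ℝ → ℂ} (h : Bdd C u) {E : Measure ℝ}
    (hG : Integrable G E) : Integrable (fun x => u x * G x) E :=
  hG.bdd_mul h.meas.aestronglyMeasurable (Eventually.of_forall h.bound)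

lemma Bdd.comp {C : ℝ} {u : ℝ → ℂ} (h : Bdd C u) {g : ℝ → ℝ} (hg : Measurable g) :
    Bdd C fun x => u (g x) := ⟨h.meas.comp hg, fun _ => h.bound _⟩

/-- Correlation of an integrable and a bounded function is continuous. -/
lemma continuous_correlation {G : ℝ → ℂ} (hG : Integrable G) {C : ℝ} {u : ℝ → ℂ}
    (hu : Bdd C u) : Continuous fun s : ℝ => ∫ x, G x * u (x - s) := by
  obtain ⟨T, hT⟩ := exists_pairing (p := 1) hu.memLp_top
  let g : LpR 1 := hG.toL1 G
  have hg : g =ᵐ[volume] G := hG.coeFn_toL1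
  have h1 : Continuous fun s : ℝ => T (transOp 1 (-s) g) :=
    T.continuous.comp ((continuous_transOp (by simp) g).comp continuous_neg)
  refine h1.congr fun s => ?_
  rw [hT, ← integral_sub_right_eq_self _ s]
  apply integral_congr_ae
  have h2 := (measurePreserving_sub_right volume s).quasiMeasurePreserving.ae
    (coe_transOp 1 (-s) g)
  filter_upwards [h2, hg] with x h3 h4
  rw [h3, sub_neg_eq_add, sub_add_cancel, h4]

/-- The Cauchy density. -/
def pois (s : ℝ) : ℝ := (Real.pi * (1 + s ^ 2))⁻¹

lemma pois_pos (s : ℝ) : 0 < pois s := by unfold pois; positivity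

lemma integrable_pois : Integrable pois := by
  unfold pois
  simp_rw [mul_inv]
  exact integrable_inv_one_add_sq.const_mul _

lemma integral_pois : ∫ s, pois s = 1 := by
  unfold pois
  simp_rw [mul_inv]
  rw [integral_const_mul, integral_univ_inv_one_add_sq, inv_mul_cancel₀ Real.pi_ne_zero]

lemma continuous_pois : Continuous pois := by
  unfold pois
  exact Continuous.inv₀ (by fun_prop) fun s => by positivity

lemma integrable_pois_ofReal : Integrable fun s => (pois s : ℂ) := integrable_pois.ofReal

/-- The Poisson extension of `u` to the upper half-plane. -/
def poisInt (u : ℝ → ℂ) (z : ℂ) : ℂ := ∫ s : ℝ, u (z.re - z.im * s) * pois s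

/-- The Poisson kernel. -/
def pk (z : ℂ) (t : ℝ) : ℝ := z.im / (Real.pi * ((t - z.re) ^ 2 + z.im ^ 2))

lemma pk_nonneg {z : ℂ} (hz : 0 < z.im) (t : ℝ) : 0 ≤ pk z t := by unfold pk; positivity

lemma ofReal_pk {z : ℂ} (hz : 0 < z.im) (t : ℝ) :
    (pk z t : ℂ) = (2 * Real.pi * I)⁻¹ * (wt (-z) t - wt (-conj z) t) := by
  have h1 : (-z).im ≠ 0 := by simpa using hz.ne'
  have h2 : (-conj z).im ≠ 0 := by simpa using hz.ne'
  have h1' := add_ne_zero_of_im h1 t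
  have h2' := add_ne_zero_of_im h2 t
  have e : ((t : ℂ) + -z) * (t + -conj z) = (((t - z.re) ^ 2 + z.im ^ 2 : ℝ) : ℂ) := by
    apply Complex.ext
    · simp [pow_two]; ring
    · simp [pow_two]; ring
  have e2 : conj z = z - 2 * z.im * I := by
    apply Complex.ext
    · simp
    · simp; ring
  have h3 : (Real.pi : ℂ) ≠ 0 := by exact_mod_cast Real.pi_ne_zero
  rw [wt_sub h1 h2, pk]
  push_cast at e ⊢
  rw [← e, wt, wt, e2]
  rw [e2] at h2'
  field_simp
  ring

lemma integrable_pk {z : ℂ} (hz : 0 < z.im) : Integrable (pk z) := by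
  have h : Integrable fun t => (pk z t : ℂ) := by
    have h1 : (-z).im ≠ 0 := by simpa using hz.ne'
    have h2 : (-conj z).im ≠ 0 := by simpa using hz.ne'
    simp only [ofReal_pk hz, wt_sub h1 h2]
    refine Integrable.const_mul (Integrable.const_mul ?_ _) _
    exact integrable_mul_wt (p := 2) (by simp) (by simp) (memLp_wt h1 (by norm_num)) h2
  simpa using h.re

lemma poisInt_eq {z : ℂ} (hz : 0 < z.im) (u : ℝ → ℂ) : poisInt u z = ∫ t, u t * pk z t := by
  have h1 := integral_sub_left_eq_self (fun t => u t * pk z t) volume z.re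
  have h2 := Measure.integral_comp_mul_left (fun s => u (z.re - s) * pk z (z.re - s)) z.im
  rw [← h1]
  have h3 : |z.im⁻¹| * z.im = 1 := by rw [abs_of_pos (inv_pos.2 hz), inv_mul_cancel₀ hz.ne']
  have h4 : ∫ t, u (z.re - t) * pk z (z.re - t) =
      (z.im : ℂ) * ∫ s, u (z.re - z.im * s) * pk z (z.re - z.im * s) := by
    rw [h2, Complex.real_smul, ← mul_assoc, ← ofReal_mul, mul_comm z.im, h3, ofReal_one, one_mul]
  rw [h4, ← integral_const_mul, poisInt]
  congr 1
  funext s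
  have h5 : pois s = z.im * pk z (z.re - z.im * s) := by
    unfold pois pk
    have : (1:ℝ) + s ^ 2 ≠ 0 := by positivity
    have h6 : (z.re - z.im * s - z.re) ^ 2 + z.im ^ 2 = z.im ^ 2 * (1 + s ^ 2) := by ring
    rw [h6]
    field_simp
  rw [h5]; push_cast; ring

lemma Bdd.norm_poisInt_le {C : ℝ} {u : ℝ → ℂ} (hu : Bdd C u) (z : ℂ) : ‖poisInt u z‖ ≤ C := by
  calc ‖poisInt u z‖ ≤ ∫ s, C * pois s := by
        refine norm_integral_le_of_norm_le (integrable_pois.const_mul C)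
          (Eventually.of_forall fun s => ?_)
        rw [norm_mul, Complex.norm_real, Real.norm_of_nonneg (pois_pos s).le]
        exact mul_le_mul_of_nonneg_right (hu.bound _) (pois_pos s).le
    _ = C := by rw [integral_const_mul, integral_pois, mul_one]

/-- The Poisson extension converges weakly to the boundary function. -/
lemma tendsto_integral_mul_poisInt {G : ℝ → ℂ} (hG : Integrable G) {C : ℝ} {u : ℝ → ℂ}
    (hu : Bdd C u) :
    Tendsto (fun δ : ℝ => ∫ x, G x * poisInt u (x + δ * I)) (𝓝[>] 0) (𝓝 (∫ x, G x * u x)) := by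
  have hswap : ∀ δ : ℝ, ∫ x, G x * poisInt u (x + δ * I) =
      ∫ s, (∫ x, G x * u (x - δ * s)) * pois s := by
    intro δ
    have e1 : ∀ x, G x * poisInt u (x + δ * I) = ∫ s, G x * u (x - δ * s) * pois s := by
      intro x
      simp only [poisInt, add_re, ofReal_re, mul_re, I_re, mul_zero, ofReal_im, I_im, mul_one,
        sub_self, add_zero, add_im, mul_im, zero_add, mul_assoc]
      rw [integral_const_mul]
    simp_rw [e1, ← integral_mul_const]
    rw [integral_integral_swap]
    have h1 : Integrable (fun q : ℝ × ℝ => G q.1 * (pois q.2 : ℂ)) (volume.prod volume) :=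
      hG.mul_prod integrable_pois_ofReal
    have h2 := h1.bdd_mul (c := C) (f := fun q : ℝ × ℝ => u (q.1 - δ * q.2))
      (hu.meas.comp (by fun_prop)).aestronglyMeasurable (Eventually.of_forall fun q => hu.bound _)
    refine h2.congr (Eventually.of_forall fun q => ?_)
    simp only [Function.uncurry]; ring
  simp_rw [hswap]
  have e : ∫ x, G x * u x = ∫ s, (∫ x, G x * u x) * pois s := by
    rw [integral_const_mul, integral_complex_ofReal, integral_pois]; simp
  rw [e]
  have hc := continuous_correlation hG hu
  refine tendsto_integral_filter_of_dominated_convergence (fun s => (C * ∫ x, ‖G x‖) * pois s)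
    (Eventually.of_forall fun δ => ?_) (Eventually.of_forall fun δ => Eventually.of_forall fun s => ?_)
    (integrable_pois.const_mul _) (Eventually.of_forall fun s => ?_)
  · exact ((hc.comp (by fun_prop : Continuous fun s : ℝ => δ * s)).mul
      (continuous_ofReal.comp continuous_pois)).aestronglyMeasurable
  · rw [norm_mul, Complex.norm_real, Real.norm_of_nonneg (pois_pos s).le]
    refine mul_le_mul_of_nonneg_right ?_ (pois_pos s).le
    rw [← integral_const_mul]
    refine norm_integral_le_of_norm_le (hG.norm.const_mul C) (Eventually.of_forall fun x => ?_)
    rw [norm_mul, mul_comm]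
    exact mul_le_mul_of_nonneg_right (hu.bound _) (norm_nonneg _)
  · refine Tendsto.mul_const _ ?_
    have := (hc.comp (by fun_prop : Continuous fun δ : ℝ => δ * s)).tendsto 0
    simp only [Function.comp, zero_mul, sub_zero] at this
    exact this.mono_left nhdsWithin_le_nhds

/-- An integrable function orthogonal to all resolvent weights vanishes. -/
lemma ae_eq_zero_of_forall_wt {G : ℝ → ℂ} (hG : Integrable G)
    (h : ∀ v : ℂ, v.im ≠ 0 → ∫ x, G x * wt v x = 0) : G =ᵐ[volume] 0 := by
  have h2 : ∀ u : ℝ → ℂ, Bdd 1 u → Integrable u → ∫ x, G x * u x = 0 := by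
    intro u hu hui
    refine tendsto_nhds_unique (tendsto_integral_mul_poisInt hG hu) ?_
    refine (tendsto_const_nhds (x := (0:ℂ))).congr' ?_
    filter_upwards [self_mem_nhdsWithin] with δ hδ
    have hz : ∀ x : ℝ, 0 < ((x : ℂ) + δ * I).im := fun x => by simpa using hδ
    have hsymm : ∀ x t : ℝ, pk (x + δ * I) t = pk (t + δ * I) x := fun x t => by
      simp only [pk, add_re, ofReal_re, mul_re, I_re, mul_zero, ofReal_im, I_im, mul_one,
        sub_self, add_zero, add_im, mul_im, zero_add]
      rw [← neg_sub, neg_sq]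
    have hb : ∀ x t : ℝ, ‖(pk (x + δ * I) t : ℂ)‖ ≤ (Real.pi * δ)⁻¹ := fun x t => by
      have hδ' : (0:ℝ) < δ := hδ
      rw [Complex.norm_real, Real.norm_of_nonneg (pk_nonneg (hz x) t)]
      simp only [pk, add_re, ofReal_re, mul_re, I_re, mul_zero, ofReal_im, I_im, mul_one,
        sub_self, add_zero, add_im, mul_im, zero_add]
      rw [div_le_iff₀ (by positivity)]
      field_simp
      nlinarith [sq_nonneg (t - x)]
    simp_rw [poisInt_eq (hz _), ← integral_const_mul]
    rw [integral_integral_swap]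
    · symm
      rw [← integral_zero ℝ ℂ]
      congr 1
      funext t
      have h1 : (-((t : ℂ) + δ * I)).im ≠ 0 := by simpa using (hz t).ne'
      have h2 : (-conj ((t : ℂ) + δ * I)).im ≠ 0 := by simpa using (hz t).ne'
      have e : ∀ x : ℝ, G x * (u t * pk (x + δ * I) t) = (u t * (2 * Real.pi * I)⁻¹) *
          (G x * wt (-((t : ℂ) + δ * I)) x - G x * wt (-conj ((t : ℂ) + δ * I)) x) := by
        intro x
        rw [hsymm, ofReal_pk (hz t)]; ring
      simp_rw [e]
      have hG1 := memLp_one_iff_integrable.2 hG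
      rw [integral_const_mul, integral_sub (integrable_mul_wt le_rfl (by simp) hG1 h1)
        (integrable_mul_wt le_rfl (by simp) hG1 h2), h _ h1, h _ h2]
      simp
    · have h1 : Integrable (fun q : ℝ × ℝ => G q.1 * u q.2) (volume.prod volume) :=
        hG.mul_prod hui
      have h2 := h1.bdd_mul (c := (Real.pi * δ)⁻¹)
        (f := fun q : ℝ × ℝ => (pk ((q.1 : ℂ) + δ * I) q.2 : ℂ))
        (by
          refine Measurable.aestronglyMeasurable ?_
          unfold pk
          fun_prop) (Eventually.of_forall fun q => hb _ _)
      refine h2.congr (Eventually.of_forall fun q => ?_)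
      simp only [Function.uncurry]; ring
  refine hG.ae_eq_zero_of_forall_setIntegral_eq_zero fun A hA hA' => ?_
  have := h2 (A.indicator fun _ => 1) ⟨measurable_const.indicator hA, fun x => by
    by_cases hx : x ∈ A <;> simp [hx]⟩
    ((integrable_indicator_iff hA).2 (integrableOn_const hA'.ne))
  rw [← integral_indicator hA, ← this]
  congr 1; funext x
  by_cases hx : x ∈ A <;> simp [hx]

end

section

lemma tendsto_wt {u : ℂ} {l : Filter ℝ} (hl : Tendsto (fun x : ℝ => ‖x‖) l atTop) :
    Tendsto (wt u) l (𝓝 0) := by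
  have h1 : Tendsto (fun x : ℝ => ‖(x : ℂ)‖) l atTop := by simpa using hl
  exact tendsto_inv₀_cobounded.comp
    ((tendsto_add_const_cobounded u).comp (tendsto_norm_atTop_iff_cobounded.1 h1))

lemma integrable_wt_mul_wt {u v : ℂ} (hu : u.im ≠ 0) (hv : v.im ≠ 0) :
    Integrable fun x => wt u x * wt v x :=
  integrable_mul_wt (p := 2) (by simp) (by simp) (memLp_wt hu (by norm_num)) hv

lemma hardyVanish_wt {v : ℂ} (hv : 0 < v.im) : HardyVanish (wt v) := by
  intro u hu
  have hi := integrable_wt_mul_wt hv.ne' hu.ne'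
  have hv' := add_ne_zero_of_im hv.ne'
  have hu' := add_ne_zero_of_im hu.ne'
  have hd : ∀ (w : ℂ) (x : ℝ), HasDerivAt (fun x : ℝ => (x : ℂ) + w) 1 x := fun w x =>
    (Complex.ofRealCLM.hasDerivAt (x := x)).add_const w
  by_cases huv : u = v
  · subst huv
    have h1 : ∀ x : ℝ, HasDerivAt (fun x => - wt u x) (wt u x * wt u x) x := by
      intro x
      have := ((hd u x).inv (hu' x)).neg
      refine this.congr_deriv ?_
      unfold wt
      have := hu' x
      field_simp
    have h2 := fun (l : Filter ℝ) hl => (tendsto_wt (u := u) (l := l) hl).neg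
    rw [integral_of_hasDerivAt_of_tendsto h1 hi (h2 atBot tendsto_abs_atBot_atTop)
      (h2 atTop tendsto_norm_atTop_atTop), sub_self]
  · have hne : u - v ≠ 0 := sub_ne_zero.2 huv
    have hsl : ∀ x : ℝ, ((x : ℂ) + v) * wt u x ∈ slitPlane := by
      intro x
      by_contra hx
      rw [mem_slitPlane_iff_not_le_zero, not_not] at hx
      obtain ⟨h1, h2⟩ := Complex.le_def.1 hx
      set r := ((x : ℂ) + v) * wt u x with hr
      have h3 : (x : ℂ) + v = r * (x + u) := by
        rw [hr, wt, inv_mul_cancel_right₀ (hu' x)]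
      have h4 := congrArg Complex.im h3
      simp only [zero_re, zero_im] at h1 h2
      simp only [add_im, ofReal_im, zero_add, mul_im, h2, zero_mul, add_zero] at h4
      nlinarith
    have h1 : ∀ x : ℝ, HasDerivAt (fun x : ℝ => (u - v)⁻¹ * Complex.log (((x : ℂ) + v) * wt u x))
        (wt v x * wt u x) x := by
      intro x
      have := (((hd v x).mul ((hd u x).inv (hu' x))).clog_real (hsl x)).const_mul (u - v)⁻¹
      refine this.congr_deriv ?_
      have := hu' x
      have := hv' x
      simp only [wt, Pi.mul_apply, Pi.inv_apply]
      field_simp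
      ring
    have h2 : ∀ (l : Filter ℝ), Tendsto (fun x : ℝ => ‖x‖) l atTop →
        Tendsto (fun x : ℝ => (u - v)⁻¹ * Complex.log (((x : ℂ) + v) * wt u x)) l (𝓝 0) := by
      intro l hl
      have e : ∀ x : ℝ, ((x : ℂ) + v) * wt u x = 1 + (v - u) * wt u x := by
        intro x
        have := hu' x
        unfold wt
        field_simp
        ring
      have h3 : Tendsto (fun x : ℝ => 1 + (v - u) * wt u x) l (𝓝 1) := by
        simpa using ((tendsto_wt (u := u) hl).const_mul (v - u)).const_add 1
      have h4 := ((continuousAt_clog one_mem_slitPlane).tendsto.comp h3).const_mul (u - v)⁻¹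
      simpa [e] using h4
    rw [integral_of_hasDerivAt_of_tendsto h1 hi (h2 atBot tendsto_abs_atBot_atTop)
      (h2 atTop tendsto_norm_atTop_atTop), sub_self]

/-- The inner product of `L²(ℝ)` as an integral. -/
lemma inner_eq_integral (f g : LpR 2) : inner ℂ f g = ∫ x, conj (f x) * g x := by
  rw [L2.inner_def]
  simp only [RCLike.inner_apply, mul_comm]

lemma integrable_conj_mul (f g : LpR 2) : Integrable fun x => conj (f x) * g x := by
  have := L2.integrable_inner (𝕜 := ℂ) f g
  simpa only [RCLike.inner_apply, mul_comm] using this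


lemma integral_mul_wt_mul_wt {p : ℝ≥0∞} (h1 : 1 ≤ p) (hp : p ≠ ⊤) {f : ℝ → ℂ}
    (hf : MemLp f p volume) {u v : ℂ} (hu : u.im ≠ 0) (hv : v.im ≠ 0) (huv : u ≠ v) :
    ∫ x, f x * (wt u x * wt v x) = (v - u)⁻¹ * ((∫ x, f x * wt u x) - ∫ x, f x * wt v x) := by
  rw [← integral_sub (integrable_mul_wt h1 hp hf hu) (integrable_mul_wt h1 hp hf hv),
    ← integral_const_mul]
  congr 1
  funext x
  have h2 := wt_sub hu hv x
  have h3 : v - u ≠ 0 := sub_ne_zero.2 huv.symm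
  rw [← mul_sub, h2]
  field_simp

lemma conj_wt (u : ℂ) (x : ℝ) : conj (wt u x) = wt (conj u) x := by simp [wt]

/-- The Blaschke factor with zero at `-ū`. -/
def blaschke (u : ℂ) (x : ℝ) : ℂ := 1 + (conj u - u) * wt u x

lemma blaschke_mul_wt {u : ℂ} (hu : u.im ≠ 0) (x : ℝ) :
    blaschke u x * wt (conj u) x = wt u x := by
  have hu' : (conj u).im ≠ 0 := by simpa using hu
  have := wt_sub hu hu' x
  unfold blaschke
  linear_combination -this

lemma blaschke_conj_mul_blaschke {u : ℂ} (hu : u.im ≠ 0) (x : ℝ) :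
    blaschke (conj u) x * blaschke u x = 1 := by
  have h := blaschke_mul_wt hu x
  rw [blaschke, Complex.conj_conj]
  have h2 : blaschke u x = 1 + (conj u - u) * wt u x := rfl
  linear_combination (u - conj u) * h + h2

lemma memLp_blaschke {u : ℂ} (hu : u.im ≠ 0) : MemLp (blaschke u) ⊤ volume :=
  (memLp_top_const (1:ℂ)).add ((memLp_wt_top hu).const_mul _)

/-- An integrable real function whose product with a Blaschke factor is orthogonal to
constants and resolvent weights vanishes if its integral does. -/
lemma ae_eq_zero_of_blaschke {D : ℝ → ℂ} (hD : Integrable D) (hreal : ∀ x, conj (D x) = D x)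
    {u : ℂ} (hu : 0 < u.im) (h0 : ∫ x, D x = 0) (h1 : ∫ x, D x * blaschke u x = 0)
    (h2 : ∀ v : ℂ, 0 < v.im → ∫ x, D x * (blaschke u x * wt v x) = 0) : D =ᵐ[volume] 0 := by
  have hD1 := memLp_one_iff_integrable.2 hD
  have hDw : ∀ {v : ℂ}, v.im ≠ 0 → Integrable fun x => D x * wt v x := fun hv =>
    integrable_mul_wt le_rfl (by simp) hD1 hv
  have hne : conj u - u ≠ 0 := fun h => by
    have := congrArg Complex.im h
    simp at this
    linarith
  have hu0 : ∫ x, D x * wt u x = 0 := by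
    have e : ∀ x, D x * blaschke u x = D x + (conj u - u) * (D x * wt u x) := fun x => by
      unfold blaschke; ring
    simp_rw [e] at h1
    rw [integral_add hD ((hDw hu.ne').const_mul _), h0, zero_add, integral_const_mul] at h1
    exact (mul_eq_zero.1 h1).resolve_left hne
  have hpos : ∀ v : ℂ, 0 < v.im → ∫ x, D x * wt v x = 0 := by
    intro v hv
    by_cases huv : u = v
    · rw [← huv, hu0]
    have e : ∀ x, D x * (blaschke u x * wt v x) =
        D x * wt v x + (conj u - u) * (D x * (wt u x * wt v x)) := fun x => by
      unfold blaschke; ring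
    have h3 := h2 v hv
    simp_rw [e] at h3
    have h4 : Integrable fun x => D x * (wt u x * wt v x) := by
      simp_rw [← mul_assoc]
      exact integrable_mul_wt le_rfl (by simp) (memLp_mul_bdd hD1 (memLp_wt_top hu.ne')) hv.ne'
    rw [integral_add (hDw hv.ne') (h4.const_mul _), integral_const_mul,
      integral_mul_wt_mul_wt le_rfl (by simp) hD1 hu.ne' hv.ne' huv, hu0] at h3
    have h5 : v - u ≠ 0 := sub_ne_zero.2 (Ne.symm huv)
    have h6 : v - conj u ≠ 0 := fun h => by
      have := congrArg Complex.im h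
      simp at this
      linarith
    field_simp at h3
    have h7 : (v - conj u) * ∫ x, D x * wt v x = 0 := by linear_combination h3
    exact (mul_eq_zero.1 h7).resolve_left h6
  refine ae_eq_zero_of_forall_wt hD fun v hv => ?_
  rcases lt_or_gt_of_ne hv with h | h
  · have h3 := congrArg conj (hpos (conj v) (by simpa using h))
    rw [← integral_conj] at h3
    simpa [hreal, conj_wt] using h3
  · exact hpos v h

lemma exists_unimod_of_norm_eq {ψ : ℝ → ℂ} (hm : Measurable ψ) (h : ∀ᵐ x, ‖ψ x‖ = 1) :
    ∃ φ, Unimod φ ∧ φ =ᵐ[volume] ψ := by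
  classical
  have hs : MeasurableSet {x | ‖ψ x‖ = 1} := measurableSet_eq_fun hm.norm measurable_const
  refine ⟨fun x => if ‖ψ x‖ = 1 then ψ x else 1, ⟨hm.ite hs measurable_const, fun x => ?_⟩, ?_⟩
  · split_ifs with hx
    · exact hx
    · simp
  · filter_upwards [h] with x hx
    simp [hx]

section Beurling

variable {K : Submodule ℂ (LpR 2)}

lemma SemiInv.blaschke_mem (hK : IsClosed (K : Set (LpR 2))) (hI : SemiInv (K : Set (LpR 2)))
    {u : ℂ} (hu : 0 < u.im) {f : LpR 2} (hf : f ∈ K) :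
    mulOp 2 (blaschke u) (memLp_blaschke hu.ne') f ∈ K := by
  have h := K.add_mem hf (K.smul_mem (conj u - u) (SemiInv.mul_wt_mem (by simp) hK hI hu hf))
  convert h using 1
  apply Lp.ext
  filter_upwards [coe_mulOp 2 (memLp_blaschke hu.ne') f, coe_mulOp 2 (memLp_wt_top hu.ne') f,
    Lp.coeFn_add f ((conj u - u) • mulOp 2 (wt u) (memLp_wt_top hu.ne') f),
    Lp.coeFn_smul (conj u - u) (mulOp 2 (wt u) (memLp_wt_top hu.ne') f)] with x h1 h2 h3 h4
  rw [h1, h3, Pi.add_apply, h4, Pi.smul_apply, h2, blaschke, smul_eq_mul]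
  ring

/-- A wandering vector. -/
lemma exists_wandering (hK : IsClosed (K : Set (LpR 2))) (hI : SemiInv (K : Set (LpR 2)))
    {u : ℂ} (hu : 0 < u.im) {f₀ : LpR 2} (hf₀ : f₀ ∈ K)
    (hn : mulOp 2 (wt (conj u)) (memLp_wt_top (by simpa using hu.ne')) f₀ ∉ K) :
    ∃ ψ ∈ K, ψ ≠ 0 ∧ ∀ g ∈ K, ∫ x, conj (ψ x) * (blaschke u x * g x) = 0 := by
  have hu' : (conj u).im ≠ 0 := by simpa using hu.ne'
  let B := mulOp 2 (blaschke (conj u)) (memLp_blaschke hu')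
  have hcancel : ∀ g : LpR 2, B (mulOp 2 (blaschke u) (memLp_blaschke hu.ne') g) = g := by
    intro g
    apply Lp.ext
    filter_upwards [coe_mulOp 2 (memLp_blaschke hu') (mulOp 2 _ (memLp_blaschke hu.ne') g),
      coe_mulOp 2 (memLp_blaschke hu.ne') g] with x h1 h2
    rw [h1, h2, ← mul_assoc, blaschke_conj_mul_blaschke hu.ne', one_mul]
  have hcancel' : ∀ g : LpR 2, mulOp 2 (blaschke u) (memLp_blaschke hu.ne') (B g) = g := by
    intro g
    apply Lp.ext
    filter_upwards [coe_mulOp 2 (memLp_blaschke hu.ne') (mulOp 2 _ (memLp_blaschke hu') g),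
      coe_mulOp 2 (memLp_blaschke hu') g] with x h1 h2
    rw [h1, h2, ← mul_assoc, mul_comm (blaschke u x), blaschke_conj_mul_blaschke hu.ne', one_mul]
  let X : Submodule ℂ (LpR 2) := K.comap B.toLinearMap
  have hX : IsClosed (X : Set (LpR 2)) := hK.preimage B.continuous
  have hXK : X ≤ K := fun g hg => by
    rw [← hcancel' g]
    exact SemiInv.blaschke_mem hK hI hu hg
  have hf₀X : f₀ ∉ X := by
    intro h
    apply hn
    have hne : u - conj u ≠ 0 := fun h => by
      have := congrArg Complex.im h
      simp at this
      linarith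
    have h1 := K.smul_mem (u - conj u)⁻¹ (K.sub_mem (show B f₀ ∈ K from h) hf₀)
    convert h1 using 1
    apply Lp.ext
    filter_upwards [coe_mulOp 2 (memLp_blaschke hu') f₀, coe_mulOp 2 (memLp_wt_top hu') f₀,
      Lp.coeFn_sub (B f₀) f₀, Lp.coeFn_smul (u - conj u)⁻¹ (B f₀ - f₀)] with x h1 h2 h3 h4
    rw [h2, h4, Pi.smul_apply, h3, Pi.sub_apply, h1, blaschke, Complex.conj_conj, smul_eq_mul]
    field_simp
    ring
  have : CompleteSpace X := hX.completeSpace_coe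
  obtain ⟨y, hy, ψ, hψ, e⟩ := X.exists_add_mem_mem_orthogonal f₀
  have hψK : ψ ∈ K := by
    have : ψ = f₀ - y := by rw [e]; abel
    rw [this]
    exact K.sub_mem hf₀ (hXK hy)
  refine ⟨ψ, hψK, ?_, fun g hg => ?_⟩
  · rintro rfl
    apply hf₀X
    rw [e, add_zero]
    exact hy
  · have h1 : mulOp 2 (blaschke u) (memLp_blaschke hu.ne') g ∈ X := by
      change B _ ∈ K
      rw [hcancel]
      exact hg
    have h2 := (Submodule.mem_orthogonal' X ψ).1 hψ _ h1
    rw [inner_eq_integral] at h2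
    rw [← h2]
    apply integral_congr_ae
    filter_upwards [coe_mulOp 2 (memLp_blaschke hu.ne') g] with x hx
    rw [hx]

end Beurling

end

section

variable {K : Submodule ℂ (LpR 2)}

lemma SemiInv.integral_wandering_wt (hK : IsClosed (K : Set (LpR 2)))
    (hI : SemiInv (K : Set (LpR 2))) {u : ℂ} {ψ : LpR 2}
    (hψ : ∀ g ∈ K, ∫ x, conj (ψ x) * (blaschke u x * g x) = 0) {g : LpR 2} (hg : g ∈ K)
    {v : ℂ} (hv : 0 < v.im) : ∫ x, conj (ψ x) * (blaschke u x * (wt v x * g x)) = 0 := by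
  rw [← hψ _ (SemiInv.mul_wt_mem (by simp) hK hI hv hg)]
  apply integral_congr_ae
  filter_upwards [coe_mulOp 2 (memLp_wt_top hv.ne') g] with x hx
  rw [hx]

lemma wandering_norm (hK : IsClosed (K : Set (LpR 2))) (hI : SemiInv (K : Set (LpR 2)))
    {u : ℂ} (hu : 0 < u.im) {ψ : LpR 2} (hψK : ψ ∈ K) (hψ0 : ψ ≠ 0)
    (hψ : ∀ g ∈ K, ∫ x, conj (ψ x) * (blaschke u x * g x) = 0) :
    ∃ c : ℝ, 0 < c ∧ ∀ᵐ x, ‖ψ x‖ = c * ‖wt u x‖ := by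
  have hu' : (conj u).im ≠ 0 := by simpa using hu.ne'
  have hww := integrable_wt_mul_wt hu.ne' hu'
  have hψψ := integrable_conj_mul ψ ψ
  let w : LpR 2 := (memLp_wt (r := 2) hu.ne' (by norm_num)).toLp
  have hw : w =ᵐ[volume] wt u := MemLp.coeFn_toLp _
  have hwne : w ≠ 0 := by
    intro h
    rw [Lp.eq_zero_iff_ae_eq_zero] at h
    obtain ⟨x, h1, h2⟩ := (h.and hw).exists
    rw [h1] at h2
    exact wt_ne_zero hu.ne' x h2.symm
  have ew : ∫ x, wt u x * wt (conj u) x = ((‖w‖ ^ 2 : ℝ) : ℂ) := by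
    rw [ofReal_pow]
    refine Eq.trans ?_ (inner_self_eq_norm_sq_to_K (𝕜 := ℂ) w)
    rw [inner_eq_integral]
    apply integral_congr_ae
    filter_upwards [hw] with x hx
    rw [hx, conj_wt, mul_comm]
  have eψ : ∫ x, conj (ψ x) * ψ x = ((‖ψ‖ ^ 2 : ℝ) : ℂ) := by
    rw [ofReal_pow]
    refine Eq.trans ?_ (inner_self_eq_norm_sq_to_K (𝕜 := ℂ) ψ)
    rw [inner_eq_integral]
  have hwpos : 0 < ‖w‖ := norm_pos_iff.2 hwne
  have hψpos : 0 < ‖ψ‖ := norm_pos_iff.2 hψ0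
  let c : ℝ := ‖ψ‖ / ‖w‖
  have hc : 0 < c := by positivity
  have hcc : ((c ^ 2 : ℝ) : ℂ) * ((‖w‖ ^ 2 : ℝ) : ℂ) = ((‖ψ‖ ^ 2 : ℝ) : ℂ) := by
    rw [← ofReal_mul]
    congr 1
    simp only [c]
    field_simp
  let D : ℝ → ℂ := fun x => conj (ψ x) * ψ x - ((c ^ 2 : ℝ) : ℂ) * (wt u x * wt (conj u) x)
  have hbb : ∀ {G : ℝ → ℂ}, Integrable G → Integrable fun x => blaschke u x * G x := by
    intro G hG
    exact memLp_one_iff_integrable.1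
      (memLp_bdd_mul (memLp_one_iff_integrable.2 hG) (memLp_blaschke hu.ne'))
  have hwtt : ∀ {G : ℝ → ℂ} {v : ℂ}, 0 < v.im → Integrable G → Integrable fun x => wt v x * G x := by
    intro G v hv hG
    exact memLp_one_iff_integrable.1
      (memLp_bdd_mul (memLp_one_iff_integrable.2 hG) (memLp_wt_top hv.ne'))
  have hwt2 : MemLp (fun x => wt u x) 2 volume := memLp_wt hu.ne' (by norm_num)
  have hD : D =ᵐ[volume] 0 := by
    refine ae_eq_zero_of_blaschke (hψψ.sub (hww.const_mul _)) (fun x => ?_) hu ?_ ?_ ?_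
    · simp only [D, map_sub, map_mul, Complex.conj_conj, Complex.conj_ofReal, conj_wt]
      ring
    · simp only [D]
      rw [integral_sub hψψ (hww.const_mul _), integral_const_mul, eψ, ew, hcc, sub_self]
    · have e : ∀ x, D x * blaschke u x = conj (ψ x) * (blaschke u x * ψ x) -
          ((c ^ 2 : ℝ) : ℂ) * (wt u x * wt u x) := by
        intro x
        have := blaschke_mul_wt hu.ne' x
        simp only [D]
        linear_combination -((c ^ 2 : ℝ) : ℂ) * wt u x * this
      simp_rw [e]
      rw [integral_sub, integral_const_mul, hardyVanish_wt hu u hu, hψ _ hψK, mul_zero, sub_zero]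
      · simpa only [mul_left_comm] using hbb hψψ
      · exact (integrable_wt_mul_wt hu.ne' hu.ne').const_mul _
    · intro v hv
      have e : ∀ x, D x * (blaschke u x * wt v x) =
          conj (ψ x) * (blaschke u x * (wt v x * ψ x)) -
          ((c ^ 2 : ℝ) : ℂ) * (wt u x * wt u x * wt v x) := by
        intro x
        have := blaschke_mul_wt hu.ne' x
        simp only [D]
        linear_combination -((c ^ 2 : ℝ) : ℂ) * wt u x * wt v x * this
      simp_rw [e]
      rw [integral_sub, integral_const_mul,
        HardyVanish.mul_wt (p := 2) (by simp) (by simp) hwt2 (hardyVanish_wt hu) hu v hv,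
        SemiInv.integral_wandering_wt hK hI hψ hψK hv, mul_zero, sub_zero]
      · simpa only [mul_left_comm] using hbb (hwtt hv hψψ)
      · refine (Integrable.congr (hwtt hv (integrable_wt_mul_wt hu.ne' hu.ne'))
          (Eventually.of_forall fun x => ?_)).const_mul _
        simp only [mul_comm]
  refine ⟨c, hc, ?_⟩
  filter_upwards [hD] with x hx
  simp only [D, Pi.zero_apply] at hx
  rw [← conj_wt, mul_comm (wt u x), Complex.conj_mul', Complex.conj_mul'] at hx
  have h3 : ‖ψ x‖ ^ 2 = (c * ‖wt u x‖) ^ 2 := by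
    rw [mul_pow]
    exact_mod_cast sub_eq_zero.1 hx
  exact (sq_eq_sq₀ (norm_nonneg _) (by positivity)).1 h3

/-- A Beurling-type alternative for subspaces of `L²(ℝ)`. -/
theorem SemiInv.beurling (hK : IsClosed (K : Set (LpR 2))) (hI : SemiInv (K : Set (LpR 2))) :
    (∀ (u : ℂ) (hu : 0 < u.im), ∀ f ∈ K,
      mulOp 2 (wt (conj u)) (memLp_wt_top (by simpa using hu.ne')) f ∈ K) ∨
    ∃ φ, Unimod φ ∧ (K : Set (LpR 2)) = mulHardy 2 φ := by
  by_contra! hcon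
  obtain ⟨⟨u, hu, f₀, hf₀, hn⟩, hno⟩ := hcon
  have hu' : (conj u).im ≠ 0 := by simpa using hu.ne'
  obtain ⟨ψ, hψK, hψ0, hψ⟩ := exists_wandering hK hI hu hf₀ hn
  obtain ⟨c, hc, hnorm⟩ := wandering_norm hK hI hu hψK hψ0 hψ
  have hc' : (c : ℂ) ≠ 0 := by exact_mod_cast hc.ne'
  have hm : Measurable fun x => ψ x / (c * wt u x) :=
    (Lp.stronglyMeasurable ψ).measurable.div (measurable_const.mul (continuous_wt hu.ne').measurable)
  obtain ⟨φ, hφ, hφψ⟩ := exists_unimod_of_norm_eq hm (by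
    filter_upwards [hnorm] with x hx
    have := norm_pos_iff.2 (wt_ne_zero hu.ne' x)
    rw [norm_div, norm_mul, Complex.norm_real, Real.norm_of_nonneg hc.le, hx]
    field_simp)
  have hψφ : ∀ᵐ x, ψ x = c * (φ x * wt u x) := by
    filter_upwards [hφψ] with x hx
    have := wt_ne_zero hu.ne' x
    rw [hx]
    field_simp
  have hconj : ∀ᵐ x, conj (ψ x) = c * (conj (φ x) * wt (conj u) x) := by
    filter_upwards [hψφ] with x hx
    rw [hx, map_mul, map_mul, conj_wt, Complex.conj_ofReal]
  have hL : ∀ f : LpR 2, MemLp (fun x => conj (φ x) * f x) 2 volume := fun f =>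
    memLp_bdd_mul (Lp.memLp f) hφ.conj.memLp_top
  have hKH : ∀ f ∈ K, HardyVanish fun x => conj (φ x) * f x := by
    intro f hf
    have h0 : ∫ x, conj (φ x) * f x * wt u x = 0 := by
      have h1 := hψ f hf
      have : ∫ x, conj (ψ x) * (blaschke u x * f x) = c * ∫ x, conj (φ x) * f x * wt u x := by
        rw [← integral_const_mul]
        apply integral_congr_ae
        filter_upwards [hconj] with x hx
        have := blaschke_mul_wt hu.ne' x
        rw [hx]
        linear_combination c * conj (φ x) * f x * this
      rw [this] at h1
      exact (mul_eq_zero.1 h1).resolve_left hc'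
    intro v hv
    by_cases huv : u = v
    · rw [← huv, h0]
    have h1 := SemiInv.integral_wandering_wt hK hI hψ hf hv
    have : ∫ x, conj (ψ x) * (blaschke u x * (wt v x * f x)) =
        c * ∫ x, conj (φ x) * f x * (wt u x * wt v x) := by
      rw [← integral_const_mul]
      apply integral_congr_ae
      filter_upwards [hconj] with x hx
      have := blaschke_mul_wt hu.ne' x
      rw [hx]
      linear_combination c * conj (φ x) * f x * wt v x * this
    rw [this, integral_mul_wt_mul_wt (by simp) (by simp) (hL f) hu.ne' hv.ne' huv, h0] at h1
    have h5 : v - u ≠ 0 := sub_ne_zero.2 (Ne.symm huv)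
    have h6 := ((mul_eq_zero.1 ((mul_eq_zero.1 h1).resolve_left hc')).resolve_left
      (inv_ne_zero h5))
    simpa using h6
  refine hno φ hφ (Set.Subset.antisymm (fun f hf => (mem_mulHardy_iff hφ f).2 (hKH f hf)) ?_)
  intro f hf
  rw [mem_mulHardy_iff hφ] at hf
  have : CompleteSpace K := hK.completeSpace_coe
  obtain ⟨y, hy, z, hz, e⟩ := K.exists_add_mem_mem_orthogonal f
  have hzH : HardyVanish fun x => conj (φ x) * z x := by
    intro v hv
    have h1 := hf v hv
    have h2 := hKH y hy v hv
    have h3 : ∫ x, conj (φ x) * z x * wt v x =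
        (∫ x, conj (φ x) * f x * wt v x) - ∫ x, conj (φ x) * y x * wt v x := by
      rw [← integral_sub (integrable_mul_wt (by simp) (by simp) (hL f) hv.ne')
        (integrable_mul_wt (by simp) (by simp) (hL y) hv.ne')]
      apply integral_congr_ae
      filter_upwards [Lp.coeFn_add y z] with x hx
      rw [e, hx, Pi.add_apply]
      ring
    rw [h3, h1, h2, sub_zero]
  have hz0 : ∫ x, conj (ψ x) * z x = 0 := by
    rw [← inner_eq_integral]
    exact (Submodule.mem_orthogonal K z).1 hz ψ hψK
  have hφz : ∫ x, conj (φ x) * z x * wt (conj u) x = 0 := by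
    have : ∫ x, conj (ψ x) * z x = c * ∫ x, conj (φ x) * z x * wt (conj u) x := by
      rw [← integral_const_mul]
      apply integral_congr_ae
      filter_upwards [hconj] with x hx
      rw [hx]
      ring
    rw [this] at hz0
    exact (mul_eq_zero.1 hz0).resolve_left hc'
  have hG : (fun x => conj (ψ x) * z x) =ᵐ[volume] 0 := by
    refine ae_eq_zero_of_forall_wt (integrable_conj_mul ψ z) fun v hv => ?_
    rcases lt_or_gt_of_ne hv with h | h
    · have hv' : 0 < (conj v).im := by simpa using h
      have h1 := (Submodule.mem_orthogonal K z).1 hz _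
        (SemiInv.mul_wt_mem (by simp) hK hI hv' hψK)
      rw [inner_eq_integral] at h1
      rw [← h1]
      apply integral_congr_ae
      filter_upwards [coe_mulOp 2 (memLp_wt_top hv'.ne') ψ] with x hx
      rw [hx, map_mul, conj_wt, Complex.conj_conj]
      ring
    · have huv : conj u ≠ v := fun h' => by
        rw [← h'] at h
        simp at h
        linarith
      have : ∫ x, conj (ψ x) * z x * wt v x =
          c * ∫ x, conj (φ x) * z x * (wt (conj u) x * wt v x) := by
        rw [← integral_const_mul]
        apply integral_congr_ae
        filter_upwards [hconj] with x hx
        rw [hx]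
        ring
      rw [this, integral_mul_wt_mul_wt (by simp) (by simp) (hL z) hu' h.ne' huv, hφz,
        hzH v h]
      simp
  have hz00 : z = 0 := by
    rw [Lp.eq_zero_iff_ae_eq_zero]
    filter_upwards [hG, hnorm] with x h1 h2
    refine (mul_eq_zero.1 h1).resolve_left fun h3 => ?_
    have h4 : ψ x = 0 := by simpa using h3
    rw [h4, norm_zero] at h2
    have := norm_pos_iff.2 (wt_ne_zero hu.ne' x)
    have : 0 < c * ‖wt u x‖ := by positivity
    linarith
  rw [e, hz00, add_zero]
  exact hy

end

section

variable {K : Submodule ℂ (LpR 2)}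

lemma SemiInv.mul_eq_zero_of_doubly (hK : IsClosed (K : Set (LpR 2)))
    (hI : SemiInv (K : Set (LpR 2)))
    (hd : ∀ (u : ℂ) (hu : 0 < u.im), ∀ f ∈ K,
      mulOp 2 (wt (conj u)) (memLp_wt_top (by simpa using hu.ne')) f ∈ K)
    {f g : LpR 2} (hf : f ∈ K) (hg : g ∈ Kᗮ) : ∀ᵐ x, conj (g x) * f x = 0 := by
  have key : ∀ (v : ℂ) (hv : v.im ≠ 0), mulOp 2 (wt v) (memLp_wt_top hv) f ∈ K := by
    intro v hv
    rcases lt_or_gt_of_ne hv with h | h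
    · have := hd (conj v) (by simpa using h) f hf
      simpa only [Complex.conj_conj] using this
    · exact SemiInv.mul_wt_mem (by simp) hK hI h hf
  refine ae_eq_zero_of_forall_wt (integrable_conj_mul g f) fun v hv => ?_
  have h1 := (Submodule.mem_orthogonal' K g).1 hg _ (key v hv)
  rw [inner_eq_integral] at h1
  rw [← h1]
  apply integral_congr_ae
  filter_upwards [coe_mulOp 2 (memLp_wt_top hv) f] with x hx
  rw [hx]
  ring

lemma SemiInv.vanish_or_vanish (hK : IsClosed (K : Set (LpR 2)))
    (hI : SemiInv (K : Set (LpR 2)))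
    (hd : ∀ (u : ℂ) (hu : 0 < u.im), ∀ f ∈ K,
      mulOp 2 (wt (conj u)) (memLp_wt_top (by simpa using hu.ne')) f ∈ K)
    {f g : LpR 2} (hf : f ∈ K) (hg : g ∈ Kᗮ) (τ : ℝ) :
    (∀ᵐ x : ℝ, x < τ → f x = 0) ∨ (∀ᵐ x : ℝ, τ < x → g x = 0) := by
  by_contra hcon
  obtain ⟨h1, h2⟩ := not_or.1 hcon
  have hfm := (Lp.stronglyMeasurable f).measurable
  have hgm := (Lp.stronglyMeasurable g).measurable
  have hμ : ∀ᵐ m : ℝ, ∀ᵐ x : ℝ, 0 ≤ m → f (x - m) * g x = 0 := by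
    refine Eventually.of_forall fun m => ?_
    by_cases hm : 0 ≤ m
    · filter_upwards [SemiInv.mul_eq_zero_of_doubly hK hI hd (hI.2 m hm f hf) hg,
        coe_transOp 2 m f] with x h3 h4 _
      rw [h4] at h3
      rcases mul_eq_zero.1 h3 with h5 | h5
      · rw [(map_eq_zero _).1 h5, mul_zero]
      · rw [h5, zero_mul]
    · exact Eventually.of_forall fun x h => absurd h hm
  rw [Measure.ae_ae_comm] at hμ
  swap
  · have hS : MeasurableSet {x : ℝ × ℝ | f (x.2 - x.1) * g x.2 = 0} :=
      measurableSet_eq_fun ((hfm.comp (measurable_snd.sub measurable_fst)).mul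
        (hgm.comp measurable_snd)) measurable_const
    have hS' : MeasurableSet {x : ℝ × ℝ | 0 ≤ x.1} := measurableSet_le measurable_const measurable_fst
    convert hS'.compl.union hS using 1
    ext x
    simp only [Set.mem_ofPred_eq, Set.mem_union, Set.mem_compl_iff, imp_iff_not_or]
  obtain ⟨x, hx, hxτ, hgx⟩ : ∃ x, (∀ᵐ m : ℝ, 0 ≤ m → f (x - m) * g x = 0) ∧ τ < x ∧ g x ≠ 0 := by
    by_contra! h
    apply h2
    filter_upwards [hμ] with x hx hxτ
    exact h x hx hxτ
  apply h1
  have h3 := (Measure.measurePreserving_sub_left volume x).quasiMeasurePreserving.ae hx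
  filter_upwards [h3] with y hy hyτ
  have h4 := hy (by linarith)
  rw [sub_sub_cancel] at h4
  exact (mul_eq_zero.1 h4).resolve_right hgx

/-- Doubly invariant subspaces are the trivial ones and those given by half-lines. -/
theorem SemiInv.isModel_of_doubly (hK : IsClosed (K : Set (LpR 2)))
    (hI : SemiInv (K : Set (LpR 2)))
    (hd : ∀ (u : ℂ) (hu : 0 < u.im), ∀ f ∈ K,
      mulOp 2 (wt (conj u)) (memLp_wt_top (by simpa using hu.ne')) f ∈ K) :
    IsModel (K : Set (LpR 2)) := by
  have : CompleteSpace K := hK.completeSpace_coe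
  let S : Set ℝ := {τ | ∀ f ∈ K, ∀ᵐ x : ℝ, x < τ → f x = 0}
  have hS : ∀ τ ∉ S, ∀ g ∈ Kᗮ, ∀ᵐ x : ℝ, τ < x → g x = 0 := by
    intro τ hτ g hg
    simp only [S, Set.mem_ofPred_eq, not_forall] at hτ
    obtain ⟨f, hf, hfτ⟩ := hτ
    exact (SemiInv.vanish_or_vanish hK hI hd hf hg τ).resolve_left hfτ
  rcases S.eq_empty_or_nonempty with hE | hne
  · right; left
    have : Kᗮ = ⊥ := by
      rw [Submodule.eq_bot_iff]
      intro g hg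
      rw [Lp.eq_zero_iff_ae_eq_zero]
      have h1 : ∀ᵐ x : ℝ, ∀ n : ℕ, -(n : ℝ) < x → g x = 0 :=
        ae_all_iff.2 fun n => hS _ (by simp [hE]) g hg
      filter_upwards [h1] with x hx
      obtain ⟨n, hn⟩ := exists_nat_gt (-x)
      exact hx n (by linarith)
    rw [(Submodule.orthogonal_eq_bot_iff).1 this]
    rfl
  · by_cases hb : BddAbove S
    · right; right; left
      refine ⟨sSup S, Set.Subset.antisymm (fun f hf => ?_) fun f hf => ?_⟩
      · have h1 : ∀ᵐ x : ℝ, ∀ q : ℚ, (q : ℝ) < sSup S → x < q → f x = 0 := by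
          refine ae_all_iff.2 fun q => ?_
          by_cases hq : (q : ℝ) < sSup S
          · obtain ⟨τ, hτ, hqτ⟩ := exists_lt_of_lt_csSup hne hq
            filter_upwards [hτ f hf] with x hx _ hxq
            exact hx (hxq.trans hqτ)
          · exact Eventually.of_forall fun x h => absurd h hq
        change ∀ᵐ x : ℝ, x < sSup S → f x = 0
        filter_upwards [h1] with x hx hxS
        obtain ⟨q, hq1, hq2⟩ := exists_rat_btwn hxS
        exact hx q hq2 hq1
      · change f ∈ K
        rw [← K.orthogonal_orthogonal, Submodule.mem_orthogonal]
        intro g hg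
        have h1 : ∀ᵐ x : ℝ, ∀ q : ℚ, sSup S < (q : ℝ) → (q : ℝ) < x → g x = 0 := by
          refine ae_all_iff.2 fun q => ?_
          by_cases hq : sSup S < (q : ℝ)
          · filter_upwards [hS q (fun h => absurd (le_csSup hb h) (not_le.2 hq)) g hg] with x hx _
            exact hx
          · exact Eventually.of_forall fun x h => absurd h hq
        rw [inner_eq_integral, ← integral_zero ℝ ℂ]
        apply integral_congr_ae
        have hf' : ∀ᵐ x : ℝ, x < sSup S → f x = 0 := hf
        have hx0 : ∀ᵐ x : ℝ, x ≠ sSup S := Measure.ae_ne volume _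
        filter_upwards [h1, hf', hx0] with x hx hfx hne
        rcases lt_or_gt_of_ne hne with h | h
        · rw [hfx h, mul_zero]
        · obtain ⟨q, hq1, hq2⟩ := exists_rat_btwn h
          rw [hx q hq1 hq2, map_zero, zero_mul]
    · left
      have : K = ⊥ := by
        rw [Submodule.eq_bot_iff]
        intro f hf
        rw [Lp.eq_zero_iff_ae_eq_zero]
        have h1 : ∀ᵐ x : ℝ, ∀ n : ℕ, x < n → f x = 0 := by
          refine ae_all_iff.2 fun n => ?_
          obtain ⟨τ, hτ, hn⟩ := not_bddAbove_iff.1 hb n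
          filter_upwards [hτ f hf] with x hx hxn
          exact hx (hxn.trans hn)
        filter_upwards [h1] with x hx
        obtain ⟨n, hn⟩ := exists_nat_gt x
        exact hx n hn
      rw [this]
      rfl

end

section

/-- Boundary functions of bounded analytic functions on the upper half-plane. -/
def Hinf (u : ℝ → ℂ) : Prop :=
  ∀ a b : ℂ, 0 < a.im → 0 < b.im → ∫ x, u x * (wt a x * wt b x) = 0

/-- Multipliers of the Hardy space. -/
def HMult (u : ℝ → ℂ) : Prop :=
  ∀ h : ℝ → ℂ, MemLp h 2 volume → HardyVanish h → HardyVanish fun x => u x * h x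

lemma HMult.hinf {u : ℝ → ℂ} (hu : HMult u) : Hinf u := by
  intro a b ha hb
  rw [← hu (wt a) (memLp_wt ha.ne' (by norm_num)) (hardyVanish_wt ha) b hb]
  simp only [mul_assoc]

lemma HMult.comp_sub {u : ℝ → ℂ} (hu : HMult u) (m : ℝ) : HMult fun x => u (x - m) := by
  intro h hh hv
  have h1 := (hu (fun x => h (x + m))
    (hh.comp_measurePreserving (measurePreserving_add_right volume m))
    (by simpa using hv.comp_sub (-m))).comp_sub m
  simpa using h1

lemma HardyVanish.integral_eq_zero {k : ℝ → ℂ} (hk : Integrable k) (hv : HardyVanish k) :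
    ∫ x, k x = 0 := by
  let a : ℕ → ℂ := fun n => ((n : ℝ) + 1 : ℝ) * I
  have ha : ∀ n, 0 < (a n).im := fun n => by
    have : (0:ℝ) < (n : ℝ) + 1 := by positivity
    simpa [a] using this
  have hlim : Tendsto (fun n : ℕ => ∫ x, k x * (a n * wt (a n) x)) atTop (𝓝 (∫ x, k x)) := by
    refine tendsto_integral_of_dominated_convergence (fun x => ‖k x‖) (fun n => ?_) hk.norm
      (fun n => Eventually.of_forall fun x => ?_) (Eventually.of_forall fun x => ?_)
    · exact hk.aestronglyMeasurable.mul
        ((continuous_const.mul (continuous_wt (ha n).ne')).aestronglyMeasurable)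
    · rw [norm_mul]
      refine mul_le_of_le_one_right (norm_nonneg _) ?_
      rw [norm_mul]
      have h1 : ‖a n‖ = (a n).im := by
        have : (0:ℝ) ≤ (n : ℝ) + 1 := by positivity
        simp only [a, norm_mul, norm_I, mul_one, Complex.norm_real, Real.norm_of_nonneg this]
        simp
      have h2 := norm_wt_le (ha n).ne' x
      rw [abs_of_pos (ha n)] at h2
      calc ‖a n‖ * ‖wt (a n) x‖ ≤ (a n).im * (a n).im⁻¹ := by
            rw [h1]; exact mul_le_mul_of_nonneg_left h2 (ha n).le
        _ = 1 := mul_inv_cancel₀ (ha n).ne'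
    · have e : ∀ n, k x * (a n * wt (a n) x) = k x * (1 - x * wt (a n) x) := by
        intro n
        have := add_ne_zero_of_im (ha n).ne' x
        unfold wt
        field_simp
        ring
      simp_rw [e]
      have hw : Tendsto (fun n => wt (a n) x) atTop (𝓝 0) := by
        rw [tendsto_zero_iff_norm_tendsto_zero]
        refine squeeze_zero (fun n => norm_nonneg _) (fun n => norm_wt_le (ha n).ne' x) ?_
        have : (fun n => |(a n).im|⁻¹) = fun n : ℕ => 1 / ((n : ℝ) + 1) := by
          funext n
          rw [abs_of_pos (ha n)]
          simp [a]
        rw [this]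
        exact tendsto_one_div_add_atTop_nhds_zero_nat
      simpa using ((hw.const_mul (x : ℂ)).const_sub 1).const_mul (k x)
  have h0 : (fun n : ℕ => ∫ x, k x * (a n * wt (a n) x)) = fun _ => 0 := by
    funext n
    simp_rw [mul_left_comm (k _)]
    rw [integral_const_mul, hv _ (ha n), mul_zero]
  rw [h0] at hlim
  exact tendsto_nhds_unique hlim tendsto_const_nhds

lemma neg_im_ne {z : ℂ} (hz : 0 < z.im) : (-z).im ≠ 0 := by simpa using hz.ne'

lemma neg_conj_im_pos {z : ℂ} (hz : 0 < z.im) : 0 < (-conj z).im := by simpa using hz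

lemma poisInt_eq_wt {z : ℂ} (hz : 0 < z.im) (u : ℝ → ℂ) :
    poisInt u z = (z.im / Real.pi : ℂ) * ∫ x, u x * (wt (-z) x * wt (-conj z) x) := by
  rw [poisInt_eq hz, ← integral_const_mul]
  congr 1
  funext x
  rw [ofReal_pk hz, wt_sub (neg_im_ne hz) (neg_conj_im_pos hz).ne']
  have e2 : conj z = z - 2 * z.im * I := by
    apply Complex.ext
    · simp
    · simp; ring
  have e3 : -conj z - -z = 2 * z.im * I := by rw [e2]; ring
  have h3 : (Real.pi : ℂ) ≠ 0 := by exact_mod_cast Real.pi_ne_zero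
  rw [e3]
  field_simp

lemma integrable_mul_wt_wt {C : ℝ} {u : ℝ → ℂ} (hu : Bdd C u) {a b : ℂ} (ha : a.im ≠ 0)
    (hb : b.im ≠ 0) : Integrable fun x => u x * (wt a x * wt b x) :=
  hu.integrable_mul (integrable_wt_mul_wt ha hb)

lemma Hinf.poisInt_eq {C : ℝ} {u : ℝ → ℂ} (hb : Bdd C u) (hu : Hinf u) {z : ℂ} (hz : 0 < z.im) :
    poisInt u z = (2 * Real.pi * I)⁻¹ * (z + I) * ∫ x, u x * wt I x * wt (-z) x := by
  have hI : (0:ℝ) < I.im := by simp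
  have h0 := hu I (-conj z) hI (neg_conj_im_pos hz)
  have e : ∀ x, u x * pk z x = (2 * Real.pi * I)⁻¹ * ((z + I) * (u x * (wt I x * wt (-z) x)) -
      (conj z + I) * (u x * (wt I x * wt (-conj z) x))) := by
    intro x
    have h1 := wt_sub hI.ne' (neg_im_ne hz) x
    have h2 := wt_sub hI.ne' (neg_conj_im_pos hz).ne' x
    rw [ofReal_pk hz]
    linear_combination (2 * Real.pi * I)⁻¹ * u x * (h2 - h1)
  rw [_root_.poisInt_eq hz]
  simp_rw [e]
  rw [integral_const_mul, integral_sub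
    ((integrable_mul_wt_wt hb hI.ne' (neg_im_ne hz)).const_mul _)
    ((integrable_mul_wt_wt hb hI.ne' (neg_conj_im_pos hz).ne').const_mul _), integral_const_mul,
    integral_const_mul, h0, mul_zero, sub_zero, mul_assoc]
  simp only [mul_assoc]

lemma differentiableOn_cauchy {g : ℝ → ℂ} (hg : MemLp g 2 volume) :
    DifferentiableOn ℂ (fun z => ∫ x, g x * wt (-z) x) {z | 0 < z.im} := by
  intro z hz
  have hz : 0 < z.im := hz
  have hr : 0 < z.im / 2 := by positivity
  have hball : ∀ w ∈ Metric.ball z (z.im / 2), z.im / 2 < w.im := by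
    intro w hw
    have h1 := Complex.abs_im_le_norm (w - z)
    rw [Metric.mem_ball, dist_eq_norm] at hw
    have h2 := (abs_lt.1 (h1.trans_lt hw)).1
    rw [sub_im] at h2
    linarith
  have hpos : ∀ w ∈ Metric.ball z (z.im / 2), 0 < w.im := fun w hw => hr.trans (hball w hw)
  have hgi : Integrable fun x => ‖g x * wt (-z) x‖ :=
    (integrable_mul_wt (by simp) (by simp) hg (neg_im_ne hz)).norm
  refine (hasDerivAt_integral_of_dominated_loc_of_deriv_le (μ := volume)
    (F := fun w x => g x * wt (-w) x) (F' := fun w x => g x * (wt (-w) x * wt (-w) x))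
    (x₀ := z) (s := Metric.ball z (z.im / 2))
    (bound := fun x => ‖g x * wt (-z) x‖ * (2 * (z.im / 2)⁻¹))
    (Metric.ball_mem_nhds z hr) ?_ ?_ ?_ ?_ ?_ ?_).2.differentiableAt.differentiableWithinAt
  · filter_upwards [Metric.ball_mem_nhds z hr] with w hw
    exact (integrable_mul_wt (by simp) (by simp) hg (neg_im_ne (hpos w hw))).aestronglyMeasurable
  · exact integrable_mul_wt (by simp) (by simp) hg (neg_im_ne hz)
  · exact hg.aestronglyMeasurable.mul ((continuous_wt (neg_im_ne hz)).mul
      (continuous_wt (neg_im_ne hz))).aestronglyMeasurable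
  · refine Eventually.of_forall fun x w hw => ?_
    have h1 : ‖wt (-w) x‖ ≤ (z.im / 2)⁻¹ := by
      refine (norm_wt_le (neg_im_ne (hpos w hw)) x).trans (inv_anti₀ hr ?_)
      rw [neg_im, abs_neg, abs_of_pos (hpos w hw)]
      exact (hball w hw).le
    have h2 : ‖wt (-w) x‖ ≤ 2 * ‖wt (-z) x‖ := by
      have h3 := norm_pos_iff.2 (add_ne_zero_of_im (neg_im_ne hz) x)
      have h4 := norm_pos_iff.2 (add_ne_zero_of_im (neg_im_ne (hpos w hw)) x)
      rw [wt, wt, norm_inv, norm_inv, ← div_eq_mul_inv, ← one_div, div_le_div_iff₀ h4 h3]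
      have h5 : ‖(x : ℂ) + -z‖ ≤ ‖(x : ℂ) + -w‖ + ‖w - z‖ := by
        have := norm_add_le ((x : ℂ) + -w) (w - z)
        rwa [show (x : ℂ) + -w + (w - z) = x + -z by ring] at this
      have h6 := hw
      rw [Metric.mem_ball, dist_eq_norm] at h6
      have h7 : w.im ≤ ‖(x : ℂ) + -w‖ := by
        have := Complex.abs_im_le_norm ((x : ℂ) + -w)
        simp only [add_im, ofReal_im, neg_im, zero_add, abs_neg] at this
        exact (le_abs_self _).trans this
      have h8 := hball w hw
      linarith
    rw [norm_mul, norm_mul, norm_mul]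
    calc ‖g x‖ * (‖wt (-w) x‖ * ‖wt (-w) x‖)
        ≤ ‖g x‖ * ((2 * ‖wt (-z) x‖) * (z.im / 2)⁻¹) := by gcongr
      _ = _ := by ring
  · exact hgi.mul_const _
  · refine Eventually.of_forall fun x w hw => ?_
    have h1 : HasDerivAt (fun w : ℂ => (x : ℂ) + -w) (-1) w := (hasDerivAt_neg w).const_add _
    have h2 := (h1.inv (add_ne_zero_of_im (neg_im_ne (hpos w hw)) x)).const_mul (g x)
    refine h2.congr_deriv ?_
    unfold wt
    field_simp

lemma Hinf.differentiableOn {C : ℝ} {u : ℝ → ℂ} (hb : Bdd C u) (hu : Hinf u) :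
    DifferentiableOn ℂ (poisInt u) {z | 0 < z.im} := by
  have h1 : MemLp (fun x => u x * wt I x) 2 volume :=
    memLp_bdd_mul (memLp_wt (by simp) (by norm_num)) hb.memLp_top
  have h2 : DifferentiableOn ℂ (fun z => (2 * Real.pi * I)⁻¹ * (z + I) *
      ∫ x, u x * wt I x * wt (-z) x) {z | 0 < z.im} :=
    DifferentiableOn.mul (by fun_prop) (differentiableOn_cauchy h1)
  exact h2.congr fun z hz => hu.poisInt_eq hb hz

lemma integral_wt_wt_conj {z : ℂ} (hz : 0 < z.im) :
    (z.im / Real.pi : ℂ) * ∫ x, wt (-z) x * wt (-conj z) x = 1 := by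
  have := poisInt_eq_wt hz (fun _ => 1)
  simp only [one_mul] at this
  rw [← this]
  simp only [poisInt, one_mul]
  rw [integral_complex_ofReal, integral_pois, ofReal_one]

/-- The Poisson extension is multiplicative on multipliers. -/
lemma HMult.poisInt_mul {C D : ℝ} {u v : ℝ → ℂ} (hu : HMult u) (hub : Bdd C u) (hv : HMult v)
    (hvb : Bdd D v) {z : ℂ} (hz : 0 < z.im) :
    poisInt (fun x => u x * v x) z = poisInt u z * poisInt v z := by
  have hz' := neg_conj_im_pos hz
  have hzn := neg_im_ne hz
  set a : ℝ → ℂ := wt (-conj z) with ha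
  have ha2 : MemLp a 2 volume := memLp_wt hz'.ne' (by norm_num)
  have hva : MemLp (fun x => v x * a x) 2 volume := memLp_bdd_mul ha2 hvb.memLp_top
  have hvaH : HardyVanish fun x => v x * a x := hv a ha2 (hardyVanish_wt hz')
  set c := poisInt v z with hc
  let h : ℝ → ℂ := fun x => v x * a x - c * a x
  have hh2 : MemLp h 2 volume := hva.sub (ha2.const_mul c)
  have hhH : HardyVanish h := by
    intro w hw
    simp only [h, sub_mul]
    rw [integral_sub (integrable_mul_wt (by simp) (by simp) hva hw.ne')
      (integrable_mul_wt (by simp) (by simp) (ha2.const_mul c) hw.ne'), hvaH w hw,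
      ((hardyVanish_wt hz').const_mul c) w hw, sub_zero]
  have hy : (z.im / Real.pi : ℂ) ≠ 0 := by
    have h1 : (z.im : ℂ) ≠ 0 := by exact_mod_cast hz.ne'
    have h2 : (Real.pi : ℂ) ≠ 0 := by exact_mod_cast Real.pi_ne_zero
    exact div_ne_zero h1 h2
  have hcv : (z.im / Real.pi : ℂ) * ∫ x, v x * a x * wt (-z) x = c := by
    rw [hc, poisInt_eq_wt hz]
    simp only [mul_comm (wt (-z) _), ha, mul_assoc]
  have hone := integral_wt_wt_conj hz
  have h0 : ∫ x, h x * wt (-z) x = 0 := by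
    simp only [h, sub_mul]
    rw [integral_sub (integrable_mul_wt (by simp) (by simp) hva hzn)
      (integrable_mul_wt (by simp) (by simp) (ha2.const_mul c) hzn)]
    simp only [mul_assoc] at hcv ⊢
    rw [integral_const_mul]
    simp only [mul_comm (wt (-z) _)] at hone
    apply (mul_right_inj' hy).1
    linear_combination hcv - c * hone
  have hkH : HardyVanish fun x => h x * wt (-z) x := by
    intro w hw
    have hne : -z ≠ w := fun h => by
      rw [← h] at hw
      simp at hw
      linarith
    simp only [mul_assoc]
    rw [integral_mul_wt_mul_wt (by simp) (by simp) hh2 hzn hw.ne' hne, h0, hhH w hw]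
    simp
  have hk2 : MemLp (fun x => h x * wt (-z) x) 2 volume := memLp_mul_bdd hh2 (memLp_wt_top hzn)
  have huk := hu _ hk2 hkH
  have hki := hub.integrable_mul (integrable_mul_wt (by simp) (by simp) hh2 hzn)
  have hfin := huk.integral_eq_zero hki
  have e : ∀ x, u x * (h x * wt (-z) x) = u x * v x * (wt (-z) x * wt (-conj z) x) -
      c * (u x * (wt (-z) x * wt (-conj z) x)) := by
    intro x
    simp only [h, ha]
    ring
  simp_rw [e] at hfin
  have huv : Bdd (C * D) fun x => u x * v x := ⟨hub.meas.mul hvb.meas, fun x => by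
    rw [norm_mul]
    exact mul_le_mul (hub.bound x) (hvb.bound x) (norm_nonneg _)
      ((norm_nonneg _).trans (hub.bound x))⟩
  rw [integral_sub (integrable_mul_wt_wt huv hzn hz'.ne')
    ((integrable_mul_wt_wt hub hzn hz'.ne').const_mul c), integral_const_mul] at hfin
  rw [poisInt_eq_wt hz, poisInt_eq_wt hz u]
  linear_combination (z.im / Real.pi : ℂ) * hfin

end

section

/-- The quotient of a translate of `φ` by `φ`. -/
def quo (φ : ℝ → ℂ) (m x : ℝ) : ℂ := φ (x - m) * conj (φ x)

/-- The Poisson extension of `quo φ m`. -/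
def quoExt (φ : ℝ → ℂ) (m : ℝ) (z : ℂ) : ℂ := poisInt (quo φ m) z

lemma Unimod.quo {φ : ℝ → ℂ} (h : Unimod φ) (m : ℝ) : Unimod (quo φ m) := (h.comp_sub m).mul h.conj

lemma measurable_quo {φ : ℝ → ℂ} (h : Unimod φ) : Measurable fun w : ℝ × ℝ => quo φ w.1 w.2 := by
  unfold quo
  exact (h.meas.comp (measurable_snd.sub measurable_fst)).mul (h.conj.meas.comp measurable_snd)

/-- All the quotients `quo φ m`, `m ≥ 0`, are multipliers of the Hardy space. -/
structure InnerQuo (φ : ℝ → ℂ) : Prop where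
  unimod : Unimod φ
  hmult : ∀ m : ℝ, 0 ≤ m → HMult (quo φ m)

lemma SemiInv.innerQuo {φ : ℝ → ℂ} (hφ : Unimod φ) (hI : SemiInv (mulHardy 2 φ)) : InnerQuo φ := by
  refine ⟨hφ, fun m hm h hh hv => ?_⟩
  have h1 : MemLp (fun x => φ x * h (x + m)) 2 volume :=
    memLp_bdd_mul (hh.comp_measurePreserving (measurePreserving_add_right volume m))
      hφ.memLp_top
  have h2 : HardyVanish fun x => h (x + m) := by simpa using hv.comp_sub (-m)
  have hg : h1.toLp _ ∈ mulHardy 2 φ := by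
    rw [mem_mulHardy_iff hφ]
    refine h2.congr ?_
    filter_upwards [h1.coeFn_toLp] with x hx
    rw [hx, ← mul_assoc, hφ.conj_mul, one_mul]
  have h3 := hI.2 m hm _ hg
  rw [mem_mulHardy_iff hφ] at h3
  refine h3.congr ?_
  filter_upwards [coe_transOp 2 m (h1.toLp _),
    (measurePreserving_sub_right volume m).quasiMeasurePreserving.ae h1.coeFn_toLp] with x h4 h5
  rw [h4, h5, sub_add_cancel, quo]
  ring

variable {φ : ℝ → ℂ}

lemma quoExt_zero (hφ : Unimod φ) (z : ℂ) : quoExt φ 0 z = 1 := by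
  have : quo φ 0 = fun _ => 1 := by
    funext x
    rw [quo, sub_zero, mul_comm, hφ.conj_mul]
  rw [quoExt, this, poisInt]
  simp only [one_mul]
  rw [integral_complex_ofReal, integral_pois, ofReal_one]

lemma norm_quoExt_le (hφ : Unimod φ) (m : ℝ) (z : ℂ) : ‖quoExt φ m z‖ ≤ 1 :=
  (hφ.quo m).bdd.norm_poisInt_le z

lemma InnerQuo.quoExt_add (h : InnerQuo φ) {m n : ℝ} (hm : 0 ≤ m) (hn : 0 ≤ n) {z : ℂ}
    (hz : 0 < z.im) : quoExt φ (m + n) z = quoExt φ n z * quoExt φ m (z - n) := by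
  have e : quo φ (m + n) = fun x => quo φ n x * quo φ m (x - n) := by
    funext x
    have := h.unimod.conj_mul (x - n)
    unfold quo
    rw [show x - n - m = x - (m + n) by ring]
    linear_combination (-φ (x - (m + n)) * conj (φ x)) * this
  have e2 : quoExt φ m (z - n) = poisInt (fun x => quo φ m (x - n)) z := by
    simp only [quoExt, poisInt, sub_re, ofReal_re, sub_im, ofReal_im, sub_zero]
    congr 1; funext s
    congr 2; ring
  rw [e2, quoExt, e, (h.hmult n hn).poisInt_mul (h.unimod.quo n).bdd ((h.hmult m hm).comp_sub n)
    ((h.unimod.quo m).comp_sub n).bdd hz]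
  rfl

lemma continuous_quoExt (h : Unimod φ) {z : ℂ} (hz : 0 < z.im) :
    Continuous fun m => quoExt φ m z := by
  have h1 : Integrable fun x => conj (φ x) * (pk z x : ℂ) :=
    h.conj.bdd.integrable_mul (integrable_pk hz).ofReal
  refine (continuous_correlation h1 h.bdd).congr fun m => ?_
  rw [quoExt, poisInt_eq hz]
  congr 1; funext x
  rw [quo]; ring

lemma InnerQuo.differentiableOn_quoExt (h : InnerQuo φ) {m : ℝ} (hm : 0 ≤ m) :
    DifferentiableOn ℂ (quoExt φ m) {z | 0 < z.im} :=
  (h.hmult m hm).hinf.differentiableOn (h.unimod.quo m).bdd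

/-- The integral of the extended quotients over `[0, ε]`. -/
def quoInt (φ : ℝ → ℂ) (ε : ℝ) (z : ℂ) : ℂ := ∫ t in (0:ℝ)..ε, quoExt φ t z

lemma integral_quo_mul (hφ : Unimod φ) {ε : ℝ} (hε : 0 ≤ ε) {g : ℝ → ℂ} (hg : Integrable g) :
    ∫ x, (∫ t in (0:ℝ)..ε, quo φ t x) * g x = ∫ t in (0:ℝ)..ε, ∫ x, quo φ t x * g x := by
  simp only [intervalIntegral.integral_of_le hε, ← integral_mul_const]
  rw [integral_integral_swap]
  have h1 : Integrable (fun w : ℝ × ℝ => g w.1 * (1:ℂ))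
      (volume.prod (volume.restrict (Set.Ioc 0 ε))) := hg.mul_prod (integrable_const (1:ℂ))
  have h2 := h1.bdd_mul (c := 1) (f := fun w : ℝ × ℝ => quo φ w.2 w.1)
    ((measurable_quo hφ).comp measurable_swap).aestronglyMeasurable
    (Eventually.of_forall fun w => ((hφ.quo _).norm _).le)
  simpa [Function.uncurry_def] using h2

lemma InnerQuo.differentiableOn_quoInt (h : InnerQuo φ) {ε : ℝ} (hε : 0 ≤ ε) :
    DifferentiableOn ℂ (quoInt φ ε) {z | 0 < z.im} := by
  have hb : Bdd ε fun x => ∫ t in (0:ℝ)..ε, quo φ t x := by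
    constructor
    · simp only [intervalIntegral.integral_of_le hε]
      exact (((measurable_quo h.unimod).comp measurable_swap).stronglyMeasurable.integral_prod_right
        (f := fun x t => quo φ t x)).measurable
    · intro x
      have := intervalIntegral.norm_integral_le_of_norm_le_const (a := 0) (b := ε) (C := 1)
        (f := fun t => quo φ t x) fun t _ => ((h.unimod.quo t).norm x).le
      simpa [abs_of_nonneg hε] using this
  have hi : Hinf fun x => ∫ t in (0:ℝ)..ε, quo φ t x := by
    intro a b ha hb
    rw [integral_quo_mul h.unimod hε (integrable_wt_mul_wt ha.ne' hb.ne')]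
    rw [intervalIntegral.integral_of_le hε]
    refine setIntegral_eq_zero_of_forall_eq_zero fun t ht => ?_
    exact (h.hmult t ht.1.le).hinf a b ha hb
  refine (hi.differentiableOn hb).congr fun z hz => ?_
  rw [poisInt_eq hz, integral_quo_mul h.unimod hε (g := fun x => (pk z x : ℂ)) (integrable_pk hz).ofReal,
    quoInt]
  simp only [quoExt, poisInt_eq hz]

lemma InnerQuo.quoExt_mul_quoInt (h : InnerQuo φ) {m ε : ℝ} (hm : 0 ≤ m) (hε : 0 ≤ ε) {z : ℂ}
    (hz : 0 < z.im) :
    quoExt φ m z * quoInt φ ε (z - m) = ∫ t in m..(m + ε), quoExt φ t z := by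
  have h1 := intervalIntegral.integral_comp_add_right (a := 0) (b := ε)
    (fun t => quoExt φ t z) m
  rw [zero_add, add_comm ε] at h1
  rw [← h1, quoInt, ← intervalIntegral.integral_const_mul]
  refine intervalIntegral.integral_congr fun t ht => ?_
  rw [Set.uIcc_of_le hε] at ht
  exact (h.quoExt_add ht.1 hm hz).symm

lemma exists_quoInt_ne_zero (h : Unimod φ) {z : ℂ} (hz : 0 < z.im) :
    ∃ ε : ℝ, 0 < ε ∧ quoInt φ ε z ≠ 0 := by
  have h1 := (continuous_quoExt h hz).tendsto 0
  rw [quoExt_zero h, Metric.tendsto_nhds_nhds] at h1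
  obtain ⟨d, hd, h2⟩ := h1 (1/2) (by norm_num)
  refine ⟨d / 2, by positivity, fun h0 => ?_⟩
  have h3 := intervalIntegral.norm_integral_le_of_norm_le_const (a := 0) (b := d / 2) (C := 1 / 2)
    (f := fun t => quoExt φ t z - 1) fun t ht => by
      rw [Set.uIoc_of_le (by positivity)] at ht
      rw [← dist_eq_norm]
      refine (h2 ?_).le
      rw [Real.dist_eq, sub_zero, abs_of_pos ht.1]
      linarith [ht.2]
  rw [intervalIntegral.integral_sub ((continuous_quoExt h hz).intervalIntegrable _ _)
    intervalIntegrable_const, ← quoInt, h0] at h3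
  simp only [intervalIntegral.integral_const, sub_zero, zero_sub, norm_neg, real_smul, mul_one,
    Complex.norm_real, Real.norm_eq_abs] at h3
  rw [abs_of_pos (by positivity)] at h3
  linarith

/-- The negative logarithmic derivative of `quoExt φ` at `0`. -/
def quoGen (φ : ℝ → ℂ) (z : ℂ) : ℂ := -derivWithin (fun m => quoExt φ m z) (Set.Ici 0) 0

lemma isOpen_upper : IsOpen {z : ℂ | 0 < z.im} := isOpen_lt continuous_const continuous_im

lemma InnerQuo.hasDerivWithinAt_aux (h : InnerQuo φ) {z : ℂ} (hz : 0 < z.im) {ε : ℝ} (hε : 0 ≤ ε)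
    (h0 : quoInt φ ε z ≠ 0) : HasDerivWithinAt (fun m => quoExt φ m z)
      ((quoExt φ ε z - 1 + deriv (quoInt φ ε) z) / quoInt φ ε z) (Set.Ici 0) 0 := by
  have hc := continuous_quoExt h.unimod hz
  have hN1 : ∀ b : ℝ, HasDerivAt (fun m => ∫ t in (0:ℝ)..m, quoExt φ t z) (quoExt φ b z) b :=
    fun b => intervalIntegral.integral_hasDerivAt_right (hc.intervalIntegrable _ _)
      hc.stronglyMeasurable.stronglyMeasurableAtFilter hc.continuousAt
  have hN : HasDerivAt (fun m => ∫ t in m..(m + ε), quoExt φ t z)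
      (quoExt φ ε z - quoExt φ 0 z) 0 := by
    have h1 : HasDerivAt (fun m : ℝ => ∫ t in (0:ℝ)..(m + ε), quoExt φ t z)
        (quoExt φ ε z) 0 := by
      have := (hN1 (0 + ε)).comp_add_const 0 ε
      rwa [zero_add] at this
    refine (h1.sub (hN1 0)).congr_of_eventuallyEq (Eventually.of_forall fun m => ?_)
    simp only [Pi.sub_apply]
    rw [intervalIntegral.integral_interval_sub_left] <;> exact hc.intervalIntegrable _ _
  have hA : HasDerivAt (quoInt φ ε) (deriv (quoInt φ ε) z) z :=
    ((h.differentiableOn_quoInt hε).differentiableAt (isOpen_upper.mem_nhds hz)).hasDerivAt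
  have hD : HasDerivAt (fun m : ℝ => quoInt φ ε (z - m)) (-deriv (quoInt φ ε) z) 0 := by
    have h1 : HasDerivAt (fun m : ℝ => z - (m : ℂ)) (-1) 0 := by
      simpa using (ofRealCLM.hasDerivAt (x := (0:ℝ))).const_sub z
    have h2 : HasDerivAt (quoInt φ ε) (deriv (quoInt φ ε) z) (z - ((0:ℝ) : ℂ)) := by simpa using hA
    have h3 := HasDerivAt.comp (0:ℝ) h2 h1
    rwa [mul_neg_one] at h3
  have hQ := hN.div hD (by simpa using h0)
  have hne : ∀ᶠ m : ℝ in 𝓝 0, quoInt φ ε (z - m) ≠ 0 :=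
    hD.continuousAt.eventually_ne (by simpa using h0)
  have h2 := hQ.hasDerivWithinAt (s := Set.Ici 0)
  have h3 : HasDerivWithinAt (fun m => quoExt φ m z) _ (Set.Ici 0) 0 :=
    h2.congr_of_eventuallyEq (by
      filter_upwards [self_mem_nhdsWithin, nhdsWithin_le_nhds hne] with m hm hm'
      have := h.quoExt_mul_quoInt hm hε hz
      simp only [Pi.div_apply]
      rw [← this, mul_div_cancel_right₀ _ hm']) (by
      have := h.quoExt_mul_quoInt le_rfl hε hz
      simp only [Pi.div_apply]
      rw [← this, mul_div_cancel_right₀ _ (by simpa using h0)])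
  refine h3.congr_deriv ?_
  rw [quoExt_zero h.unimod]
  simp only [zero_add, ofReal_zero, sub_zero]
  rw [← quoInt]
  field_simp
  ring

lemma InnerQuo.quoGen_eq (h : InnerQuo φ) {z : ℂ} (hz : 0 < z.im) {ε : ℝ} (hε : 0 ≤ ε)
    (h0 : quoInt φ ε z ≠ 0) :
    quoGen φ z = -((quoExt φ ε z - 1 + deriv (quoInt φ ε) z) / quoInt φ ε z) := by
  rw [quoGen, (h.hasDerivWithinAt_aux hz hε h0).derivWithin (uniqueDiffWithinAt_Ici 0)]

lemma InnerQuo.hasDerivWithinAt_zero (h : InnerQuo φ) {z : ℂ} (hz : 0 < z.im) :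
    HasDerivWithinAt (fun m => quoExt φ m z) (-quoGen φ z) (Set.Ici 0) 0 := by
  obtain ⟨ε, hε, h0⟩ := exists_quoInt_ne_zero h.unimod hz
  rw [h.quoGen_eq hz hε.le h0, neg_neg]
  exact h.hasDerivWithinAt_aux hz hε.le h0

lemma InnerQuo.differentiableOn_quoGen (h : InnerQuo φ) :
    DifferentiableOn ℂ (quoGen φ) {z | 0 < z.im} := by
  intro z hz
  obtain ⟨ε, hε, h0⟩ := exists_quoInt_ne_zero h.unimod hz
  have hm := isOpen_upper.mem_nhds hz
  have hd := (h.differentiableOn_quoInt hε.le)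
  have h1 := hd.differentiableAt hm
  have h2 := (hd.deriv isOpen_upper).differentiableAt hm
  have h3 := (h.differentiableOn_quoExt hε.le).differentiableAt hm
  have h4 : DifferentiableAt ℂ
      (fun z => -((quoExt φ ε z - 1 + deriv (quoInt φ ε) z) / quoInt φ ε z)) z :=
    (((h3.sub_const 1).add h2).div h1 h0).neg
  refine (h4.congr_of_eventuallyEq ?_).differentiableWithinAt
  filter_upwards [hm, h1.continuousAt.eventually_ne h0] with w hw hw'
  exact h.quoGen_eq hw hε.le hw'

lemma InnerQuo.hasDerivWithinAt (h : InnerQuo φ) {z : ℂ} (hz : 0 < z.im) {b : ℝ} (hb : 0 ≤ b) :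
    HasDerivWithinAt (fun m => quoExt φ m z) (-quoExt φ b z * quoGen φ (z - b)) (Set.Ici b) b := by
  have hz' : 0 < (z - b).im := by simpa using hz
  have h1 := h.hasDerivWithinAt_zero hz'
  have h2 : HasDerivWithinAt (fun m : ℝ => m - b) 1 (Set.Ici b) b :=
    ((hasDerivAt_id b).sub_const b).hasDerivWithinAt
  have h1' : HasDerivWithinAt (fun m => quoExt φ m (z - b)) (-quoGen φ (z - b))
      (Set.Ici 0) (b - b) := by
    rwa [sub_self]
  have h3 := (HasDerivWithinAt.scomp (h := fun m => m - b) b h1' h2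
    (fun m hm => Set.mem_Ici.2 (sub_nonneg.2 hm))).const_mul (quoExt φ b z)
  have h4 := h3.congr_deriv (g' := -quoExt φ b z * quoGen φ (z - b)) (by simp)
  refine h4.congr (fun m hm => ?_) ?_
  · have := h.quoExt_add (sub_nonneg.2 hm) hb hz
    simpa using this
  · simp [quoExt_zero h.unimod]

lemma InnerQuo.continuous_quoGen (h : InnerQuo φ) {z : ℂ} (hz : 0 < z.im) :
    Continuous fun t : ℝ => quoGen φ (z - t) :=
  h.differentiableOn_quoGen.continuousOn.comp_continuous (by fun_prop) fun t => by simpa using hz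

lemma InnerQuo.quoExt_eq_exp (h : InnerQuo φ) {z : ℂ} (hz : 0 < z.im) {m : ℝ} (hm : 0 ≤ m) :
    quoExt φ m z = exp (-∫ t in (0:ℝ)..m, quoGen φ (z - t)) := by
  have hc := h.continuous_quoGen hz
  have hE : ∀ b : ℝ, HasDerivAt (fun m : ℝ => exp (∫ t in (0:ℝ)..m, quoGen φ (z - t)))
      (exp (∫ t in (0:ℝ)..b, quoGen φ (z - t)) * quoGen φ (z - b)) b := fun b =>
    (intervalIntegral.integral_hasDerivAt_right (hc.intervalIntegrable _ _)
      hc.stronglyMeasurable.stronglyMeasurableAtFilter hc.continuousAt).cexp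
  have h1 := constant_of_has_deriv_right_zero (a := 0) (b := m)
    (f := fun m => quoExt φ m z * exp (∫ t in (0:ℝ)..m, quoGen φ (z - t)))
    ((continuous_quoExt h.unimod hz).mul
      (continuous_iff_continuousAt.2 fun b => (hE b).continuousAt)).continuousOn
    (fun b hb => ((h.hasDerivWithinAt hz hb.1).mul (hE b).hasDerivWithinAt).congr_deriv (by ring))
    m ⟨hm, le_rfl⟩
  simp only [intervalIntegral.integral_same, exp_zero, quoExt_zero h.unimod, mul_one] at h1
  rw [exp_neg]
  exact eq_inv_of_mul_eq_one_left h1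

end

section

variable {φ : ℝ → ℂ}

lemma InnerQuo.tendsto_div (h : InnerQuo φ) {z : ℂ} (hz : 0 < z.im) :
    Tendsto (fun m : ℝ => (1 - (quoExt φ m z).re) / m) (𝓝[>] 0) (𝓝 (quoGen φ z).re) := by
  have h1 := (h.hasDerivWithinAt_zero hz).mono (Set.Ioi_subset_Ici le_rfl)
  rw [hasDerivWithinAt_iff_tendsto_slope' (by simp)] at h1
  have h2 := ((continuous_re.tendsto _).comp h1).neg
  simp only [neg_re, neg_neg] at h2
  refine h2.congr fun m => ?_
  simp only [Function.comp, slope_def_module, sub_zero, quoExt_zero h.unimod, real_smul,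
    re_ofReal_mul, sub_re, one_re]
  ring

lemma InnerQuo.quoGen_re_nonneg (h : InnerQuo φ) {z : ℂ} (hz : 0 < z.im) :
    0 ≤ (quoGen φ z).re := by
  refine ge_of_tendsto (h.tendsto_div hz) ?_
  filter_upwards [self_mem_nhdsWithin] with m hm
  have h1 := (re_le_norm _).trans (norm_quoExt_le h.unimod m z)
  exact div_nonneg (by linarith) (le_of_lt hm)

lemma InnerQuo.norm_quoExt (h : InnerQuo φ) {z : ℂ} (hz : 0 < z.im) {m : ℝ} (hm : 0 ≤ m) :
    ‖quoExt φ m z‖ = Real.exp (-∫ t in (0:ℝ)..m, (quoGen φ (z - t)).re) := by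
  rw [h.quoExt_eq_exp hz hm, norm_exp, neg_re]
  congr 2
  exact (reCLM.intervalIntegral_comp_comm
    ((h.continuous_quoGen hz).intervalIntegrable _ _)).symm

lemma InnerQuo.continuous_line (h : InnerQuo φ) {δ : ℝ} (hδ : 0 < δ) :
    Continuous fun t : ℝ => quoGen φ (t + δ * I) :=
  h.differentiableOn_quoGen.continuousOn.comp_continuous (by fun_prop) fun t => by simpa using hδ

/-- The real part of `quoGen φ` has no mass on the boundary. -/
lemma InnerQuo.tendsto_integral_re (h : InnerQuo φ) {R : ℝ} (hR : 0 ≤ R) :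
    Tendsto (fun δ : ℝ => ∫ t in (-R)..R, (quoGen φ (t + δ * I)).re) (𝓝[>] 0) (𝓝 0) := by
  set m := 2 * R + 1 with hm
  have hm0 : 0 ≤ m := by positivity
  set G : ℝ → ℂ := (Set.Icc R (R + 1)).indicator fun x => conj (quo φ m x) with hG
  have hGi : Integrable G := by
    rw [hG, integrable_indicator_iff measurableSet_Icc]
    have := (h.unimod.quo m).conj.bdd.integrable_mul
      (E := volume.restrict (Set.Icc R (R + 1))) (integrable_const (1:ℂ))
    simpa [IntegrableOn] using this
  have h1 := (tendsto_integral_mul_poisInt hGi (h.unimod.quo m).bdd).norm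
  have h2 : ∫ x, G x * quo φ m x = 1 := by
    have : ∀ x, G x * quo φ m x = (Set.Icc R (R + 1)).indicator (fun _ => (1:ℂ)) x := by
      intro x
      rw [hG]
      by_cases hx : x ∈ Set.Icc R (R + 1)
      · simp only [Set.indicator_of_mem hx, (h.unimod.quo m).conj_mul]
      · simp only [Set.indicator_of_notMem hx, zero_mul]
    simp_rw [this]
    rw [integral_indicator measurableSet_Icc]
    simp
  rw [h2, norm_one] at h1
  have h3 : ∀ δ : ℝ, 0 < δ → ‖∫ x, G x * poisInt (quo φ m) (x + δ * I)‖ ≤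
      Real.exp (-∫ t in (-R)..R, (quoGen φ (t + δ * I)).re) := by
    intro δ hδ
    set E := Real.exp (-∫ t in (-R)..R, (quoGen φ (t + δ * I)).re) with hE
    have hk : Continuous fun t : ℝ => (quoGen φ (t + δ * I)).re :=
      continuous_re.comp (h.continuous_line hδ)
    have h5 : ∀ x : ℝ, ‖G x * poisInt (quo φ m) (x + δ * I)‖ ≤
        (Set.Icc R (R + 1)).indicator (fun _ => E) x := by
      intro x
      by_cases hx : x ∈ Set.Icc R (R + 1)
      · rw [hG, Set.indicator_of_mem hx, Set.indicator_of_mem hx, norm_mul,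
          (h.unimod.quo m).conj.norm, one_mul]
        have hz : 0 < ((x : ℂ) + δ * I).im := by simpa using hδ
        change ‖quoExt φ m (x + δ * I)‖ ≤ E
        rw [h.norm_quoExt hz hm0, hE]
        refine Real.exp_le_exp.2 (neg_le_neg ?_)
        have h6 := intervalIntegral.integral_comp_sub_left (a := 0) (b := m)
          (fun t : ℝ => (quoGen φ (t + δ * I)).re) x
        have h7 : ∀ t : ℝ, (x : ℂ) + δ * I - t = ((x - t : ℝ) : ℂ) + δ * I := fun t => by
          push_cast; ring
        simp_rw [h7]
        rw [h6]
        refine intervalIntegral.integral_mono_interval (by linarith [hx.2]) (by linarith)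
          (by linarith [hx.1]) (Eventually.of_forall fun t => ?_) (hk.intervalIntegrable _ _)
        exact h.quoGen_re_nonneg (by simpa using hδ)
      · rw [hG, Set.indicator_of_notMem hx, Set.indicator_of_notMem hx, zero_mul, norm_zero]
    refine (norm_integral_le_of_norm_le ?_ (Eventually.of_forall h5)).trans ?_
    · exact (integrable_indicator_iff measurableSet_Icc).2 (integrableOn_const (by simp))
    · rw [integral_indicator measurableSet_Icc]
      simp
  have h4 : Tendsto (fun δ : ℝ => -Real.log ‖∫ x, G x * poisInt (quo φ m) (x + δ * I)‖)
      (𝓝[>] 0) (𝓝 0) := by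
    simpa using ((Real.continuousAt_log one_ne_zero).tendsto.comp h1).neg
  refine tendsto_of_tendsto_of_tendsto_of_le_of_le' tendsto_const_nhds h4 ?_ ?_
  · filter_upwards [self_mem_nhdsWithin] with δ hδ
    exact intervalIntegral.integral_nonneg (by linarith) fun t _ =>
      h.quoGen_re_nonneg (by simpa using hδ)
  · filter_upwards [self_mem_nhdsWithin, h1.eventually_const_lt zero_lt_one] with δ hδ h5
    have := Real.log_le_log h5 (h3 δ hδ)
    rw [Real.log_exp] at this
    linarith

/-- The nonnegative boundary densities whose Poisson extensions converge to `(quoGen φ z).re`. -/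
def quoDens (φ : ℝ → ℂ) (m t : ℝ) : ℝ := (1 - (quo φ m t).re) / m

lemma quoDens_nonneg (h : Unimod φ) {m : ℝ} (hm : 0 < m) (t : ℝ) : 0 ≤ quoDens φ m t := by
  have := (re_le_norm _).trans ((h.quo m).norm t).le
  exact div_nonneg (by linarith) hm.le

lemma quoDens_le (h : Unimod φ) {m : ℝ} (hm : 0 < m) (t : ℝ) : quoDens φ m t ≤ 2 / m := by
  have := (abs_le.1 ((abs_re_le_norm _).trans ((h.quo m).norm t).le)).1
  exact div_le_div_of_nonneg_right (by linarith) hm.le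

lemma measurable_quoDens (h : Unimod φ) (m : ℝ) : Measurable (quoDens φ m) :=
  (measurable_const.sub (measurable_re.comp (h.quo m).meas)).div_const m

lemma integrable_mul_quoDens (h : Unimod φ) {m : ℝ} (hm : 0 < m) {g : ℝ → ℝ} {E : Measure ℝ}
    (hg : Integrable g E) : Integrable (fun t => quoDens φ m t * g t) E :=
  hg.bdd_mul (c := 2 / m) (measurable_quoDens h m).aestronglyMeasurable
    (Eventually.of_forall fun t => by
      rw [Real.norm_of_nonneg (quoDens_nonneg h hm t)]
      exact quoDens_le h hm t)

lemma integral_pk {z : ℂ} (hz : 0 < z.im) : ∫ t, pk z t = 1 := by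
  have h1 := poisInt_eq hz fun _ => 1
  simp only [poisInt, one_mul] at h1
  rw [integral_complex_ofReal, integral_complex_ofReal, integral_pois] at h1
  exact_mod_cast h1.symm

lemma integral_quoDens_pk (h : Unimod φ) (m : ℝ) {z : ℂ} (hz : 0 < z.im) :
    ∫ t, quoDens φ m t * pk z t = (1 - (quoExt φ m z).re) / m := by
  have h1 : (quoExt φ m z).re = ∫ t, (quo φ m t).re * pk z t := by
    rw [quoExt, poisInt_eq hz]
    have h2 : Integrable fun t => quo φ m t * (pk z t : ℂ) :=
      (h.quo m).bdd.integrable_mul (integrable_pk hz).ofReal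
    have h3 := reCLM.integral_comp_comm h2
    simp only [reCLM_apply, re_mul_ofReal] at h3
    exact h3.symm
  have h4 : Integrable fun t => (quo φ m t).re * pk z t :=
    (integrable_pk hz).bdd_mul (c := 1) (measurable_re.comp (h.quo m).meas).aestronglyMeasurable
      (Eventually.of_forall fun t => (abs_re_le_norm _).trans ((h.quo m).norm t).le)
  rw [h1, ← integral_pk hz, ← integral_sub (integrable_pk hz) h4, ← integral_div]
  congr 1; funext t
  rw [quoDens]; ring

end

section

variable {φ : ℝ → ℂ}

lemma pk_line (x δ t : ℝ) : pk (x + δ * I) t = δ / (Real.pi * ((t - x) ^ 2 + δ ^ 2)) := by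
  simp [pk]

lemma continuous_pk_line {δ : ℝ} (hδ : 0 < δ) (t : ℝ) :
    Continuous fun x : ℝ => pk (x + δ * I) t := by
  simp_rw [pk_line]
  exact continuous_const.div (by fun_prop) fun x => by positivity

lemma le_integral_pk {δ R t : ℝ} (hδ : 0 < δ) (hδ1 : δ ≤ 1) (hR : 1 ≤ R) (ht : t ∈ Set.Icc (-R) R) :
    (2 * Real.pi)⁻¹ ≤ ∫ x in (-R)..R, pk (x + δ * I) t := by
  have hgi := fun a b => (continuous_pk_line hδ t).intervalIntegrable (μ := volume) a b
  have hnn : ∀ x : ℝ, 0 ≤ pk (x + δ * I) t := fun x => pk_nonneg (by simpa using hδ) t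
  have key : ∀ a : ℝ, -R ≤ a → a + δ ≤ R → a ≤ t → t ≤ a + δ →
      (2 * Real.pi)⁻¹ ≤ ∫ x in (-R)..R, pk (x + δ * I) t := by
    intro a h1 h2 h3 h4
    calc (2 * Real.pi)⁻¹ = ∫ x in a..(a + δ), (2 * Real.pi * δ)⁻¹ := by
          rw [intervalIntegral.integral_const, smul_eq_mul]
          field_simp
          ring
      _ ≤ ∫ x in a..(a + δ), pk (x + δ * I) t := by
          refine intervalIntegral.integral_mono_on (by linarith) intervalIntegrable_const (hgi _ _)
            fun x hx => ?_
          rw [pk_line, inv_eq_one_div, div_le_div_iff₀ (by positivity) (by positivity)]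
          have : (t - x) ^ 2 ≤ δ ^ 2 := sq_le_sq' (by linarith [hx.2]) (by linarith [hx.1])
          have hp := mul_le_mul_of_nonneg_left this Real.pi_pos.le
          nlinarith [Real.pi_pos]
      _ ≤ _ := intervalIntegral.integral_mono_interval h1 (by linarith) h2
          (Eventually.of_forall hnn) (hgi _ _)
  rcases le_total t 0 with h | h
  · exact key t ht.1 (by linarith) le_rfl (by linarith)
  · exact key (t - δ) (by linarith) (by linarith [ht.2]) (by linarith) (by linarith)

lemma InnerQuo.continuous_ext_line (h : InnerQuo φ) {m : ℝ} (hm : 0 ≤ m) {δ : ℝ} (hδ : 0 < δ) :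
    Continuous fun x : ℝ => quoExt φ m (x + δ * I) :=
  (h.differentiableOn_quoExt hm).continuousOn.comp_continuous (by fun_prop)
    fun t => by simpa using hδ

lemma InnerQuo.integral_quoDens_le (h : InnerQuo φ) {δ R m : ℝ} (hδ : 0 < δ) (hδ1 : δ ≤ 1)
    (hR : 1 ≤ R) (hm : 0 < m) : ∫ t in (-R)..R, quoDens φ m t ≤
      2 * Real.pi * ∫ x in (-R)..R, (1 - (quoExt φ m (x + δ * I)).re) / m := by
  have hR' : -R ≤ R := by linarith
  have hz : ∀ x : ℝ, 0 < ((x : ℂ) + δ * I).im := fun x => by simpa using hδ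
  have hK : Integrable (fun w : ℝ × ℝ => pk (w.1 + δ * I) w.2)
      ((volume.restrict (Set.Ioc (-R) R)).prod volume) := by
    rw [integrable_prod_iff]
    · refine ⟨Eventually.of_forall fun x => integrable_pk (hz x), ?_⟩
      simp only [Real.norm_of_nonneg (pk_nonneg (hz _) _), integral_pk (hz _)]
      exact integrable_const _
    · simp_rw [pk_line]
      exact Measurable.aestronglyMeasurable (by fun_prop)
  have hdK : Integrable (fun w : ℝ × ℝ => quoDens φ m w.2 * pk (w.1 + δ * I) w.2)
      ((volume.restrict (Set.Ioc (-R) R)).prod volume) :=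
    hK.bdd_mul (c := 2 / m)
      ((measurable_quoDens h.unimod m).comp measurable_snd).aestronglyMeasurable
      (Eventually.of_forall fun w => by
        rw [Real.norm_of_nonneg (quoDens_nonneg h.unimod hm _)]
        exact quoDens_le h.unimod hm _)
  simp_rw [← integral_quoDens_pk h.unimod m (hz _)]
  have hswap : ∫ x in (-R)..R, ∫ t, quoDens φ m t * pk (x + δ * I) t =
      ∫ t, quoDens φ m t * ∫ x in (-R)..R, pk (x + δ * I) t := by
    simp only [intervalIntegral.integral_of_le hR', ← integral_const_mul]
    exact integral_integral_swap hdK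
  have hP : Integrable fun t => quoDens φ m t * ∫ x in (-R)..R, pk (x + δ * I) t := by
    simp only [intervalIntegral.integral_of_le hR', ← integral_const_mul]
    exact hdK.integral_prod_right
  have hP0 : ∀ t, 0 ≤ quoDens φ m t * ∫ x in (-R)..R, pk (x + δ * I) t := fun t =>
    mul_nonneg (quoDens_nonneg h.unimod hm t)
      (intervalIntegral.integral_nonneg hR' fun x _ => pk_nonneg (hz x) t)
  rw [hswap, ← integral_const_mul]
  have hI : IntegrableOn (quoDens φ m) (Set.Ioc (-R) R) := by
    have := integrable_mul_quoDens h.unimod hm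
      (E := volume.restrict (Set.Ioc (-R) R)) (integrable_const (1:ℝ))
    simpa [IntegrableOn] using this
  calc ∫ t in (-R)..R, quoDens φ m t
      ≤ ∫ t in Set.Ioc (-R) R, 2 * Real.pi *
          (quoDens φ m t * ∫ x in (-R)..R, pk (x + δ * I) t) := by
        rw [intervalIntegral.integral_of_le hR']
        refine setIntegral_mono_on hI (hP.const_mul _).integrableOn measurableSet_Ioc fun t ht => ?_
        have h1 := le_integral_pk hδ hδ1 hR (Set.Ioc_subset_Icc_self ht)
        have h2 := mul_le_mul_of_nonneg_left h1 (quoDens_nonneg h.unimod hm t)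
        have h3 := mul_le_mul_of_nonneg_left h2 (by positivity : 0 ≤ 2 * Real.pi)
        refine le_trans (le_of_eq ?_) h3
        field_simp
    _ ≤ _ := setIntegral_le_integral (hP.const_mul _)
        (Eventually.of_forall fun t => mul_nonneg (by positivity) (hP0 t))

lemma InnerQuo.norm_quoExt_sub_one_le (h : InnerQuo φ) {z : ℂ} (hz : 0 < z.im) {m C : ℝ}
    (hm : 0 ≤ m) (hC : ∀ t ∈ Set.Ico 0 m, ‖quoGen φ (z - t)‖ ≤ C) :
    ‖quoExt φ m z - 1‖ ≤ C * m := by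
  have := norm_image_sub_le_of_norm_deriv_right_le_segment (a := 0) (b := m)
    (continuous_quoExt h.unimod hz).continuousOn
    (fun t ht => h.hasDerivWithinAt hz ht.1) (C := C) (fun t ht => by
      rw [norm_mul, norm_neg]
      exact (mul_le_of_le_one_left (norm_nonneg _) (norm_quoExt_le h.unimod _ _)).trans (hC t ht))
    m ⟨hm, le_rfl⟩
  simpa [quoExt_zero h.unimod] using this

lemma InnerQuo.tendsto_integral_line (h : InnerQuo φ) {δ R : ℝ} (hδ : 0 < δ) :
    Tendsto (fun m : ℝ => ∫ x in (-R)..R, (1 - (quoExt φ m (x + δ * I)).re) / m) (𝓝[>] 0)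
      (𝓝 (∫ x in (-R)..R, (quoGen φ (x + δ * I)).re)) := by
  obtain ⟨C, hC⟩ := (isCompact_Icc (a := -|R| - 1) (b := |R|)).exists_bound_of_continuousOn
    (h.continuous_line hδ).continuousOn
  have hz : ∀ x : ℝ, 0 < ((x : ℂ) + δ * I).im := fun x => by simpa using hδ
  refine intervalIntegral.tendsto_integral_filter_of_dominated_convergence (fun _ => C) ?_ ?_
    intervalIntegrable_const (Eventually.of_forall fun x _ => h.tendsto_div (hz x))
  · filter_upwards [self_mem_nhdsWithin] with m hm
    exact ((continuous_const.sub (continuous_re.comp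
      (h.continuous_ext_line (le_of_lt hm) hδ))).div_const m).aestronglyMeasurable
  · filter_upwards [Ioc_mem_nhdsGT zero_lt_one] with m hm
    refine Eventually.of_forall fun x hx => ?_
    have hx' : x ∈ Set.Icc (-|R|) |R| := by
      have h1 := Set.uIoc_subset_uIcc hx
      have h2 := neg_le_abs R
      have h3 := le_abs_self R
      have h4 := neg_abs_le R
      rcases Set.mem_uIcc.1 h1 with h5 | h5 <;> constructor <;> linarith [h5.1, h5.2]
    have h1 := h.norm_quoExt_sub_one_le (hz x) hm.1.le (C := C) fun t ht => by
      have := hC (x - t) ⟨by linarith [hx'.1, ht.2, hm.2], by linarith [hx'.2, ht.1]⟩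
      rwa [show (x : ℂ) + δ * I - t = ((x - t : ℝ) : ℂ) + δ * I by push_cast; ring]
    rw [Real.norm_eq_abs, abs_div, abs_of_pos hm.1, div_le_iff₀ hm.1, abs_sub_comm]
    have h2 := abs_re_le_norm (quoExt φ m (x + δ * I) - 1)
    rw [sub_re, one_re] at h2
    exact h2.trans h1

lemma InnerQuo.tendsto_integral_quoDens (h : InnerQuo φ) {R : ℝ} (hR : 1 ≤ R) :
    Tendsto (fun m : ℝ => ∫ t in (-R)..R, quoDens φ m t) (𝓝[>] 0) (𝓝 0) := by
  rw [tendsto_order]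
  constructor
  · intro a ha
    filter_upwards [self_mem_nhdsWithin] with m hm
    exact ha.trans_le (intervalIntegral.integral_nonneg (by linarith)
      fun t _ => quoDens_nonneg h.unimod hm t)
  · intro a ha
    have h1 : Tendsto (fun δ : ℝ => 2 * Real.pi * ∫ t in (-R)..R, (quoGen φ (t + δ * I)).re)
        (𝓝[>] 0) (𝓝 0) := by
      simpa using (h.tendsto_integral_re (by linarith : 0 ≤ R)).const_mul (2 * Real.pi)
    obtain ⟨δ, h2, h3⟩ := ((h1.eventually_lt_const ha).and (Ioc_mem_nhdsGT zero_lt_one)).exists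
    have h4 := ((h.tendsto_integral_line (R := R) h3.1).const_mul
      (2 * Real.pi)).eventually_lt_const h2
    filter_upwards [self_mem_nhdsWithin, h4] with m hm h5
    exact (h.integral_quoDens_le h3.1 h3.2 hR hm).trans_lt h5

lemma exists_pk_sub_le {z : ℂ} (hz : 0 < z.im) :
    ∃ D : ℝ, 0 ≤ D ∧ ∀ t : ℝ, |pk z t - z.im * pk I t| * (1 + |t|) ≤ D * pk I t := by
  set x := z.re
  set y := z.im
  have hy : 0 < y := hz
  set E := 1 + 2 * |x| + x ^ 2 + y ^ 2 with hE
  set F := 2 * (1 + |x|) ^ 2 / y ^ 2 + 2 with hF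
  have hE0 : 0 ≤ E := by positivity
  refine ⟨y * E * F, by positivity, fun t => ?_⟩
  have hI : pk I t = 1 / (Real.pi * (t ^ 2 + 1)) := by simp [pk]
  have hd : 0 < (t - x) ^ 2 + y ^ 2 := by positivity
  have e : pk z t - y * pk I t =
      y * pk I t * ((1 + 2 * t * x - x ^ 2 - y ^ 2) / ((t - x) ^ 2 + y ^ 2)) := by
    rw [hI]
    change y / (Real.pi * ((t - x) ^ 2 + y ^ 2)) - _ = _
    have := Real.pi_ne_zero
    have h1 : t ^ 2 + 1 ≠ 0 := by positivity
    field_simp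
    ring
  have h1 : |1 + 2 * t * x - x ^ 2 - y ^ 2| ≤ E * (1 + |t|) := by
    have hxt : |t * x| = |t| * |x| := abs_mul t x
    have h3 := le_abs_self (t * x)
    have h4 := neg_abs_le (t * x)
    have h5 := abs_nonneg t
    have h6 := abs_nonneg x
    have h7 : 0 ≤ (x ^ 2 + y ^ 2) * |t| := by positivity
    rw [hE, abs_le]
    constructor <;> nlinarith
  have h2 : (1 + |t|) ^ 2 ≤ F * ((t - x) ^ 2 + y ^ 2) := by
    have h3 : |t| ≤ |t - x| + |x| := by simpa using abs_add_le (t - x) x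
    have h4 : (1 + |t|) ^ 2 ≤ 2 * (1 + |x|) ^ 2 + 2 * (t - x) ^ 2 := by
      rw [← sq_abs (t - x)]
      have : (1 + |t|) ^ 2 ≤ ((1 + |x|) + |t - x|) ^ 2 :=
        pow_le_pow_left₀ (by positivity) (by linarith) 2
      nlinarith [sq_nonneg ((1 + |x|) - |t - x|)]
    have h5 : 2 * (1 + |x|) ^ 2 / y ^ 2 * y ^ 2 = 2 * (1 + |x|) ^ 2 := by field_simp
    have h6 : 0 ≤ 2 * (1 + |x|) ^ 2 / y ^ 2 * (t - x) ^ 2 := by positivity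
    rw [hF]
    nlinarith [sq_nonneg y]
  have hp := pk_nonneg (z := I) (by simp) t
  rw [e, abs_mul, abs_of_nonneg (mul_nonneg hy.le hp), abs_div, abs_of_pos hd]
  have h3 : |1 + 2 * t * x - x ^ 2 - y ^ 2| / ((t - x) ^ 2 + y ^ 2) * (1 + |t|) ≤ E * F := by
    rw [div_mul_eq_mul_div, div_le_iff₀ hd]
    calc |1 + 2 * t * x - x ^ 2 - y ^ 2| * (1 + |t|) ≤ E * (1 + |t|) * (1 + |t|) := by gcongr
      _ = E * (1 + |t|) ^ 2 := by ring
      _ ≤ E * (F * ((t - x) ^ 2 + y ^ 2)) := by gcongr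
      _ = _ := by ring
  calc _ = y * pk I t *
        (|1 + 2 * t * x - x ^ 2 - y ^ 2| / ((t - x) ^ 2 + y ^ 2) * (1 + |t|)) := by ring
    _ ≤ y * pk I t * (E * F) := by gcongr
    _ = _ := by ring

/-- The real part of `quoGen φ` is a multiple of the height. -/
lemma InnerQuo.quoGen_re (h : InnerQuo φ) {z : ℂ} (hz : 0 < z.im) :
    (quoGen φ z).re = z.im * (quoGen φ I).re := by
  have hI : 0 < I.im := by simp
  obtain ⟨D, hD, hb⟩ := exists_pk_sub_le hz
  have hpI : ∀ t, 0 ≤ pk I t := fun t => pk_nonneg hI t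
  have hpI1 : ∀ t, pk I t ≤ 1 := fun t => by
    simp only [pk, I_im, I_re, sub_zero]
    rw [div_le_one (by positivity)]
    nlinarith [Real.pi_gt_three, sq_nonneg t]
  have key : ∀ R : ℝ, 1 ≤ R →
      |(quoGen φ z).re - z.im * (quoGen φ I).re| ≤ D / R * (quoGen φ I).re := by
    intro R hR
    have hR0 : 0 < R := by linarith
    have hl : Tendsto (fun m : ℝ => |(1 - (quoExt φ m z).re) / m -
        z.im * ((1 - (quoExt φ m I).re) / m)|) (𝓝[>] 0)
        (𝓝 |(quoGen φ z).re - z.im * (quoGen φ I).re|) :=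
      ((h.tendsto_div hz).sub ((h.tendsto_div hI).const_mul _)).abs
    have hr : Tendsto (fun m : ℝ => D * (∫ t in (-R)..R, quoDens φ m t) +
        D / R * ((1 - (quoExt φ m I).re) / m)) (𝓝[>] 0)
        (𝓝 (D * 0 + D / R * (quoGen φ I).re)) :=
      ((h.tendsto_integral_quoDens hR).const_mul D).add ((h.tendsto_div hI).const_mul _)
    rw [mul_zero, zero_add] at hr
    refine le_of_tendsto_of_tendsto hl hr ?_
    filter_upwards [self_mem_nhdsWithin] with m hm
    have hd := quoDens_nonneg h.unimod hm
    have i1 := integrable_mul_quoDens h.unimod hm (integrable_pk hz)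
    have i2 := integrable_mul_quoDens h.unimod hm (integrable_pk hI)
    have i3 : Integrable (fun t => (Set.Ioc (-R) R).indicator (quoDens φ m) t) := by
      rw [integrable_indicator_iff measurableSet_Ioc]
      have := integrable_mul_quoDens h.unimod hm
        (E := volume.restrict (Set.Ioc (-R) R)) (integrable_const (1:ℝ))
      simpa [IntegrableOn] using this
    rw [← integral_quoDens_pk h.unimod m hz, ← integral_quoDens_pk h.unimod m hI,
      ← integral_const_mul, ← integral_const_mul, ← integral_sub i1 (i2.const_mul _),
      intervalIntegral.integral_of_le (by linarith), ← integral_indicator measurableSet_Ioc,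
      ← integral_const_mul, ← integral_add (i3.const_mul _) (i2.const_mul _),
      ← Real.norm_eq_abs]
    refine norm_integral_le_of_norm_le ((i3.const_mul _).add (i2.const_mul _))
      (Eventually.of_forall fun t => ?_)
    have e : quoDens φ m t * pk z t - z.im * (quoDens φ m t * pk I t) =
      quoDens φ m t * (pk z t - z.im * pk I t) := by ring
    rw [e, Real.norm_eq_abs, abs_mul, abs_of_nonneg (hd t)]
    have h1 := hb t
    have h2 := abs_nonneg (pk z t - z.im * pk I t)
    by_cases ht : t ∈ Set.Ioc (-R) R
    · simp only [Set.indicator_of_mem ht]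
      have h3 : |pk z t - z.im * pk I t| ≤ D := by
        have : D * pk I t ≤ D := mul_le_of_le_one_right hD (hpI1 t)
        nlinarith [mul_nonneg h2 (abs_nonneg t)]
      have h4 : 0 ≤ D / R * (quoDens φ m t * pk I t) :=
        mul_nonneg (by positivity) (mul_nonneg (hd t) (hpI t))
      nlinarith [mul_le_mul_of_nonneg_left h3 (hd t)]
    · simp only [Set.indicator_of_notMem ht, mul_zero, zero_add]
      have hRt : R ≤ |t| := by
        by_contra hcon
        rw [not_le, abs_lt] at hcon
        exact ht ⟨hcon.1, hcon.2.le⟩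
      have h3 : |pk z t - z.im * pk I t| ≤ D / R * pk I t := by
        rw [div_mul_eq_mul_div, le_div_iff₀ hR0]
        exact (mul_le_mul_of_nonneg_left (by linarith) h2).trans h1
      calc _ ≤ quoDens φ m t * (D / R * pk I t) := mul_le_mul_of_nonneg_left h3 (hd t)
        _ = _ := by ring
  have hlim : Tendsto (fun R : ℝ => D / R * (quoGen φ I).re) atTop (𝓝 0) := by
    simpa using (tendsto_const_nhds.div_atTop tendsto_id).mul_const (quoGen φ I).re
  have h0 := ge_of_tendsto hlim (by
    filter_upwards [eventually_ge_atTop 1] with R hR using key R hR)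
  exact sub_eq_zero.1 (abs_nonpos_iff.1 h0)

end

section

variable {φ : ℝ → ℂ}

lemma InnerQuo.exists_quoGen_eq (h : InnerQuo φ) :
    ∃ l s : ℝ, 0 ≤ s ∧ ∀ z : ℂ, 0 < z.im → quoGen φ z = I * l - I * s * z := by
  set s := (quoGen φ I).re
  have hd : DifferentiableOn ℂ (fun z => quoGen φ z + I * s * z) {z | 0 < z.im} :=
    h.differentiableOn_quoGen.add (by fun_prop)
  have hconv : Convex ℝ {z : ℂ | 0 < z.im} := convex_halfSpace_im_gt 0
  obtain ⟨l, hl⟩ := (hd.analyticOnNhd isOpen_upper).eq_re_add_const_mul_I_of_re_eq_const (c₀ := 0)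
    (fun z hz => by simp [h.quoGen_re hz, s, mul_comm]) isOpen_upper
    ⟨⟨I, by simp⟩, hconv.isPreconnected⟩
  refine ⟨l, s, h.quoGen_re_nonneg (by simp), fun z hz => ?_⟩
  have := hl z hz
  rw [ofReal_zero, zero_add] at this
  linear_combination this

lemma quo_parab (l s m x : ℝ) : quo (parab l s) m x =
    exp (-(I * l * m) - I * s * m ^ 2 / 2) * chr (s * m) x := by
  have := (unimod_parab l s).conj_mul x
  rw [quo, parab_sub]
  linear_combination (exp (-(I * l * m) - I * s * m ^ 2 / 2) * chr (s * m) x) * this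

lemma InnerQuo.exists_quo_eq (h : InnerQuo φ) :
    ∃ l s : ℝ, 0 ≤ s ∧ ∀ m : ℝ, 0 ≤ m → quo φ m =ᵐ[volume] quo (parab l s) m := by
  obtain ⟨l, s, hs, hq⟩ := h.exists_quoGen_eq
  refine ⟨l, s, hs, fun m hm => ?_⟩
  have hp := (unimod_parab l s).quo m
  have hU : ∀ x δ : ℝ, 0 < δ → poisInt (quo φ m) (x + δ * I) =
      quo (parab l s) m x * Real.exp (-(s * m * δ)) := by
    intro x δ hδ
    have hz : 0 < ((x : ℂ) + δ * I).im := by simpa using hδ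
    change quoExt φ m (x + δ * I) = _
    rw [h.quoExt_eq_exp hz hm, quo_parab, chr, ofReal_exp, ← exp_add, ← exp_add]
    congr 1
    have e : ∫ t in (0:ℝ)..m, quoGen φ (x + δ * I - t) =
        ∫ t in (0:ℝ)..m, ((I * l - I * s * (x + δ * I)) + I * s * t) := by
      congr 1; funext t
      rw [hq _ (by simpa using hδ)]
      ring
    have e2 : ∫ t in (0:ℝ)..m, (t : ℂ) = ((m ^ 2 / 2 : ℝ) : ℂ) := by
      rw [intervalIntegral.integral_ofReal, integral_id]
      congr 1; ring
    rw [e, intervalIntegral.integral_add intervalIntegrable_const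
      (Continuous.intervalIntegrable (by fun_prop) _ _), intervalIntegral.integral_const,
      intervalIntegral.integral_const_mul, e2]
    simp only [sub_zero, real_smul]
    push_cast
    linear_combination ((s : ℂ) * m * δ) * I_sq
  have hgi : ∀ {u : ℝ → ℂ}, Unimod u → ∀ A, MeasurableSet A → volume A < ⊤ →
      IntegrableOn u A := by
    intro u hu A _ hA
    have : IsFiniteMeasure (volume.restrict A) := ⟨by simpa using hA⟩
    have := hu.bdd.integrable_mul (E := volume.restrict A) (integrable_const (1:ℂ))
    simpa [IntegrableOn] using this
  refine ae_eq_of_forall_setIntegral_eq_of_sigmaFinite (hgi (h.unimod.quo m)) (hgi hp)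
    fun A hA hA' => ?_
  set G : ℝ → ℂ := A.indicator fun _ => 1 with hG
  have hGi : Integrable G := (integrable_indicator_iff hA).2 (integrableOn_const hA'.ne)
  have hGm : ∀ u : ℝ → ℂ, ∫ x, G x * u x = ∫ x in A, u x := by
    intro u
    rw [← integral_indicator hA]
    congr 1; funext x
    by_cases hx : x ∈ A <;> simp [hG, hx]
  rw [← hGm, ← hGm]
  have h1 := tendsto_integral_mul_poisInt hGi (h.unimod.quo m).bdd
  have h2 : Tendsto (fun δ : ℝ => (∫ x, G x * quo (parab l s) m x) *
      (Real.exp (-(s * m * δ)) : ℂ)) (𝓝[>] 0)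
      (𝓝 (∫ x, G x * quo (parab l s) m x)) := by
    have hc : Continuous fun δ : ℝ => (∫ x, G x * quo (parab l s) m x) *
      (Real.exp (-(s * m * δ)) : ℂ) := by fun_prop
    have := (hc.tendsto 0).mono_left (nhdsWithin_le_nhds (s := Set.Ioi 0))
    simpa using this
  refine tendsto_nhds_unique h1 (h2.congr' ?_)
  filter_upwards [self_mem_nhdsWithin] with δ hδ
  rw [← integral_mul_const]
  congr 1; funext x
  rw [hU x δ hδ, mul_assoc]

/-- A function invariant under all right translations is constant. -/
lemma exists_ae_eq_const {ρ : ℝ → ℂ} (hρ : Measurable ρ)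
    (h : ∀ m : ℝ, 0 ≤ m → ∀ᵐ x : ℝ, ρ (x - m) = ρ x) : ∃ x₀, ∀ᵐ y : ℝ, ρ y = ρ x₀ := by
  have hμ : ∀ᵐ m : ℝ, ∀ᵐ x : ℝ, 0 ≤ m → ρ (x - m) = ρ x := by
    refine Eventually.of_forall fun m => ?_
    by_cases hm : 0 ≤ m
    · filter_upwards [h m hm] with x hx _ using hx
    · exact Eventually.of_forall fun x h => absurd h hm
  rw [Measure.ae_ae_comm] at hμ
  swap
  · have hS : MeasurableSet {x : ℝ × ℝ | ρ (x.2 - x.1) = ρ x.2} :=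
      measurableSet_eq_fun (hρ.comp (measurable_snd.sub measurable_fst)) (hρ.comp measurable_snd)
    have hS' : MeasurableSet {x : ℝ × ℝ | 0 ≤ x.1} := measurableSet_le measurable_const measurable_fst
    convert hS'.compl.union hS using 1
    ext x
    simp only [Set.mem_ofPred_eq, Set.mem_union, Set.mem_compl_iff, imp_iff_not_or]
  have hμ' : ∀ᵐ x : ℝ, ∀ᵐ y : ℝ, y ≤ x → ρ y = ρ x := by
    filter_upwards [hμ] with x hx
    filter_upwards [(Measure.measurePreserving_sub_left volume x).quasiMeasurePreserving.ae hx]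
      with y hy hyx
    have := hy (by linarith)
    rwa [sub_sub_cancel] at this
  have hex : ∀ {P : ℝ → Prop} (a b : ℝ), a < b → (∀ᵐ x : ℝ, P x) → ∃ x, a < x ∧ x < b ∧ P x := by
    intro P a b hab hP
    by_contra hcon
    have h0 : ∀ᵐ x : ℝ, x ∉ Set.Ioo a b := by
      filter_upwards [hP] with x hx hx'
      exact hcon ⟨x, hx'.1, hx'.2, hx⟩
    have h1 : volume (Set.Ioo a b) = 0 := measure_eq_zero_iff_ae_notMem.2 h0
    rw [Real.volume_Ioo, ENNReal.ofReal_eq_zero] at h1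
    linarith
  obtain ⟨x₀, -, -, hx₀⟩ := hex 0 1 one_pos hμ'
  refine ⟨x₀, ?_⟩
  have hn : ∀ n : ℕ, ∀ᵐ y : ℝ, y ≤ n → ρ y = ρ x₀ := by
    intro n
    obtain ⟨x, hx1, -, hx⟩ := hex (max (n : ℝ) x₀) (max (n : ℝ) x₀ + 1) (by linarith) hμ'
    have hx2 := (le_max_right (n : ℝ) x₀).trans hx1.le
    have hx3 := (le_max_left (n : ℝ) x₀).trans hx1.le
    obtain ⟨y, -, hy, hy1, hy2⟩ := hex (x₀ - 1) x₀ (by linarith) (hx.and hx₀)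
    have e : ρ x = ρ x₀ := (hy1 (hy.le.trans hx2)).symm.trans (hy2 hy.le)
    filter_upwards [hx] with w hw hwn
    rw [hw (hwn.trans hx3), e]
  filter_upwards [ae_all_iff.2 hn] with y hy
  obtain ⟨n, hn⟩ := exists_nat_ge y
  exact hy n hn

lemma InnerQuo.exists_ae_eq_parab (h : InnerQuo φ) :
    ∃ l s : ℝ, 0 ≤ s ∧ ∃ c : ℂ, c ≠ 0 ∧ φ =ᵐ[volume] fun x => c * parab l s x := by
  obtain ⟨l, s, hs, hq⟩ := h.exists_quo_eq
  have hp := unimod_parab l s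
  refine ⟨l, s, hs, ?_⟩
  have hρ : Unimod fun x => φ x * conj (parab l s x) := h.unimod.mul hp.conj
  obtain ⟨x₀, h1⟩ := exists_ae_eq_const hρ.meas fun m hm => by
    filter_upwards [hq m hm] with x hx
    rw [quo, quo] at hx
    have e1 := h.unimod.conj_mul x
    have e2 := hp.conj_mul (x - m)
    linear_combination (φ x * conj (parab l s (x - m))) * hx -
      (φ (x - m) * conj (parab l s (x - m))) * e1 + (φ x * conj (parab l s x)) * e2
  refine ⟨φ x₀ * conj (parab l s x₀), fun h0 => ?_, ?_⟩
  · have := hρ.norm x₀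
    rw [h0, norm_zero] at this
    exact zero_ne_one this
  · filter_upwards [h1] with x hx
    rw [← hx, mul_assoc, hp.conj_mul, mul_one]

lemma SemiInv.exists_parab (hφ : Unimod φ) (hI : SemiInv (mulHardy 2 φ)) :
    ∃ l s : ℝ, 0 ≤ s ∧ mulHardy 2 φ = mulHardy 2 (parab l s) := by
  obtain ⟨l, s, hs, c, hc, h⟩ := (hI.innerQuo hφ).exists_ae_eq_parab
  refine ⟨l, s, hs, Set.ext fun g => ?_⟩
  rw [mem_mulHardy_iff hφ, mem_mulHardy_iff (unimod_parab l s)]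
  have hc' : conj c ≠ 0 := (map_ne_zero _).2 hc
  constructor
  · intro hg
    refine (hg.const_mul (conj c)⁻¹).congr ?_
    filter_upwards [h] with x hx
    rw [hx, map_mul]
    field_simp
  · intro hg
    refine (hg.const_mul (conj c)).congr ?_
    filter_upwards [h] with x hx
    rw [hx, map_mul, mul_assoc]

/-- Closed subspaces of `L²(ℝ)` invariant under both semigroups. -/
lemma SemiInv.isModel {K : Submodule ℂ (LpR 2)} (hK : IsClosed (K : Set (LpR 2)))
    (hI : SemiInv (K : Set (LpR 2))) : IsModel (K : Set (LpR 2)) := by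
  rcases hI.beurling hK with hd | ⟨φ, hφ, h⟩
  · exact hI.isModel_of_doubly hK hd
  · rw [h] at hI
    obtain ⟨l, s, hs, h2⟩ := hI.exists_parab hφ
    exact Or.inr (Or.inr (Or.inr ⟨l, s, hs, h.trans h2⟩))

end

/-- For `p ∈ (1,∞)`, the closed subspaces of `L^p(ℝ)` invariant under the
parabolic algebra are exactly `{0}`, `L^p(ℝ)`, the spaces `L^p[t,∞)` for `t ∈ ℝ`, and the
spaces `K_{λ,s}^p = e^{iλx} e^{-isx²/2} H^p(ℝ)` for `λ ∈ ℝ`, `s ≥ 0`. -/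
theorem lat_parabolicAlgebra
    (p : ℝ≥0∞) [Fact (1 ≤ p)] (hp : 1 < p) (hp' : p ≠ ⊤)
    (K : Submodule ℂ (LpR p)) (hK : IsClosed (K : Set (LpR p))) :
    (∀ T ∈ parabolicAlgebra p, ∀ f ∈ K, T f ∈ K) ↔
      ((K : Set (LpR p)) = {0} ∨ (K : Set (LpR p)) = Set.univ ∨
       (∃ t : ℝ, (K : Set (LpR p)) = LpHalfLine p t) ∨
       (∃ l s : ℝ, 0 ≤ s ∧ (K : Set (LpR p)) =
          mulHardy p (fun x => Complex.exp (Complex.I * l * x) *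
            Complex.exp (-(Complex.I * s * x ^ 2) / 2)))) := by
  rw [inv_iff K hK]
  exact ⟨fun hI => isModel_of_transfer hp hp' (q := 2) (by norm_num) (by simp) hK hI
    (SemiInv.isModel (Submodule.isClosed_topologicalClosure _) (semiInv_transfer hI)),
    fun h => semiInv_of_isModel hp' h⟩

end
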